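/- Let Λ be a self-affine Sierpiński sponge with expansion integers a_1 > a_2 > ⋯ > a_d ≥ 2 and let φ : Λ → ℝ^N be a continuous potential. Then for every α ∈ A(φ), the packing dimension of the Birkhoff level set satisfies dim_P E_φ(α) = H^1(f,φ,α)/log a_1 + Σ_{k=2}^d (1/log a_k − 1/log a_{k−1}) · H^k(f,φ,α). -/

import Mathlib

open MeasureTheory Filter Topology Metric Set
open scoped ENNReal NNReal

noncomputable section

/-- Shannon entropy of the partition of `X` induced by a map into a finite type. -/
def entPart {X : Type*} [MeasurableSpace X] (μ : Measure X) {ι : Type*} [Fintype ι]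
    (p : X → ι) : ℝ :=
  ∑ i, Real.negMulLog ((μ (p ⁻¹' {i})).toReal)

/-- Kolmogorov–Sinai (measure-theoretic) entropy of `T` with respect to `μ`:
the supremum over finite measurable partitions (coded by measurable maps into `Fin m`)
of the limit (= infimum, by subadditivity) of the averaged entropies of the dynamical
refinements of the partition. -/
def ksEntropy {X : Type*} [MeasurableSpace X] (T : X → X) (μ : Measure X) : ℝ :=
  ⨆ m : ℕ, ⨆ p : {p : X → Fin m // Measurable p},
    ⨅ n : ℕ, ((n : ℝ) + 1)⁻¹ *
      entPart μ (fun x => fun k : Fin (n + 1) => p.1 (T^[(k : ℕ)] x))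

/-- Minimal number of balls of radius `r` needed to cover `s`. -/
def coverN {X : Type*} [PseudoMetricSpace X] (s : Set X) (r : ℝ) : ℕ :=
  sInf {n : ℕ | ∃ t : Finset X, t.card = n ∧ s ⊆ ⋃ x ∈ t, Metric.ball x r}

/-- Upper box (Minkowski) dimension. -/
def upperBoxDim {X : Type*} [PseudoMetricSpace X] (s : Set X) : ℝ :=
  Filter.limsup (fun r : ℝ => Real.log (coverN s r) / Real.log r⁻¹) (nhdsWithin 0 (Set.Ioi 0))

/-- Packing dimension, via countable covers and upper box dimension. -/
def packingDim {X : Type*} [PseudoMetricSpace X] (s : Set X) : ℝ :=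
  ⨅ C : {C : ℕ → Set X // s ⊆ ⋃ n, C n}, ⨆ n, upperBoxDim (C.1 n)

/-- The `n`-th empirical (Birkhoff average) measure `A_{n+1}(δ_x)` of the orbit of `x`. -/
def empirical {X : Type*} [MeasurableSpace X] (T : X → X) (x : X) (n : ℕ) : Measure X :=
  (((n : ℝ≥0∞) + 1))⁻¹ • ∑ l ∈ Finset.range (n + 1), Measure.dirac (T^[l] x)

instance empirical_prob {X : Type*} [MeasurableSpace X] (T : X → X) (x : X) (n : ℕ) :
    IsProbabilityMeasure (empirical T x n) := by
  constructor
  have h : ∀ l : ℕ, Measure.dirac (T^[l] x) (Set.univ : Set X) = 1 := fun l => by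
    simp [measure_univ]
  simp only [empirical, Measure.smul_apply, Measure.coe_finset_sum, Finset.sum_apply, h,
    Finset.sum_const, Finset.card_range, nsmul_eq_mul, mul_one, smul_eq_mul]
  rw [Nat.cast_add, Nat.cast_one, ENNReal.inv_mul_cancel] <;> simp [Nat.cast_add_one_ne_zero]

/-- The `n`-th empirical measure as a probability measure. -/
def empiricalPM {X : Type*} [MeasurableSpace X] (T : X → X) (x : X) (n : ℕ) :
    ProbabilityMeasure X := ⟨empirical T x n, empirical_prob T x n⟩

/-- `V(x)`: the set of weak* accumulation points of the sequence of empirical measures of `x`. -/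
def accPts {X : Type*} [MeasurableSpace X] [TopologicalSpace X] [OpensMeasurableSpace X]
    (T : X → X) (x : X) : Set (ProbabilityMeasure X) :=
  {μ | MapClusterPt μ atTop (fun n => empiricalPM T x n)}

/-- A probability measure is invariant for `T`. -/
def IsInvariantPM {X : Type*} [MeasurableSpace X] (T : X → X)
    (μ : ProbabilityMeasure X) : Prop :=
  (μ : Measure X).map T = (μ : Measure X)

/-- Convexity of a set of probability measures. -/
def IsConvexPMSet {X : Type*} [MeasurableSpace X] (A : Set (ProbabilityMeasure X)) : Prop :=
  ∀ μ ∈ A, ∀ ν ∈ A, ∀ t : ℝ≥0, t ≤ 1 → ∀ ρ : ProbabilityMeasure X,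
    (ρ : Measure X) = t • (μ : Measure X) + (1 - t) • (ν : Measure X) → ρ ∈ A


/-- The left shift. -/
def shiftMap {β : Type*} (ω : ℕ → β) : ℕ → β := fun n => ω (n + 1)

/-- The index set of the first `d + 1 - j` coordinates (those kept by `η_{j+1}`). -/
def TruncIdx (d : ℕ) (j : Fin (d + 1)) : Type := {q : Fin (d + 1) // q.1 + j.1 < d + 1}

/-- `η_{j+1}` : drop the last `j` coordinates of a digit. -/
def ηmap {d : ℕ} (j : Fin (d + 1)) (v : Fin (d + 1) → ℕ) : TruncIdx d j → ℕ :=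
  fun q => v q.1

/-- The symbolic space `Σ = D^ℕ` over the digit set `D`. -/
abbrev SymbSpace {d : ℕ} (D : Finset (Fin (d + 1) → ℕ)) : Type := ℕ → {v // v ∈ D}

/-- `χ_{j+1} : Σ → Σ_{j+1}`, coordinatewise application of `η_{j+1}`. -/
def chi {d : ℕ} (D : Finset (Fin (d + 1) → ℕ)) (j : Fin (d + 1)) (ω : SymbSpace D) :
    ℕ → (TruncIdx d j → ℕ) := fun n => ηmap j (ω n).1

/-- The coding map `Π : Σ → 𝕋^{d+1}`. -/
def coding {d : ℕ} (a : Fin (d + 1) → ℕ) (D : Finset (Fin (d + 1) → ℕ)) (ω : SymbSpace D) :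
    Fin (d + 1) → AddCircle (1 : ℝ) :=
  fun q => ((∑' ν : ℕ, ((ω ν).1 q : ℝ) / (a q : ℝ) ^ (ν + 1) : ℝ) : AddCircle (1 : ℝ))

/-- The self-affine Sierpiński sponge `Λ`. -/
def sponge {d : ℕ} (a : Fin (d + 1) → ℕ) (D : Finset (Fin (d + 1) → ℕ)) :
    Set (Fin (d + 1) → AddCircle (1 : ℝ)) := Set.range (coding a D)

/-- λ-exponents `λ_k = log a_{d+1} / log a_k` (with `λ_0 = 0`), indexed by `k : ℕ`. -/
def lamN (d : ℕ) (a : Fin (d + 1) → ℕ) (k : ℕ) : ℝ :=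
  if h : k ≤ d + 1 ∧ 0 < k then
    Real.log (a (Fin.last d)) / Real.log (a ⟨k - 1, by omega⟩) else 0

/-- The torus map `f`. -/
def affineTorusMap {d : ℕ} (a : Fin (d + 1) → ℕ) (x : Fin (d + 1) → AddCircle (1 : ℝ)) :
    Fin (d + 1) → AddCircle (1 : ℝ) := fun q => a q • x q

/-- Index set for `π_{j+1}` : the coordinates `≥ j`. -/
def ProjIdx (d : ℕ) (j : Fin (d + 1)) : Type := {q : Fin (d + 1) // j ≤ q}

/-- `π_{j+1} : 𝕋^{d+1} → 𝕋^{d+1-j}`. -/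
def torusProj {d : ℕ} (j : Fin (d + 1)) (x : Fin (d + 1) → AddCircle (1 : ℝ)) :
    ProjIdx d j → AddCircle (1 : ℝ) := fun q => x q.1

/-- `f_{j+1}`, the factor map on the last coordinates. -/
def torusFactorMap {d : ℕ} (a : Fin (d + 1) → ℕ) (j : Fin (d + 1))
    (x : ProjIdx d j → AddCircle (1 : ℝ)) : ProjIdx d j → AddCircle (1 : ℝ) :=
  fun q => a q.1 • x q

/-- The spectrum combination `H_1/log a_1 + Σ_{k=2}^{d+1} (1/log a_k - 1/log a_{k-1}) H_k`. -/
def dimCombo {d : ℕ} (a : Fin (d + 1) → ℕ) (H : Fin (d + 1) → ℝ) : ℝ :=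
  H 0 / Real.log (a 0) +
    ∑ i : Fin d, (1 / Real.log (a i.succ) - 1 / Real.log (a i.castSucc)) * H i.succ


/-- `M(Λ,f)`: the `f`-invariant Borel probability measures carried by the sponge `Λ`. -/
def MemSpongeInv {d : ℕ} (a : Fin (d + 1) → ℕ) (D : Finset (Fin (d + 1) → ℕ))
    (μ : ProbabilityMeasure (Fin (d + 1) → AddCircle (1 : ℝ))) : Prop :=
  IsInvariantPM (affineTorusMap a) μ ∧
    (μ : Measure (Fin (d + 1) → AddCircle (1 : ℝ))) (sponge a D) = 1

/-- The Birkhoff average sequence of `φ` at `x`. -/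
def birkhoffSeq {d N : ℕ} (a : Fin (d + 1) → ℕ)
    (φ : (Fin (d + 1) → AddCircle (1 : ℝ)) → (Fin N → ℝ))
    (x : Fin (d + 1) → AddCircle (1 : ℝ)) (n : ℕ) : Fin N → ℝ :=
  (n : ℝ)⁻¹ • ∑ q ∈ Finset.range n, φ ((affineTorusMap a)^[q] x)

/-- The Birkhoff level set `E_φ(α) ⊆ Λ`. -/
def birkhoffLevel {d N : ℕ} (a : Fin (d + 1) → ℕ) (D : Finset (Fin (d + 1) → ℕ))
    (φ : (Fin (d + 1) → AddCircle (1 : ℝ)) → (Fin N → ℝ)) (α : Fin N → ℝ) :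
    Set (Fin (d + 1) → AddCircle (1 : ℝ)) :=
  {x | x ∈ sponge a D ∧ Tendsto (birkhoffSeq a φ x) atTop (𝓝 α)}

/-- `H^{j+1}(f, φ, α)`. -/
def HkLevel {d N : ℕ} (a : Fin (d + 1) → ℕ) (D : Finset (Fin (d + 1) → ℕ))
    (φ : (Fin (d + 1) → AddCircle (1 : ℝ)) → (Fin N → ℝ)) (α : Fin N → ℝ)
    (j : Fin (d + 1)) : ℝ :=
  sSup {h : ℝ | ∃ μ : ProbabilityMeasure (Fin (d + 1) → AddCircle (1 : ℝ)),
    MemSpongeInv a D μ ∧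
    (∫ x, φ x ∂(μ : Measure (Fin (d + 1) → AddCircle (1 : ℝ)))) = α ∧
    h = ksEntropy (torusFactorMap a j)
      ((μ : Measure (Fin (d + 1) → AddCircle (1 : ℝ))).map (torusProj j))}

/-! ### Shannon entropy of finite-valued maps -/

section Entropy

variable {X : Type*} [MeasurableSpace X] {ι κ : Type*} [Fintype ι] [Fintype κ]

lemma negMulLog_sum_le {τ : Type*} (s : Finset τ) (p : τ → ℝ) (hp : ∀ i ∈ s, 0 ≤ p i) :
    Real.negMulLog (∑ i ∈ s, p i) ≤ ∑ i ∈ s, Real.negMulLog (p i) := by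
  have h : Real.negMulLog (∑ i ∈ s, p i) = ∑ i ∈ s, -(p i * Real.log (∑ j ∈ s, p j)) := by
    rw [Finset.sum_neg_distrib, ← Finset.sum_mul, Real.negMulLog, neg_mul]
  rw [h]
  refine Finset.sum_le_sum fun i hi => ?_
  rw [Real.negMulLog, neg_mul, neg_le_neg_iff]
  rcases (hp i hi).eq_or_lt with h0 | h0
  · simp [← h0]
  · exact mul_le_mul_of_nonneg_left
      (Real.log_le_log h0 (Finset.single_le_sum hp hi)) h0.le

/-- Gibbs' inequality. -/
lemma sum_negMulLog_le_of_sum_le_one {p q : ι → ℝ} (hp : ∀ i, 0 ≤ p i) (hq : ∀ i, 0 ≤ q i)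
    (hp1 : ∑ i, p i = 1) (hq1 : ∑ i, q i ≤ 1) (hpq : ∀ i, q i = 0 → p i = 0) :
    ∑ i, Real.negMulLog (p i) ≤ ∑ i, p i * (-Real.log (q i)) := by
  have key : ∀ i, Real.negMulLog (p i) - p i * (-Real.log (q i)) ≤ q i - p i := by
    intro i
    rcases (hp i).eq_or_lt with h0 | h0
    · simp [← h0, hq i]
    · have hq0 : 0 < q i := (hq i).lt_of_ne fun h => h0.ne' (hpq i h.symm)
      have h1 := Real.log_le_sub_one_of_pos (div_pos hq0 h0)
      rw [Real.log_div hq0.ne' h0.ne'] at h1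
      have h2 := mul_le_mul_of_nonneg_left h1 h0.le
      have h3 : p i * (q i / p i - 1) = q i - p i := by field_simp
      rw [h3] at h2
      rw [Real.negMulLog]
      linarith
  have h := Finset.sum_le_sum fun i (_ : i ∈ Finset.univ) => key i
  rw [Finset.sum_sub_distrib, Finset.sum_sub_distrib] at h
  linarith

variable [MeasurableSpace ι] [MeasurableSingletonClass ι] (μ : Measure X)

lemma measureReal_comp_preimage {κ : Type*} [IsFiniteMeasure μ] [DecidableEq κ] {f : X → ι}
    (hf : Measurable f) (g : ι → κ) (k : κ) :
    μ.real ((fun x => g (f x)) ⁻¹' {k}) =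
      ∑ i with g i = k, μ.real (f ⁻¹' {i}) := by
  have h : (fun x => g (f x)) ⁻¹' {k} =
      ⋃ i ∈ (Finset.univ.filter fun i => g i = k), f ⁻¹' {i} := by
    ext x; simp
  rw [h, measureReal_biUnion_finset]
  · intro i _ j _ hij
    exact Disjoint.preimage f (by simpa using hij)
  · intro i _
    exact hf (measurableSet_singleton i)

lemma sum_measureReal_mul_comp [IsFiniteMeasure μ] {f : X → ι} (hf : Measurable f)
    (g : ι → κ) (F : κ → ℝ) :
    ∑ i, μ.real (f ⁻¹' {i}) * F (g i) =
      ∑ k, μ.real ((fun x => g (f x)) ⁻¹' {k}) * F k := by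
  classical
  simp_rw [measureReal_comp_preimage μ hf g, Finset.sum_mul]
  rw [← Finset.sum_fiberwise (s := Finset.univ) (g := g)]
  refine Finset.sum_congr rfl fun k _ => Finset.sum_congr rfl fun i hi => ?_
  rw [(Finset.mem_filter.1 hi).2]

lemma sum_measureReal_preimage [IsProbabilityMeasure μ] {f : X → ι} (hf : Measurable f) :
    ∑ i, μ.real (f ⁻¹' {i}) = 1 := by
  have h := sum_measureReal_mul_comp μ hf (fun _ => ()) (fun _ => 1)
  simpa using h

lemma entPart_eq (f : X → κ) : entPart μ f = ∑ i, Real.negMulLog (μ.real (f ⁻¹' {i})) := rfl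

lemma entPart_nonneg [IsProbabilityMeasure μ] (f : X → κ) : 0 ≤ entPart μ f :=
  Finset.sum_nonneg fun _ _ => Real.negMulLog_nonneg measureReal_nonneg measureReal_le_one

lemma entPart_comp_le [IsFiniteMeasure μ] {f : X → ι} (hf : Measurable f) (g : ι → κ) :
    entPart μ (fun x => g (f x)) ≤ entPart μ f := by
  classical
  rw [entPart_eq, entPart_eq, ← Finset.sum_fiberwise (s := Finset.univ) (g := g)]
  refine Finset.sum_le_sum fun k _ => ?_
  rw [measureReal_comp_preimage μ hf g k]
  exact negMulLog_sum_le _ _ fun _ _ => measureReal_nonneg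

lemma entPart_le_of_sum_le_one [IsProbabilityMeasure μ] {f : X → ι} (hf : Measurable f)
    {q : ι → ℝ} (hq : ∀ i, 0 ≤ q i) (hq1 : ∑ i, q i ≤ 1)
    (hpq : ∀ i, q i = 0 → μ.real (f ⁻¹' {i}) = 0) :
    entPart μ f ≤ ∑ i, μ.real (f ⁻¹' {i}) * (-Real.log (q i)) :=
  sum_negMulLog_le_of_sum_le_one (fun _ => measureReal_nonneg) hq
    (sum_measureReal_preimage μ hf) hq1 hpq

lemma entPart_le_log_card [IsProbabilityMeasure μ] {f : X → ι} (hf : Measurable f) :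
    entPart μ f ≤ Real.log (Fintype.card ι) := by
  have hX : Nonempty X := nonempty_of_isProbabilityMeasure μ
  have hι : Nonempty ι := hX.map f
  have h := entPart_le_of_sum_le_one μ hf (q := fun _ => (Fintype.card ι : ℝ)⁻¹)
    (fun _ => by positivity) (by simp) (fun i hi => absurd hi (by simp))
  refine h.trans_eq ?_
  rw [← Finset.sum_mul, sum_measureReal_preimage μ hf, Real.log_inv]
  ring

lemma entPart_pi_le [IsProbabilityMeasure μ] {τ : Type*} [Fintype τ] [DecidableEq τ]
    {Y : τ → X → ι}
    (hY : ∀ t, Measurable (Y t)) :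
    entPart μ (fun x t => Y t x) ≤ ∑ t, entPart μ (Y t) := by
  have hm : Measurable (fun x t => Y t x) := measurable_pi_lambda _ hY
  have hcoord : ∀ (t : τ) (u : τ → ι),
      μ.real ((fun x t => Y t x) ⁻¹' {u}) ≤ μ.real (Y t ⁻¹' {u t}) := by
    intro t u
    refine measureReal_mono fun x hx => ?_
    have : (fun t => Y t x) = u := hx
    simp [← this]
  refine (entPart_le_of_sum_le_one μ hm (q := fun u => ∏ t, μ.real (Y t ⁻¹' {u t}))
    (fun u => Finset.prod_nonneg fun _ _ => measureReal_nonneg) ?_ ?_).trans_eq ?_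
  · have h := Finset.prod_univ_sum (fun _ : τ => (Finset.univ : Finset ι))
      (fun t i => μ.real (Y t ⁻¹' {i}))
    rw [Fintype.piFinset_univ] at h
    rw [← h]
    simp [sum_measureReal_preimage μ (hY _)]
  · intro u hu
    obtain ⟨t, -, ht⟩ := Finset.prod_eq_zero_iff.1 hu
    exact le_antisymm ((hcoord t u).trans_eq ht) measureReal_nonneg
  · have h1 : ∀ u : τ → ι, μ.real ((fun x t => Y t x) ⁻¹' {u}) *
        (-Real.log (∏ t, μ.real (Y t ⁻¹' {u t}))) =
        ∑ t, μ.real ((fun x t => Y t x) ⁻¹' {u}) * (-Real.log (μ.real (Y t ⁻¹' {u t}))) := by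
      intro u
      by_cases h0 : μ.real ((fun x t => Y t x) ⁻¹' {u}) = 0
      · simp [h0]
      · rw [Real.log_prod, ← Finset.sum_neg_distrib, Finset.mul_sum]
        intro t _ ht
        exact h0 (le_antisymm ((hcoord t u).trans_eq ht) measureReal_nonneg)
    simp_rw [h1]
    rw [Finset.sum_comm]
    refine Finset.sum_congr rfl fun t _ => ?_
    rw [sum_measureReal_mul_comp μ hm (fun u => u t)
      (fun i => -Real.log (μ.real (Y t ⁻¹' {i})))]
    simp [entPart_eq, Real.negMulLog]

lemma entPart_prod_le [IsProbabilityMeasure μ] [MeasurableSpace κ] [MeasurableSingletonClass κ]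
    {f : X → ι} {g : X → κ} (hf : Measurable f) (hg : Measurable g) :
    entPart μ (fun x => (f x, g x)) ≤ entPart μ f + entPart μ g := by
  have hm : Measurable (fun x => (f x, g x)) := hf.prodMk hg
  have h1 : ∀ u : ι × κ, μ.real ((fun x => (f x, g x)) ⁻¹' {u}) ≤ μ.real (f ⁻¹' {u.1}) :=
    fun u => measureReal_mono fun x hx => by
      have : (f x, g x) = u := hx
      simp [← this]
  have h2 : ∀ u : ι × κ, μ.real ((fun x => (f x, g x)) ⁻¹' {u}) ≤ μ.real (g ⁻¹' {u.2}) :=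
    fun u => measureReal_mono fun x hx => by
      have : (f x, g x) = u := hx
      simp [← this]
  refine (entPart_le_of_sum_le_one μ hm
    (q := fun u => μ.real (f ⁻¹' {u.1}) * μ.real (g ⁻¹' {u.2}))
    (fun u => mul_nonneg measureReal_nonneg measureReal_nonneg) ?_ ?_).trans_eq ?_
  · rw [Fintype.sum_prod_type]
    simp_rw [← Finset.mul_sum, sum_measureReal_preimage μ hg, mul_one]
    exact (sum_measureReal_preimage μ hf).le
  · intro u hu
    rcases mul_eq_zero.1 hu with h | h
    · exact le_antisymm ((h1 u).trans_eq h) measureReal_nonneg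
    · exact le_antisymm ((h2 u).trans_eq h) measureReal_nonneg
  · have h3 : ∀ u : ι × κ, μ.real ((fun x => (f x, g x)) ⁻¹' {u}) *
        (-Real.log (μ.real (f ⁻¹' {u.1}) * μ.real (g ⁻¹' {u.2}))) =
        μ.real ((fun x => (f x, g x)) ⁻¹' {u}) * (-Real.log (μ.real (f ⁻¹' {u.1}))) +
        μ.real ((fun x => (f x, g x)) ⁻¹' {u}) * (-Real.log (μ.real (g ⁻¹' {u.2}))) := by
      intro u
      by_cases h0 : μ.real ((fun x => (f x, g x)) ⁻¹' {u}) = 0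
      · simp [h0]
      · rw [Real.log_mul (fun h => h0 (le_antisymm ((h1 u).trans_eq h) measureReal_nonneg))
          (fun h => h0 (le_antisymm ((h2 u).trans_eq h) measureReal_nonneg))]
        ring
    simp_rw [h3]
    rw [Finset.sum_add_distrib,
      sum_measureReal_mul_comp μ hm Prod.fst (fun i => -Real.log (μ.real (f ⁻¹' {i}))),
      sum_measureReal_mul_comp μ hm Prod.snd (fun i => -Real.log (μ.real (g ⁻¹' {i})))]
    simp [entPart_eq, Real.negMulLog]

/-- If `h` is a function of `(f, e)` where `e` takes values in a finite type `κ`, then its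
entropy exceeds that of `f` by at most `log (card κ)`. -/
lemma entPart_le_add_log_card [IsProbabilityMeasure μ] [MeasurableSpace κ]
    [MeasurableSingletonClass κ] {τ : Type*} [Fintype τ]
    {f : X → ι} {e : X → κ} (hf : Measurable f) (he : Measurable e) (g : ι × κ → τ) :
    entPart μ (fun x => g (f x, e x)) ≤ entPart μ f + Real.log (Fintype.card κ) :=
  (entPart_comp_le μ (hf.prodMk he) g).trans <|
    (entPart_prod_le μ hf he).trans (by gcongr; exact entPart_le_log_card μ he)

/-- A variable that is almost constant has small entropy. -/
lemma exists_entPart_lt_of_measureReal_le (ι : Type*) [Fintype ι] [MeasurableSpace ι]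
    [MeasurableSingletonClass ι] {ε : ℝ} (hε : 0 < ε) :
    ∃ δ > 0, ∀ {X : Type*} [MeasurableSpace X] (μ : Measure X) [IsProbabilityMeasure μ]
      (f : X → ι) (_ : Measurable f) (i₀ : ι), μ.real (f ⁻¹' {i₀}ᶜ) ≤ δ →
        entPart μ f ≤ ε := by
  classical
  set c : ℝ := Fintype.card ι + 1 with hc
  have hc0 : 0 < c := by positivity
  have hcont0 : ∀ᶠ x in 𝓝 (0 : ℝ), Real.negMulLog x < ε / c :=
    Real.continuous_negMulLog.continuousAt.eventually_lt continuousAt_const (by simp; positivity)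
  have hcont1 : ∀ᶠ x in 𝓝 (1 : ℝ), Real.negMulLog x < ε / c :=
    Real.continuous_negMulLog.continuousAt.eventually_lt continuousAt_const (by simp; positivity)
  obtain ⟨δ0, hδ0, h0⟩ := Metric.eventually_nhds_iff.1 hcont0
  obtain ⟨δ1, hδ1, h1⟩ := Metric.eventually_nhds_iff.1 hcont1
  refine ⟨min δ0 δ1 / 2, by positivity, ?_⟩
  intro X _ μ _ f hf i₀ hle
  have hlt : μ.real (f ⁻¹' {i₀}ᶜ) < min δ0 δ1 := by
    have : 0 < min δ0 δ1 := by positivity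
    linarith
  have hterm : ∀ i, Real.negMulLog (μ.real (f ⁻¹' {i})) ≤ ε / c := by
    intro i
    by_cases hi : i = i₀
    · subst hi
      refine (h1 ?_).le
      have h2 := probReal_compl_eq_one_sub (μ := μ) (hf (measurableSet_singleton i))
      rw [← preimage_compl] at h2
      rw [Real.dist_eq, abs_lt]
      have := min_le_right δ0 δ1
      have h3 : 0 ≤ μ.real (f ⁻¹' {i}ᶜ) := measureReal_nonneg
      constructor <;> linarith
    · refine (h0 ?_).le
      rw [Real.dist_eq, sub_zero, abs_of_nonneg measureReal_nonneg]
      refine lt_of_le_of_lt (measureReal_mono (preimage_mono ?_)) (hlt.trans_le (min_le_left _ _))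
      simpa [eq_comm] using hi
  rw [entPart_eq]
  refine (Finset.sum_le_sum fun i _ => hterm i).trans ?_
  rw [Finset.sum_const, nsmul_eq_mul, Finset.card_univ, ← mul_div_assoc, div_le_iff₀ hc0, hc]
  nlinarith

/-- Concavity of the entropy in the measure, for finite averages. -/
lemma sum_mul_entPart_le {τ : Type*} (s : Finset τ) (w : τ → ℝ) (hw : ∀ t ∈ s, 0 ≤ w t)
    (hw1 : ∑ t ∈ s, w t = 1) (ν : τ → Measure X) (f : X → κ)
    (hμ : ∀ k, μ.real (f ⁻¹' {k}) = ∑ t ∈ s, w t * (ν t).real (f ⁻¹' {k})) :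
    ∑ t ∈ s, w t * entPart (ν t) f ≤ entPart μ f := by
  simp_rw [entPart_eq, Finset.mul_sum]
  rw [Finset.sum_comm]
  refine Finset.sum_le_sum fun k _ => ?_
  rw [hμ k]
  have := Real.concaveOn_negMulLog.le_map_sum (t := s) (w := w)
    (p := fun t => (ν t).real (f ⁻¹' {k})) hw hw1 (fun t _ => measureReal_nonneg)
  simpa using this

lemma entPart_map {Y : Type*} [MeasurableSpace Y] {T : X → Y} (hT : Measurable T) {f : Y → ι}
    (hf : Measurable f) : entPart (μ.map T) f = entPart μ (fun x => f (T x)) := by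
  rw [entPart_eq, entPart_eq]
  refine Finset.sum_congr rfl fun i _ => ?_
  rw [map_measureReal_apply hT (hf (measurableSet_singleton i))]
  rfl

end Entropy

/-! ### Birkhoff sums on symbolic spaces -/

section Symbolic

lemma shiftMap_iterate {β : Type*} (n : ℕ) (ω : ℕ → β) (p : ℕ) :
    shiftMap^[n] ω p = ω (p + n) := by
  induction n generalizing p with
  | zero => rfl
  | succ n ih => rw [Function.iterate_succ_apply', shiftMap, ih]; congr 1; omega

/-- The Birkhoff sum `∑_{i < n} ψ (σ^i ω)`. -/
def birkSum {β E : Type*} [AddCommMonoid E] (ψ : (ℕ → β) → E) (n : ℕ) (ω : ℕ → β) : E :=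
  ∑ i ∈ Finset.range n, ψ (shiftMap^[i] ω)

/-- The sequence that follows `ω` before time `T` and then runs through `ω'` from its start. -/
def splice {β : Type*} (T : ℕ) (ω ω' : ℕ → β) : ℕ → β := fun p => if p < T then ω p else ω' (p - T)

lemma splice_of_lt {β : Type*} {T p : ℕ} (h : p < T) (ω ω' : ℕ → β) :
    splice T ω ω' p = ω p := if_pos h

lemma splice_add {β : Type*} (T p : ℕ) (ω ω' : ℕ → β) : splice T ω ω' (T + p) = ω' p := by
  simp [splice]

lemma birkSum_add {β E : Type*} [AddCommMonoid E] (ψ : (ℕ → β) → E) (m n : ℕ) (ω : ℕ → β) :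
    birkSum ψ (m + n) ω = birkSum ψ m ω + birkSum ψ n (shiftMap^[m] ω) := by
  rw [birkSum, Finset.sum_range_add]
  simp_rw [birkSum, ← Function.iterate_add_apply, add_comm m]

lemma birkSum_mul {β E : Type*} [AddCommMonoid E] (ψ : (ℕ → β) → E) (m n : ℕ) (ω : ℕ → β) :
    birkSum ψ (n * m) ω = ∑ b ∈ Finset.range n, birkSum ψ m (shiftMap^[b * m] ω) := by
  induction n with
  | zero => simp [birkSum]
  | succ n ih => rw [Nat.succ_mul, birkSum_add, ih, Finset.sum_range_succ]

lemma continuous_shiftMap {β : Type*} [TopologicalSpace β] :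
    Continuous (shiftMap : (ℕ → β) → ℕ → β) :=
  continuous_pi fun n => continuous_apply (n + 1)

lemma birkSum_norm_le {β E : Type*} [NormedAddCommGroup E] {ψ : (ℕ → β) → E} {C : ℝ}
    (hC : ∀ ω, ‖ψ ω‖ ≤ C) (n : ℕ) (ω : ℕ → β) :
    ‖birkSum ψ n ω‖ ≤ n * C := by
  refine (norm_sum_le_of_le _ fun i _ => hC _).trans_eq ?_
  simp

lemma exists_norm_le_of_continuous {β E : Type*} [TopologicalSpace β] [Finite β]
    [NormedAddCommGroup E] {ψ : (ℕ → β) → E} (hψ : Continuous ψ) :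
    ∃ C, 0 ≤ C ∧ ∀ ω, ‖ψ ω‖ ≤ C := by
  obtain ⟨C, hC⟩ := (isCompact_range hψ).isBounded.exists_norm_le
  exact ⟨max C 0, le_max_right _ _, fun ω => (hC _ ⟨ω, rfl⟩).trans (le_max_left _ _)⟩

variable {A : Type*} [TopologicalSpace A] [DiscreteTopology A] [Finite A]
  {E : Type*} [NormedAddCommGroup E]

lemma exists_agree_norm_sub_le {ψ : (ℕ → A) → E} (hψ : Continuous ψ) {ε : ℝ} (hε : 0 < ε) :
    ∃ l : ℕ, ∀ ω ω' : ℕ → A, (∀ p < l, ω p = ω' p) → ‖ψ ω - ψ ω'‖ ≤ ε := by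
  have h1 : ∀ ω : ℕ → A, ∃ l : ℕ, ∀ ω' ∈ PiNat.cylinder ω l, ‖ψ ω' - ψ ω‖ ≤ ε / 2 := by
    intro ω
    have hU : {ω' | ‖ψ ω' - ψ ω‖ < ε / 2} ∈ 𝓝 ω := by
      refine IsOpen.mem_nhds (isOpen_lt (by fun_prop) continuous_const) ?_
      simpa using half_pos hε
    obtain ⟨t, ⟨y, l, rfl⟩, hωt, ht⟩ :=
      (PiNat.isTopologicalBasis_cylinders (fun _ : ℕ => A)).mem_nhds_iff.1 hU
    refine ⟨l, fun ω' hω' => ?_⟩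
    have : ω' ∈ PiNat.cylinder y l := by
      rw [PiNat.mem_cylinder_iff] at *
      exact fun i hi => (hω' i hi).trans (hωt i hi)
    exact (ht this).le
  choose l hl using h1
  obtain ⟨t, -, ht⟩ := isCompact_univ.elim_nhds_subcover
    (fun ω : ℕ → A => PiNat.cylinder ω (l ω))
    (fun ω _ => (PiNat.isOpen_cylinder (fun _ => A) ω (l ω)).mem_nhds (PiNat.self_mem_cylinder _ _))
  refine ⟨t.sup l, fun ω ω' h => ?_⟩
  obtain ⟨ω₀, hω₀, hmem⟩ := mem_iUnion₂.1 (ht (mem_univ ω))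
  have hmem' : ω' ∈ PiNat.cylinder ω₀ (l ω₀) := by
    rw [PiNat.mem_cylinder_iff] at *
    intro i hi
    rw [← h i (hi.trans_le (Finset.le_sup hω₀)), hmem i hi]
  have := norm_sub_le_norm_sub_add_norm_sub (ψ ω) (ψ ω₀) (ψ ω')
  have h3 := hl ω₀ _ hmem
  have h4 := hl ω₀ _ hmem'
  rw [norm_sub_rev] at h4
  linarith

/-- Birkhoff sums of length `m` depend on the first `m` symbols up to an error `o(m)`. -/
lemma exists_birkSum_sub_le {ψ : (ℕ → A) → E} (hψ : Continuous ψ) {ε : ℝ} (hε : 0 < ε) :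
    ∃ M : ℕ, ∀ m ≥ M, ∀ ω ω' : ℕ → A, (∀ p < m, ω p = ω' p) →
      ‖birkSum ψ m ω - birkSum ψ m ω'‖ ≤ ε * m := by
  obtain ⟨C, hC0, hC⟩ := exists_norm_le_of_continuous hψ
  obtain ⟨l, hl⟩ := exists_agree_norm_sub_le hψ (half_pos hε)
  obtain ⟨M, hM⟩ := exists_nat_ge (2 * C * l / (ε / 2))
  refine ⟨M, fun m hm ω ω' h => ?_⟩
  have hterm : ∀ i ∈ Finset.range m, ‖ψ (shiftMap^[i] ω) - ψ (shiftMap^[i] ω')‖ ≤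
      ε / 2 + if m < i + l then 2 * C else 0 := by
    intro i hi
    split_ifs with hil
    · have := norm_sub_le (ψ (shiftMap^[i] ω)) (ψ (shiftMap^[i] ω'))
      have h1 := hC (shiftMap^[i] ω)
      have h2 := hC (shiftMap^[i] ω')
      linarith
    · rw [add_zero]
      refine hl _ _ fun p hp => ?_
      rw [shiftMap_iterate, shiftMap_iterate]
      exact h _ (by omega)
  rw [birkSum, birkSum, ← Finset.sum_sub_distrib]
  refine (norm_sum_le_of_le _ hterm).trans ?_
  rw [Finset.sum_add_distrib, ← Finset.sum_filter, Finset.sum_const, Finset.sum_const,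
    Finset.card_range, nsmul_eq_mul, nsmul_eq_mul]
  have hcard : ((Finset.range m).filter fun i => m < i + l).card ≤ l := by
    have : ((Finset.range m).filter fun i => m < i + l) ⊆ Finset.Ico (m + 1 - l) m := by
      intro i hi
      simp only [Finset.mem_filter, Finset.mem_range, Finset.mem_Ico] at *
      omega
    refine (Finset.card_le_card this).trans ?_
    rw [Nat.card_Ico]; omega
  have hcard' : (((Finset.range m).filter fun i => m < i + l).card : ℝ) ≤ l := by
    exact_mod_cast hcard
  have hm' : 2 * C * l / (ε / 2) ≤ m := hM.trans (by exact_mod_cast hm)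
  rw [div_le_iff₀ (half_pos hε)] at hm'
  nlinarith

/-- Projected words of length `m` admitting a lift whose Birkhoff average is `δ`-close to `α`. -/
def goodWords {A B E : Type*} [NormedAddCommGroup E] (π : A → B) (ψ : (ℕ → A) → E) (α : E)
    (m : ℕ) (δ : ℝ) : Set (Fin m → B) :=
  {u | ∃ ω : ℕ → A, ‖birkSum ψ m ω - m • α‖ ≤ δ * m ∧ ∀ i : Fin m, π (ω i) = u i}

end Symbolic

/-! ### From many good words to invariant measures of large entropy -/

section Misiurewicz

/-- The word of length `n` read off by `π` along `ω`. -/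
def wordMap {A B : Type*} (π : A → B) (n : ℕ) (ω : ℕ → A) : Fin n → B := fun k => π (ω k)

/-- The uniform average of the Dirac masses at the points `x t`, `t ∈ s`. -/
def avgDirac {X τ : Type*} [MeasurableSpace X] (s : Finset τ) (x : τ → X) : Measure X :=
  (s.card : ℝ≥0∞)⁻¹ • ∑ t ∈ s, Measure.dirac (x t)

variable {X τ : Type*} [MeasurableSpace X] (s : Finset τ) (x : τ → X)

lemma isProbabilityMeasure_avgDirac (hs : s.Nonempty) : IsProbabilityMeasure (avgDirac s x) := by
  constructor
  simp only [avgDirac, Measure.smul_apply, Measure.coe_finsetSum, Finset.sum_apply, measure_univ,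
    Finset.sum_const, nsmul_eq_mul, mul_one, smul_eq_mul]
  exact ENNReal.inv_mul_cancel (by simpa using hs.ne_empty) (by simp)

lemma integral_avgDirac (f : X → ℝ) (hf : StronglyMeasurable f) :
    ∫ y, f y ∂(avgDirac s x) = (s.card : ℝ)⁻¹ * ∑ t ∈ s, f (x t) := by
  rw [avgDirac, integral_smul_measure, integral_finsetSum_measure]
  · simp [integral_dirac' f _ hf]
  · intro t _
    exact integrable_dirac' hf (by simp)

lemma avgDirac_real (S : Set X) (hS : MeasurableSet S) :
    (avgDirac s x).real S = (s.card : ℝ)⁻¹ * ∑ t ∈ s, S.indicator 1 (x t) := by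
  have := integral_avgDirac s x (S.indicator 1) ((stronglyMeasurable_one).indicator hS)
  rwa [integral_indicator_one hS] at this

lemma log_card_le_entPart_avgDirac {κ : Type*} [Fintype κ] [MeasurableSpace κ]
    [MeasurableSingletonClass κ] (G : Finset κ) (hG : G.Nonempty)
    (y : κ → X) (W : X → κ) (hW : Measurable W) (hWy : ∀ u ∈ G, W (y u) = u) :
    Real.log G.card ≤ entPart (avgDirac G y) W := by
  classical
  have hpr : ∀ u ∈ G, (avgDirac G y).real (W ⁻¹' {u}) = (G.card : ℝ)⁻¹ := by
    intro u hu
    rw [avgDirac_real _ _ _ (hW (measurableSet_singleton u))]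
    have : ∑ t ∈ G, (W ⁻¹' {u}).indicator (1 : X → ℝ) (y t) = ∑ t ∈ G, if t = u then 1 else 0 := by
      refine Finset.sum_congr rfl fun t ht => ?_
      simp [indicator_apply, hWy t ht]
    rw [this]
    simp [hu]
  have := isProbabilityMeasure_avgDirac G y hG
  rw [entPart_eq]
  refine le_trans (le_of_eq ?_) (Finset.sum_le_sum_of_subset_of_nonneg (Finset.subset_univ G)
    fun u _ _ => Real.negMulLog_nonneg measureReal_nonneg measureReal_le_one)
  rw [Finset.sum_congr rfl fun u hu => by rw [hpr u hu]]
  have : (G.card : ℝ) ≠ 0 := by simpa using hG.ne_empty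
  rw [Finset.sum_const, nsmul_eq_mul, Real.negMulLog, Real.log_inv]
  field_simp

lemma sum_range_mul_eq {M : Type*} [AddCommMonoid M] (F : ℕ → M) (n q : ℕ) :
    ∑ i ∈ Finset.range (q * n), F i =
      ∑ l ∈ Finset.range q, ∑ j ∈ Finset.range n, F (l * n + j) := by
  induction q with
  | zero => simp
  | succ q ih => rw [Nat.succ_mul, Finset.sum_range_add, ih, Finset.sum_range_succ]

lemma measurable_wordMap {A B : Type*} [MeasurableSpace A] [DiscreteMeasurableSpace A]
    [MeasurableSpace B] (π : A → B) (n : ℕ) : Measurable (wordMap π n) :=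
  measurable_pi_lambda _ fun _ => Measurable.of_discrete.comp (measurable_pi_apply _)

lemma measurable_shiftMap {A : Type*} [MeasurableSpace A] :
    Measurable (shiftMap : (ℕ → A) → ℕ → A) :=
  measurable_pi_lambda _ fun _ => measurable_pi_apply _

variable {A B : Type*} [MeasurableSpace A] [DiscreteMeasurableSpace A]
  [Fintype B] [MeasurableSpace B] [MeasurableSingletonClass B] (π : A → B)

lemma mul_log_card_le_of_word_lift {m : ℕ} (hm : 0 < m) (G : Finset (Fin m → B))
    (hG : G.Nonempty)
    (y : (Fin m → B) → ℕ → A) (hy : ∀ u ∈ G, wordMap π m (y u) = u) (n : ℕ) (hn : 0 < n) :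
    n * Real.log G.card ≤
      m * entPart (avgDirac (G ×ˢ Finset.range m) fun t => shiftMap^[t.2] (y t.1)) (wordMap π n) +
        2 * n * (n * Real.log (Fintype.card B)) := by
  classical
  set P := avgDirac G y with hP
  have hPp : IsProbabilityMeasure P := isProbabilityMeasure_avgDirac G y hG
  set Y : ℕ → (ℕ → A) → (Fin n → B) := fun i ω => wordMap π n (shiftMap^[i] ω) with hY
  have hYm : ∀ i, Measurable (Y i) := fun i =>
    (measurable_wordMap π n).comp (measurable_shiftMap.iterate i)
  have hYle : ∀ i, entPart P (Y i) ≤ n * Real.log (Fintype.card B) := by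
    intro i
    refine (entPart_le_log_card P (hYm i)).trans_eq ?_
    rw [Fintype.card_fun, Fintype.card_fin, Nat.cast_pow, Real.log_pow]
  have hstep : ∀ j < n, Real.log G.card ≤ entPart P (Y 0) +
      ∑ l ∈ Finset.range (m / n + 1), entPart P (Y (l * n + j)) := by
    intro j hj
    refine (log_card_le_entPart_avgDirac G hG y (wordMap π m) (measurable_wordMap π m) hy).trans ?_
    set Z : Fin (m / n + 1) → (ℕ → A) → (Fin n → B) := fun l => Y (l * n + j) with hZ
    have hZm : Measurable (fun ω l => Z l ω) := measurable_pi_lambda _ fun l => hYm _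
    have hlt : ∀ i : Fin m, (i.1 - j) / n < m / n + 1 := fun i =>
      Nat.lt_succ_of_le (Nat.div_le_div_right (by omega))
    let g : (Fin n → B) × (Fin (m / n + 1) → Fin n → B) → (Fin m → B) := fun v i =>
      if h : i.1 < n then v.1 ⟨i, h⟩ else
        v.2 ⟨(i.1 - j) / n, hlt i⟩ ⟨(i.1 - j) % n, Nat.mod_lt _ hn⟩
    have hg : wordMap π m = fun ω => g (Y 0 ω, fun l => Z l ω) := by
      ext ω i
      simp only [g, hZ, hY, wordMap]
      split_ifs with h
      · rfl
      · rw [shiftMap_iterate]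
        congr 2
        have := Nat.mod_add_div' (i.1 - j) n
        omega
    rw [hg]
    refine (entPart_comp_le P ((hYm 0).prodMk hZm) g).trans ?_
    refine (entPart_prod_le P (hYm 0) hZm).trans ?_
    gcongr
    refine (entPart_pi_le P fun l => hYm _).trans_eq ?_
    rw [Finset.sum_range]
  have hsum := Finset.sum_le_sum fun j (hj : j ∈ Finset.range n) => hstep j (Finset.mem_range.1 hj)
  rw [Finset.sum_add_distrib, Finset.sum_comm,
    ← sum_range_mul_eq (fun i => entPart P (Y i))] at hsum
  simp only [Finset.sum_const, Finset.card_range, nsmul_eq_mul] at hsum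
  have hle1 : ∑ i ∈ Finset.range ((m / n + 1) * n), entPart P (Y i) ≤
      ∑ i ∈ Finset.range (m + n), entPart P (Y i) := by
    refine Finset.sum_le_sum_of_subset_of_nonneg ?_ fun i _ _ => entPart_nonneg P _
    refine Finset.range_subset_range.2 ?_
    have := Nat.div_mul_le_self m n
    rw [Nat.succ_mul]; omega
  rw [Finset.sum_range_add] at hle1
  have hle2 : ∑ i ∈ Finset.range n, entPart P (Y (m + i)) ≤
      n * (n * Real.log (Fintype.card B)) := by
    refine (Finset.sum_le_sum fun i _ => hYle _).trans_eq ?_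
    simp
  have hle3 : ∑ i ∈ Finset.range m, entPart P (Y i) ≤
      m * entPart (avgDirac (G ×ˢ Finset.range m) fun t => shiftMap^[t.2] (y t.1))
        (wordMap π n) := by
    have hmR : (m : ℝ) ≠ 0 := by exact_mod_cast hm.ne'
    have h := sum_mul_entPart_le
      (avgDirac (G ×ˢ Finset.range m) fun t => shiftMap^[t.2] (y t.1)) (Finset.range m)
      (fun _ => (m : ℝ)⁻¹) (fun _ _ => by positivity) (by simp [hmR])
      (fun i => P.map shiftMap^[i]) (wordMap π n) (by
        intro k
        have hk := measurable_wordMap π n (measurableSet_singleton k)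
        rw [avgDirac_real _ _ _ hk, Finset.sum_product_right, Finset.card_product,
          Finset.card_range, Nat.cast_mul, Finset.mul_sum]
        refine Finset.sum_congr rfl fun i _ => ?_
        rw [map_measureReal_apply (measurable_shiftMap.iterate i) hk, hP,
          avgDirac_real _ _ _ (measurable_shiftMap.iterate i hk), mul_inv]
        simp only [indicator_apply, mem_preimage, Pi.one_apply]
        ring)
    rw [← Finset.mul_sum, inv_mul_le_iff₀ (by positivity)] at h
    refine le_trans (le_of_eq ?_) h
    refine Finset.sum_congr rfl fun i _ => ?_
    rw [entPart_map P (measurable_shiftMap.iterate i) (measurable_wordMap π n)]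
  have hle4 : (n : ℝ) * entPart P (Y 0) ≤ n * (n * Real.log (Fintype.card B)) := by
    gcongr; exact hYle 0
  linarith

end Misiurewicz

/-! ### Invariant measures as limits of orbit averages -/

section Limit

lemma integral_avgDirac_orbit {X τ : Type*} [MeasurableSpace X] (G : Finset τ) (m : ℕ) (T : X → X)
    (y : τ → X) (f : X → ℝ) (hf : StronglyMeasurable f) :
    ∫ x, f x ∂(avgDirac (G ×ˢ Finset.range m) fun t => T^[t.2] (y t.1)) =
      (G.card : ℝ)⁻¹ * ∑ u ∈ G, (m : ℝ)⁻¹ * ∑ i ∈ Finset.range m, f (T^[i] (y u)) := by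
  rw [integral_avgDirac _ _ _ hf, Finset.sum_product, Finset.card_product, Finset.card_range,
    Nat.cast_mul, mul_inv, mul_assoc, Finset.mul_sum]

lemma abs_inv_card_mul_sum_sub_le {τ : Type*} {G : Finset τ} (hG : G.Nonempty) {F : τ → ℝ}
    {b c : ℝ} (h : ∀ u ∈ G, |F u - b| ≤ c) : |(G.card : ℝ)⁻¹ * ∑ u ∈ G, F u - b| ≤ c := by
  have hc : (0 : ℝ) < G.card := by exact_mod_cast hG.card_pos
  have : (G.card : ℝ)⁻¹ * ∑ u ∈ G, F u - b = (G.card : ℝ)⁻¹ * ∑ u ∈ G, (F u - b) := by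
    rw [Finset.sum_sub_distrib]; simp; field_simp
  rw [this, abs_mul, abs_of_pos (by positivity), inv_mul_le_iff₀ hc]
  refine (Finset.abs_sum_le_sum_abs _ _).trans ((Finset.sum_le_sum h).trans_eq ?_)
  simp

lemma isClopen_wordMap_preimage {A B : Type*} [TopologicalSpace A] [DiscreteTopology A]
    (π : A → B) (n : ℕ) (u : Fin n → B) :
    IsClopen (wordMap π n ⁻¹' {u}) := by
  have : wordMap π n ⁻¹' {u} = ⋂ k : Fin n, (fun ω : ℕ → A => ω k) ⁻¹' (π ⁻¹' {u k}) := by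
    ext ω; simp [wordMap, funext_iff]
  rw [this]
  exact isClopen_iInter_of_finite fun k =>
    (isClopen_discrete (π ⁻¹' {u k})).preimage (continuous_apply _)

variable {A B : Type*} [TopologicalSpace A] [DiscreteTopology A] [Finite A] [MeasurableSpace A]
  [BorelSpace A] [Fintype B]

theorem exists_invariant_of_card_goodWords {N : ℕ} (π : A → B) (ψ : (ℕ → A) → Fin N → ℝ)
    (hψ : Continuous ψ) (α : Fin N → ℝ) (h : ℝ)
    (H : ∀ δ > 0, ∀ M : ℕ, ∃ m ≥ M, Real.exp (m * h) ≤ (goodWords π ψ α m δ).ncard) :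
    ∃ ν : ProbabilityMeasure (ℕ → A), IsInvariantPM shiftMap ν ∧ ∫ ω, ψ ω ∂(ν : Measure _) = α ∧
      ∀ n : ℕ, n * h ≤ entPart (ν : Measure (ℕ → A)) (wordMap π n) := by
  classical
  let δ : ℕ → ℝ := fun j => 1 / ((j : ℝ) + 1)
  have hδ : ∀ j, 0 < δ j := fun j => by positivity
  have hδ0 : Tendsto δ atTop (𝓝 0) := tendsto_one_div_add_atTop_nhds_zero_nat
  choose m hmj hm using fun j : ℕ => H (δ j) (hδ j) (j + 1)
  have hm0 : ∀ j, 0 < m j := fun j => (Nat.succ_pos j).trans_le (hmj j)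
  have hmR : ∀ j, (0 : ℝ) < m j := fun j => by exact_mod_cast hm0 j
  have hminv : ∀ j, (m j : ℝ)⁻¹ ≤ δ j := by
    intro j
    rw [← one_div]
    exact one_div_le_one_div_of_le (by positivity) (by exact_mod_cast hmj j)
  let G : ∀ j, Finset (Fin (m j) → B) := fun j => (toFinite (goodWords π ψ α (m j) (δ j))).toFinset
  have hGmem : ∀ j u, u ∈ G j ↔ u ∈ goodWords π ψ α (m j) (δ j) := fun j u =>
    Set.Finite.mem_toFinset _
  have hGcard : ∀ j, Real.exp (m j * h) ≤ (G j).card := fun j => by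
    rw [← Set.ncard_eq_toFinset_card]; exact hm j
  have hGne : ∀ j, (G j).Nonempty := fun j => by
    rw [← Finset.card_pos]
    exact_mod_cast (Real.exp_pos _).trans_le (hGcard j)
  have hne : Nonempty (ℕ → A) := by
    obtain ⟨u, hu⟩ := hGne 0
    obtain ⟨ω, -⟩ := (hGmem 0 u).1 hu
    exact ⟨ω⟩
  have hy : ∀ j, ∃ y : (Fin (m j) → B) → ℕ → A, ∀ u ∈ G j,
      ‖birkSum ψ (m j) (y u) - m j • α‖ ≤ δ j * m j ∧ wordMap π (m j) (y u) = u := by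
    intro j
    have : ∀ u, ∃ ω : ℕ → A, u ∈ G j → ‖birkSum ψ (m j) ω - m j • α‖ ≤ δ j * m j ∧
        wordMap π (m j) ω = u := by
      intro u
      by_cases hu : u ∈ G j
      · obtain ⟨ω, h1, h2⟩ := (hGmem j u).1 hu
        exact ⟨ω, fun _ => ⟨h1, funext h2⟩⟩
      · exact ⟨Classical.arbitrary _, fun h => absurd h hu⟩
    choose y hy using this
    exact ⟨y, fun u hu => hy u hu⟩
  choose y hy using hy
  let μ : ∀ j, Measure (ℕ → A) := fun j =>
    avgDirac (G j ×ˢ Finset.range (m j)) fun t => shiftMap^[t.2] (y j t.1)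
  have hμ : ∀ j, IsProbabilityMeasure (μ j) := fun j =>
    isProbabilityMeasure_avgDirac _ _ ((hGne j).product (by simpa using (hm0 j).ne'))
  have hμi : ∀ j (f : (ℕ → A) → ℝ), Continuous f → ∫ x, f x ∂(μ j) = ((G j).card : ℝ)⁻¹ *
      ∑ u ∈ G j, (m j : ℝ)⁻¹ * ∑ i ∈ Finset.range (m j), f (shiftMap^[i] (y j u)) :=
    fun j f hf => integral_avgDirac_orbit _ _ _ _ _ hf.stronglyMeasurable
  let μ' : ℕ → ProbabilityMeasure (ℕ → A) := fun j => ⟨μ j, hμ j⟩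
  let F : Ultrafilter ℕ := Filter.hyperfilter ℕ
  have hF : (F : Filter ℕ) ≤ atTop := Nat.hyperfilter_le_atTop
  obtain ⟨ν, -, hν⟩ := isCompact_univ.ultrafilter_le_nhds (F.map μ') (by simp)
  have hlim : Tendsto μ' F (𝓝 ν) := hν
  have hint := ProbabilityMeasure.tendsto_iff_forall_integral_tendsto.1 hlim
  refine ⟨ν, ?_, ?_, ?_⟩
  · have : IsProbabilityMeasure ((ν : Measure (ℕ → A)).map shiftMap) :=
      Measure.isProbabilityMeasure_map measurable_shiftMap.aemeasurable
    refine ext_of_forall_integral_eq_of_IsFiniteMeasure fun f => ?_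
    rw [integral_map measurable_shiftMap.aemeasurable f.continuous.aestronglyMeasurable]
    let g : BoundedContinuousFunction (ℕ → A) ℝ :=
      f.compContinuous ⟨shiftMap, continuous_shiftMap⟩
    have hd := (hint g).sub (hint f)
    have hz : Tendsto (fun j => ∫ x, g x ∂(μ j) - ∫ x, f x ∂(μ j)) F (𝓝 0) := by
      refine squeeze_zero_norm (a := fun j => 2 * ‖f‖ * δ j) (fun j => ?_) ?_
      · rw [hμi j _ g.continuous, hμi j _ f.continuous, ← mul_sub, ← Finset.sum_sub_distrib,
          Real.norm_eq_abs, ← sub_zero (_ * _)]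
        refine abs_inv_card_mul_sum_sub_le (hGne j) fun u hu => ?_
        rw [sub_zero, ← mul_sub, ← Finset.sum_sub_distrib]
        have : ∀ i ∈ Finset.range (m j), g (shiftMap^[i] (y j u)) - f (shiftMap^[i] (y j u)) =
            f (shiftMap^[i + 1] (y j u)) - f (shiftMap^[i] (y j u)) := by
          intro i _
          rw [Function.iterate_succ_apply']; rfl
        rw [Finset.sum_congr rfl this, Finset.sum_range_sub (fun i => f (shiftMap^[i] (y j u))),
          abs_mul, abs_of_pos (by have := hmR j; positivity), mul_comm]
        have h1 := f.norm_coe_le_norm (shiftMap^[m j] (y j u))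
        have h2 := f.norm_coe_le_norm (shiftMap^[0] (y j u))
        gcongr
        · refine (abs_sub _ _).trans ?_
          rw [Real.norm_eq_abs] at h1 h2
          linarith
        · exact hminv j
      · simpa using (hδ0.const_mul (2 * ‖f‖)).mono_left hF
    have := tendsto_nhds_unique hd hz
    exact sub_eq_zero.1 this
  · ext c
    have hint' : Integrable ψ (ν : Measure (ℕ → A)) :=
      (BoundedContinuousFunction.mkOfCompact ⟨ψ, hψ⟩).integrable _
    rw [eval_integral fun c => hint'.eval c]
    let g : BoundedContinuousFunction (ℕ → A) ℝ :=
      BoundedContinuousFunction.mkOfCompact ⟨fun ω => ψ ω c, by fun_prop⟩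
    have hd := (hint g).sub_const (α c)
    have hz : Tendsto (fun j => ∫ x, g x ∂(μ j) - α c) F (𝓝 0) := by
      refine squeeze_zero_norm (a := δ) (fun j => ?_) (hδ0.mono_left hF)
      rw [hμi j _ g.continuous, Real.norm_eq_abs]
      refine abs_inv_card_mul_sum_sub_le (hGne j) fun u hu => ?_
      have h1 := (norm_le_pi_norm _ c).trans (hy j u hu).1
      have h2 : ∑ i ∈ Finset.range (m j), g (shiftMap^[i] (y j u)) = birkSum ψ (m j) (y j u) c := by
        rw [birkSum, Finset.sum_apply]; rfl
      have h3 : (m j : ℝ)⁻¹ * ∑ i ∈ Finset.range (m j), g (shiftMap^[i] (y j u)) - α c =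
          (m j : ℝ)⁻¹ * (birkSum ψ (m j) (y j u) - m j • α) c := by
        have := (hmR j).ne'
        rw [h2]; simp; field_simp
      rw [h3, abs_mul, abs_of_pos (by have := hmR j; positivity), inv_mul_le_iff₀ (hmR j), mul_comm]
      exact h1
    have := tendsto_nhds_unique hd hz
    exact sub_eq_zero.1 this
  · intro n
    rcases Nat.eq_zero_or_pos n with rfl | hn
    · simpa using entPart_nonneg (ν : Measure (ℕ → A)) (wordMap π 0)
    let _ : MeasurableSpace B := ⊤
    have hent : Tendsto (fun j => entPart (μ j) (wordMap π n)) F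
        (𝓝 (entPart (ν : Measure (ℕ → A)) (wordMap π n))) := by
      refine tendsto_finsetSum _ fun u _ => ?_
      refine (Real.continuous_negMulLog.tendsto _).comp ?_
      have hcl := isClopen_wordMap_preimage π n u
      have := ProbabilityMeasure.tendsto_measure_of_null_frontier_of_tendsto' hlim
        (E := wordMap π n ⁻¹' {u}) (by rw [hcl.frontier_eq]; simp)
      exact (ENNReal.tendsto_toReal (measure_ne_top _ _)).comp this
    set C : ℝ := 2 * n * (n * Real.log (Fintype.card B)) with hC
    have hC0 : 0 ≤ C := by positivity
    have hbd : ∀ j, n * h - C * δ j ≤ entPart (μ j) (wordMap π n) := by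
      intro j
      have h1 := mul_log_card_le_of_word_lift π (hm0 j) (G j) (hGne j) (y j)
        (fun u hu => (hy j u hu).2) n hn
      have h2 : m j * h ≤ Real.log (G j).card := by
        rw [Real.le_log_iff_exp_le (by exact_mod_cast (hGne j).card_pos)]
        exact hGcard j
      have h3 : (n : ℝ) * (m j * h) ≤ n * Real.log (G j).card := by gcongr
      have h4 : (m j : ℝ) * (n * h - C * (m j : ℝ)⁻¹) ≤ m j * entPart (μ j) (wordMap π n) := by
        have : (m j : ℝ) * (n * h - C * (m j : ℝ)⁻¹) = n * (m j * h) - C := by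
          have := (hmR j).ne'
          field_simp
        rw [this]
        linarith
      have h5 := le_of_mul_le_mul_left h4 (hmR j)
      have h6 := mul_le_mul_of_nonneg_left (hminv j) hC0
      linarith
    have hl : Tendsto (fun j => n * h - C * δ j) F (𝓝 (n * h)) := by
      simpa using ((hδ0.const_mul C).const_sub (n * h)).mono_left hF
    exact le_of_tendsto_of_tendsto' hl hent hbd

end Limit

/-! ### Counting good words by the law of large numbers -/

section LawOfLargeNumbers

open ProbabilityTheory

lemma exists_measure_sum_sub_ge_lt {K E : Type*} [Fintype K] [MeasurableSpace K]
    [MeasurableSingletonClass K] [NormedAddCommGroup E] [NormedSpace ℝ E] [CompleteSpace E]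
    (ρ : Measure K) [IsProbabilityMeasure ρ] (F : K → E) {ε : ℝ} (hε : 0 < ε) :
    ∃ n₀ : ℕ, ∀ n ≥ n₀, 1 / 2 ≤ (Measure.infinitePi fun _ : ℕ => ρ).real
      {w | ‖∑ i ∈ Finset.range n, F (w i) - n • ∫ k, F k ∂ρ‖ ≤ ε * n} := by
  borelize E
  set P := Measure.infinitePi fun _ : ℕ => ρ with hP
  have hF : Measurable F := Measurable.of_discrete
  have hmp : ∀ i : ℕ, MeasurePreserving (fun w : ℕ → K => w i) P ρ := fun i =>
    measurePreserving_eval_infinitePi _ i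
  have hsm : StronglyMeasurable F := StronglyMeasurable.of_discrete
  have hint : Integrable F ρ := .of_finite
  have hlaw := strong_law_ae (μ := P) (fun i w => F (w i))
      ((hmp 0).integrable_comp_of_integrable hint)
    (fun i j hij => (iIndepFun_infinitePi (fun _ : ℕ => hF)).indepFun hij)
    (fun i => ⟨(hF.comp (hmp i).measurable).aemeasurable, (hF.comp (hmp 0).measurable).aemeasurable,
      by
        have h := fun i => Measure.map_map (μ := P) hF (hmp i).measurable
        simp only [Function.comp_def] at h
        rw [← h, ← h, (hmp i).map_eq, (hmp 0).map_eq]⟩)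
  have hmean : ∫ w, F (w 0) ∂P = ∫ k, F k ∂ρ := by
    rw [← (hmp 0).map_eq, integral_map (hmp 0).measurable.aemeasurable hsm.aestronglyMeasurable]
  rw [hmean] at hlaw
  have hmeas : ∀ n : ℕ, StronglyMeasurable
      (fun w : ℕ → K => (n : ℝ)⁻¹ • ∑ i ∈ Finset.range n, F (w i)) := fun n =>
    (Finset.stronglyMeasurable_fun_sum _ fun i _ =>
      hsm.comp_measurable (hmp i).measurable).const_smul _
  have hT := tendstoInMeasure_iff_norm.1
    (tendstoInMeasure_of_tendsto_ae (fun n => (hmeas n).aestronglyMeasurable) hlaw) ε hε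
  have hev := hT.eventually_lt_const (u := (1 / 2 : ℝ≥0∞)) (by simp)
  obtain ⟨n₀, hn₀⟩ := eventually_atTop.1 (hev.and (eventually_gt_atTop 0))
  refine ⟨n₀, fun n hn => ?_⟩
  obtain ⟨h1, h2⟩ := hn₀ n hn
  have h2R : (0 : ℝ) < n := by exact_mod_cast h2
  set S : Set (ℕ → K) := {w | ε ≤ ‖(n : ℝ)⁻¹ • ∑ i ∈ Finset.range n, F (w i) - ∫ k, F k ∂ρ‖} with hS
  have hSm : MeasurableSet S :=
    measurableSet_le measurable_const ((hmeas n).sub stronglyMeasurable_const).norm.measurable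
  have h3 : P.real S ≤ 1 / 2 := by
    have := ENNReal.toReal_mono (by simp) h1.le
    simpa [Measure.real] using this
  have h4 : P.real Sᶜ = 1 - P.real S := probReal_compl_eq_one_sub hSm
  refine le_trans (by rw [h4]; linarith) (measureReal_mono (μ := P) fun w hw => ?_)
  have h5 : ‖(n : ℝ)⁻¹ • ∑ i ∈ Finset.range n, F (w i) - ∫ k, F k ∂ρ‖ ≤ ε := by
    by_contra! hc
    exact hw hc.le
  have h6 : ∑ i ∈ Finset.range n, F (w i) - n • ∫ k, F k ∂ρ =
      (n : ℝ) • ((n : ℝ)⁻¹ • ∑ i ∈ Finset.range n, F (w i) - ∫ k, F k ∂ρ) := by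
    rw [smul_sub, smul_inv_smul₀ h2R.ne', Nat.cast_smul_eq_nsmul]
  change ‖_‖ ≤ _
  rw [h6, norm_smul, Real.norm_of_nonneg h2R.le, mul_comm]
  gcongr

lemma exists_card_typical_ge {K L E : Type*} [Fintype K] [MeasurableSpace K]
    [MeasurableSingletonClass K] [Fintype L] [NormedAddCommGroup E] [NormedSpace ℝ E]
    [CompleteSpace E] (ρ : Measure K) [IsProbabilityMeasure ρ] (F : K → E) (π : K → L)
    {ε : ℝ} (hε : 0 < ε) :
    ∃ n₀ : ℕ, ∀ n ≥ n₀, Real.exp (n * (entPart ρ π - ε)) ≤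
      ({v : Fin n → L | ∃ w : ℕ → K, ‖∑ i ∈ Finset.range n, F (w i) - n • ∫ k, F k ∂ρ‖ ≤ ε * n ∧
        ∀ i : Fin n, π (w i) = v i}).ncard := by
  classical
  let _ : MeasurableSpace L := ⊤
  have hπ : Measurable π := Measurable.of_discrete
  set p : L → ℝ := fun l => ρ.real (π ⁻¹' {l}) with hp
  have hp0 : ∀ l, 0 ≤ p l := fun l => measureReal_nonneg
  let F' : K → E × ℝ := fun k => (F k, -Real.log (p (π k)))
  have hF'mean : ∫ k, F' k ∂ρ = (∫ k, F k ∂ρ, entPart ρ π) := by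
    rw [integral_pair .of_finite .of_finite]
    congr 1
    rw [integral_fintype .of_finite]
    simp only [smul_eq_mul]
    have := sum_measureReal_mul_comp ρ measurable_id π (fun l => -Real.log (p l))
    simp only [id_eq, mul_neg, Set.preimage_id] at this
    simp only [mul_neg]
    rw [this, entPart_eq]
    exact Finset.sum_congr rfl fun l _ => by rw [Real.negMulLog, neg_mul]
  obtain ⟨n₀, hn₀⟩ := exists_measure_sum_sub_ge_lt ρ F' (half_pos hε)
  obtain ⟨n₁, hn₁⟩ := exists_nat_gt (Real.log 2 / (ε / 2))
  refine ⟨max n₀ n₁, fun n hn => ?_⟩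
  have h1 := hn₀ n ((le_max_left _ _).trans hn)
  set P := Measure.infinitePi fun _ : ℕ => ρ with hP
  set V := {v : Fin n → L | ∃ w : ℕ → K, ‖∑ i ∈ Finset.range n, F (w i) - n • ∫ k, F k ∂ρ‖ ≤ ε * n ∧
        ∀ i : Fin n, π (w i) = v i} with hV
  set S := {w : ℕ → K | ‖∑ i ∈ Finset.range n, F' (w i) - n • ∫ k, F' k ∂ρ‖ ≤ ε / 2 * n} with hS
  have hSspec : ∀ w ∈ S, ‖∑ i ∈ Finset.range n, F (w i) - n • ∫ k, F k ∂ρ‖ ≤ ε / 2 * n ∧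
      |∑ i ∈ Finset.range n, -Real.log (p (π (w i))) - n * entPart ρ π| ≤ ε / 2 * n := by
    intro w hw
    have hw' : ‖∑ i ∈ Finset.range n, F' (w i) - n • ∫ k, F' k ∂ρ‖ ≤ ε / 2 * n := hw
    rw [hF'mean] at hw'
    have e1 := (norm_fst_le _).trans hw'
    have e2 := (norm_snd_le _).trans hw'
    simp only [Prod.fst_sub, Prod.snd_sub, Prod.fst_sum, Prod.snd_sum, Prod.smul_fst,
      Prod.smul_snd, nsmul_eq_mul, Real.norm_eq_abs, F'] at e1 e2
    exact ⟨e1, e2⟩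
  let cyl : (Fin n → L) → Set (ℕ → K) := fun v => {w | ∀ i : Fin n, π (w i) = v i}
  let U : Finset (Fin n → L) := Finset.univ.filter fun v => ∃ w ∈ S, w ∈ cyl v
  have hUV : (U : Set (Fin n → L)) ⊆ V := by
    intro v hv
    obtain ⟨w, hw, hwv⟩ := (Finset.mem_filter.1 hv).2
    exact ⟨w, (hSspec w hw).1.trans (by gcongr; linarith), hwv⟩
  have hcyl : ∀ v, P.real (cyl v) = ∏ i, p (v i) := by
    intro v
    have hset : cyl v = ((Finset.range n : Finset ℕ) : Set ℕ).pi
        (fun i => if h : i < n then π ⁻¹' {v ⟨i, h⟩} else univ) := by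
      ext w
      simp only [cyl, mem_ofPred_eq, Set.mem_pi, Finset.coe_range, mem_Iio]
      refine ⟨fun h i hi => by simp [hi, h ⟨i, hi⟩], fun h i => ?_⟩
      simpa [i.2] using h i i.2
    rw [hset, Measure.real, Measure.infinitePi_pi _ (fun i _ => Set.toFinite _ |>.measurableSet),
      ENNReal.toReal_prod, Finset.prod_range]
    refine Finset.prod_congr rfl fun i _ => ?_
    simp [hp, Measure.real]
  have hprod : ∀ v ∈ U, ∏ i, p (v i) ≤ Real.exp (-(n * (entPart ρ π - ε / 2))) := by
    intro v hv
    obtain ⟨w, hw, hwv⟩ := (Finset.mem_filter.1 hv).2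
    by_cases hz : ∃ i, p (v i) = 0
    · obtain ⟨i, hi⟩ := hz
      rw [Finset.prod_eq_zero (Finset.mem_univ i) hi]
      positivity
    push Not at hz
    have hpos : ∀ i, 0 < p (v i) := fun i => (hp0 _).lt_of_ne (hz i).symm
    have e : ∏ i, p (v i) = Real.exp (∑ i, Real.log (p (v i))) := by
      rw [Real.exp_sum]
      exact Finset.prod_congr rfl fun i _ => (Real.exp_log (hpos i)).symm
    rw [e, Real.exp_le_exp]
    have e2 := (abs_le.1 (hSspec w hw).2).1
    rw [Finset.sum_range, Finset.sum_neg_distrib,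
      Finset.sum_congr rfl fun i _ => by rw [hwv i]] at e2
    linarith
  have hsub : S ⊆ ⋃ v ∈ U, cyl v := by
    intro w hw
    refine mem_iUnion₂.2 ⟨fun i => π (w i), ?_, fun i => rfl⟩
    exact Finset.mem_filter.2 ⟨Finset.mem_univ _, w, hw, fun i => rfl⟩
  have h2 : 1 / 2 ≤ U.card * Real.exp (-(n * (entPart ρ π - ε / 2))) := by
    refine h1.trans ((measureReal_mono hsub (measure_ne_top _ _)).trans
      ((measureReal_biUnion_finset_le _ _).trans ?_))
    refine (Finset.sum_le_card_nsmul _ _ _ fun v hv => (hcyl v).trans_le (hprod v hv)).trans_eq ?_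
    simp
  have h3 : (U.card : ℝ) ≤ V.ncard := by
    rw [← Set.ncard_coe_finset U]
    exact_mod_cast Set.ncard_le_ncard hUV (toFinite _)
  refine le_trans ?_ h3
  have hnR : Real.log 2 ≤ ε / 2 * n := by
    have : (n₁ : ℝ) ≤ n := by exact_mod_cast (le_max_right _ _).trans hn
    rw [div_lt_iff₀ (half_pos hε)] at hn₁
    nlinarith
  have h4 : Real.exp (n * (entPart ρ π - ε)) ≤
      1 / 2 * Real.exp (n * (entPart ρ π - ε / 2)) := by
    rw [one_div, ← Real.exp_log (show (0 : ℝ) < 2⁻¹ by norm_num), ← Real.exp_add, Real.exp_le_exp,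
      Real.log_inv]
    linarith
  refine h4.trans ?_
  rw [Real.exp_neg, ← div_eq_mul_inv, le_div_iff₀ (Real.exp_pos _)] at h2
  exact h2

lemma exists_card_goodWords_ge {A B E : Type*} [Fintype A] [Finite B] [MeasurableSpace A]
    [MeasurableSingletonClass A] [NormedAddCommGroup E] [NormedSpace ℝ E] [CompleteSpace E]
    (π : A → B) (ψ : (ℕ → A) → E) (α : E) {m : ℕ} (hm : 0 < m) {δ : ℝ} (hδ : 0 < δ)
    (hψ : ∀ ω ω' : ℕ → A, (∀ p < m, ω p = ω' p) → ‖birkSum ψ m ω - birkSum ψ m ω'‖ ≤ δ * m)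
    (ρ : Measure (Fin m → A)) [IsProbabilityMeasure ρ] (e : (Fin m → A) → ℕ → A)
    (he : ∀ w (i : Fin m), e w i = w i) (hρ : ‖∫ w, birkSum ψ m (e w) ∂ρ - m • α‖ ≤ δ * m)
    {ε : ℝ} (hε : 0 < ε) [Fintype (Fin m → B)] :
    ∃ n₀ : ℕ, ∀ n ≥ n₀, Real.exp (n * (entPart ρ (fun w (i : Fin m) => π (w i)) - ε)) ≤
      (goodWords π ψ α (n * m) (3 * δ)).ncard := by
  have hmR : (1 : ℝ) ≤ m := by exact_mod_cast hm
  obtain ⟨n₀, hn₀⟩ := exists_card_typical_ge ρ (fun w => birkSum ψ m (e w))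
    (fun w (i : Fin m) => π (w i)) (lt_min hδ hε)
  refine ⟨n₀, fun n hn => le_trans (Real.exp_le_exp.2 ?_) ((hn₀ n hn).trans ?_)⟩
  · gcongr
    exact min_le_right _ _
  let J : (Fin n → Fin m → B) → (Fin (n * m) → B) := fun v q =>
    v ⟨q / m, Nat.div_lt_of_lt_mul (by simpa [mul_comm] using q.2)⟩ ⟨q % m, Nat.mod_lt _ hm⟩
  have hJ : Function.Injective J := by
    intro v v' h
    ext b i
    have hlt : b.1 * m + i < n * m := by
      have := Nat.mul_le_mul_right m b.2
      have := i.2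
      rw [Nat.succ_mul] at *
      omega
    have := congrFun h ⟨b * m + i, hlt⟩
    have e1 : (b * m + i) / m = b := by
      rw [mul_comm, Nat.mul_add_div hm, Nat.div_eq_of_lt i.2, add_zero]
    have e2 : (b * m + i) % m = i := by
      rw [Nat.mul_add_mod', Nat.mod_eq_of_lt i.2]
    simpa [J, e1, e2] using this
  have : Finite (Fin (n * m) → B) := Pi.finite
  norm_cast
  refine Set.ncard_le_ncard_of_injOn J ?_ hJ.injOn (toFinite _)
  rintro v ⟨w, hw, hwv⟩
  let ω : ℕ → A := fun p => w (p / m) ⟨p % m, Nat.mod_lt _ hm⟩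
  refine ⟨ω, ?_, fun q => ?_⟩
  · have h1 : ‖birkSum ψ (n * m) ω - ∑ i ∈ Finset.range n, birkSum ψ m (e (w i))‖ ≤ δ * m * n := by
      rw [birkSum_mul, ← Finset.sum_sub_distrib]
      refine (norm_sum_le_of_le _ fun b _ => hψ _ _ fun p hp => ?_).trans_eq
        (by simp [mul_comm])
      rw [shiftMap_iterate, he (w b) ⟨p, hp⟩]
      simp [ω, Nat.add_mul_div_right, hm, Nat.div_eq_of_lt hp, Nat.mod_eq_of_lt hp]
    have h2 : ‖(n : ℕ) • ∫ w, birkSum ψ m (e w) ∂ρ - (n * m) • α‖ ≤ δ * m * n := by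
      rw [mul_smul, ← smul_sub]
      refine (norm_nsmul_le).trans ?_
      rw [mul_comm]
      gcongr
    have h3 := norm_add₃_le (a := birkSum ψ (n * m) ω - ∑ i ∈ Finset.range n, birkSum ψ m (e (w i)))
      (b := ∑ i ∈ Finset.range n, birkSum ψ m (e (w i)) - n • ∫ w, birkSum ψ m (e w) ∂ρ)
      (c := n • ∫ w, birkSum ψ m (e w) ∂ρ - (n * m) • α)
    rw [sub_add_sub_cancel, sub_add_sub_cancel] at h3
    have h4 : min δ ε * n ≤ δ * m * n := by
      gcongr
      nlinarith [min_le_left δ ε]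
    push_cast
    linarith
  · simp only [J, ω]
    rw [← hwv]

end LawOfLargeNumbers

/-! ### Digit expansions on the torus -/

section Coding

lemma dist_coe_unitAddCircle (x y : ℝ) :
    dist (x : AddCircle (1 : ℝ)) (y : AddCircle (1 : ℝ)) = |x - y - round (x - y)| := by
  rw [dist_eq_norm, ← AddCircle.coe_sub]
  exact UnitAddCircle.norm_eq

lemma dist_coe_ofDigits_le {b n : ℕ} {s s' : ℕ → Fin b} (h : ∀ i < n, s i = s' i) :
    dist (Real.ofDigits s : AddCircle (1 : ℝ)) (Real.ofDigits s' : AddCircle (1 : ℝ)) ≤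
      ((b : ℝ) ^ n)⁻¹ := by
  rw [dist_coe_unitAddCircle]
  refine le_trans ?_ (Real.abs_ofDigits_sub_ofDigits_le h)
  simpa using round_le (Real.ofDigits s - Real.ofDigits s') 0

lemma nsmul_coe_ofDigits {b : ℕ} (hb : 0 < b) (s : ℕ → Fin b) :
    b • (Real.ofDigits s : AddCircle (1 : ℝ)) =
      (Real.ofDigits (shiftMap s) : AddCircle (1 : ℝ)) := by
  have hb' : (b : ℝ) ≠ 0 := by exact_mod_cast hb.ne'
  have h := Real.ofDigits_eq_sum_add_ofDigits s 1
  have h2 : (b : ℝ) * Real.ofDigits s = (s 0 : ℕ) + Real.ofDigits (shiftMap s) := by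
    rw [h]
    simp only [Finset.sum_range_one, Real.ofDigitsTerm, zero_add, pow_one, mul_add,
      mul_inv_cancel_left₀ hb']
    rw [mul_comm (b : ℝ), inv_mul_cancel_right₀ hb']
    rfl
  rw [← AddCircle.coe_nsmul, nsmul_eq_mul, h2, AddCircle.coe_add]
  have : (((s 0 : ℕ) : ℝ) : AddCircle (1 : ℝ)) = 0 := by
    simpa using (AddCircle.coe_eq_zero_iff (1 : ℝ)).2 ⟨((s 0 : ℕ) : ℤ), by simp⟩
  rw [this, zero_add]

lemma pow_mul_ofDigits {b n : ℕ} (hb : 0 < b) (s : ℕ → Fin b) (u : Fin n → Fin b)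
    (hu : ∀ i : Fin n, s i = u i) :
    (b : ℝ) ^ n * Real.ofDigits s = (finFunctionFinEquiv (fun i => u i.rev) : ℕ) +
      Real.ofDigits (fun i => s (i + n)) := by
  have hb' : (b : ℝ) ≠ 0 := by exact_mod_cast hb.ne'
  rw [Real.ofDigits_eq_sum_add_ofDigits s n, mul_add, mul_inv_cancel_left₀ (pow_ne_zero _ hb'),
    finFunctionFinEquiv_apply]
  congr 1
  push_cast
  rw [Finset.sum_range, Finset.mul_sum,
    ← Equiv.sum_comp Fin.revPerm fun i : Fin n => ((u i.rev : ℕ) : ℝ) * (b : ℝ) ^ (i : ℕ)]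
  refine Finset.sum_congr rfl fun i _ => ?_
  simp only [Real.ofDigitsTerm, hu, Fin.revPerm_apply, Fin.rev_rev, Fin.val_rev]
  have : (b : ℝ) ^ n = (b : ℝ) ^ (n - (i + 1)) * (b : ℝ) ^ (i.1 + 1) := by
    rw [← pow_add]; congr 1; omega
  rw [this]
  field_simp

lemma ncard_digitWords_near_le {b : ℕ} (hb : 0 < b) (n : ℕ) (x₀ : AddCircle (1 : ℝ)) :
    {u : Fin n → Fin b | ∃ s : ℕ → Fin b, (∀ i : Fin n, s i = u i) ∧
      dist (Real.ofDigits s : AddCircle (1 : ℝ)) x₀ ≤ ((b : ℝ) ^ n)⁻¹}.ncard ≤ 12 := by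
  classical
  obtain ⟨y₀, ⟨hy0, hy1⟩, rfl⟩ : ∃ y ∈ Ico (0 : ℝ) 1, (y : AddCircle (1 : ℝ)) = x₀ := by
    have := AddCircle.coe_image_Ico_eq (1 : ℝ) 0
    rw [zero_add] at this
    simpa using this.ge (mem_univ x₀)
  have hbR : (0 : ℝ) < (b : ℝ) ^ n := by positivity
  let J : (Fin n → Fin b) → ℤ := fun u => (finFunctionFinEquiv (fun i => u i.rev) : ℕ)
  have hJ : Function.Injective J := by
    intro u u' h
    have h1 := finFunctionFinEquiv.injective (Fin.ext (Nat.cast_injective (R := ℤ) h))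
    ext i
    simpa using congrArg Fin.val (congrFun h1 i.rev)
  let c : ℤ → ℤ := fun z => ⌈(b : ℝ) ^ n * (y₀ + z) - 2⌉
  let I : Finset ℤ := (Finset.Icc (-1 : ℤ) 1).biUnion fun z => Finset.Icc (c z) (c z + 3)
  have hI : I.card ≤ 12 := by
    refine Finset.card_biUnion_le.trans ((Finset.sum_le_card_nsmul _ _ 4 fun z _ => ?_).trans ?_)
    · simp
      omega
    · simp
  rw [← Set.ncard_image_of_injective _ hJ]
  refine le_trans ?_ hI
  rw [← Set.ncard_coe_finset]
  refine Set.ncard_le_ncard ?_ (Finset.finite_toSet _)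
  rintro _ ⟨u, ⟨s, hs, hd⟩, rfl⟩
  rw [dist_coe_unitAddCircle] at hd
  set o := Real.ofDigits s
  set z := round (o - y₀)
  have ho0 : 0 ≤ o := Real.ofDigits_nonneg s
  have ho1 : o ≤ 1 := Real.ofDigits_le_one s
  have ht0 := Real.ofDigits_nonneg fun i => s (i + n)
  have ht1 := Real.ofDigits_le_one fun i => s (i + n)
  have hz := abs_le.1 (abs_sub_round (o - y₀))
  have hJo : (b : ℝ) ^ n * o = (J u : ℝ) + Real.ofDigits (fun i => s (i + n)) := by
    rw [pow_mul_ofDigits hb s u hs]; simp [J]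
  have hd' : |(b : ℝ) ^ n * (o - y₀ - z)| ≤ 1 := by
    rw [abs_mul, abs_of_pos hbR]
    calc _ ≤ (b : ℝ) ^ n * ((b : ℝ) ^ n)⁻¹ := by gcongr
      _ = 1 := mul_inv_cancel₀ hbR.ne'
  have hd2 := abs_le.1 hd'
  have hz1 : -1 ≤ z := by
    have : (-2 : ℝ) < z := by linarith
    have : (-2 : ℤ) < z := by exact_mod_cast this
    omega
  have hz2 : z ≤ 1 := by
    have : (z : ℝ) < 2 := by linarith
    have : z < 2 := by exact_mod_cast this
    omega
  simp only [I, Finset.coe_biUnion, mem_iUnion, Finset.coe_Icc]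
  refine ⟨z, ⟨hz1, hz2⟩, ?_, ?_⟩
  · refine Int.ceil_le.2 ?_
    linarith
  · have h1 := Int.le_ceil ((b : ℝ) ^ n * (y₀ + z) - 2)
    have h2 : (J u : ℝ) ≤ ((c z + 3 : ℤ) : ℝ) := by
      push_cast
      change _ ≤ (⌈(b : ℝ) ^ n * (y₀ + z) - 2⌉ : ℝ) + 3
      linarith
    exact_mod_cast h2

/-- The point of the torus whose coordinates have the digit expansions `s`. -/
def digitPoint {ι : Type*} (b : ι → ℕ) (s : ℕ → ∀ q, Fin (b q)) : ι → AddCircle (1 : ℝ) :=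
  fun q => (Real.ofDigits (fun n => s n q) : ℝ)

/-- The diagonal endomorphism of the torus with multipliers `b`. -/
def torusMul {ι : Type*} (b : ι → ℕ) (x : ι → AddCircle (1 : ℝ)) : ι → AddCircle (1 : ℝ) :=
  fun q => b q • x q

variable {ι : Type*} {b : ι → ℕ}

lemma continuous_digitPoint : Continuous (digitPoint b) :=
  continuous_pi fun q => (AddCircle.continuous_mk' 1).comp
    (Real.continuous_ofDigits.comp (by fun_prop))

lemma continuous_torusMul : Continuous (torusMul b) := by
  unfold torusMul; fun_prop

lemma torusMul_digitPoint (hb : ∀ q, 0 < b q) (s : ℕ → ∀ q, Fin (b q)) :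
    torusMul b (digitPoint b s) = digitPoint b (shiftMap s) :=
  funext fun q => nsmul_coe_ofDigits (hb q) _

lemma dist_digitPoint_le [Fintype ι] {s s' : ℕ → ∀ q, Fin (b q)} {r : ℝ} (hr : 0 ≤ r)
    (h : ∀ q, ∃ n : ℕ, ((b q : ℝ) ^ n)⁻¹ ≤ r ∧ ∀ i < n, s i q = s' i q) :
    dist (digitPoint b s) (digitPoint b s') ≤ r := by
  refine (dist_pi_le_iff hr).2 fun q => ?_
  obtain ⟨n, hn, hs⟩ := h q
  exact (dist_coe_ofDigits_le hs).trans hn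

lemma ncard_words_near_le [Fintype ι] (hb : ∀ q, 0 < b q) (L : ι → ℕ)
    (x₀ : ι → AddCircle (1 : ℝ)) :
    {u : ∀ q, Fin (L q) → Fin (b q) | ∃ s : ℕ → ∀ q, Fin (b q),
      (∀ q (i : Fin (L q)), s i q = u q i) ∧
        ∀ q, dist (digitPoint b s q) (x₀ q) ≤ ((b q : ℝ) ^ L q)⁻¹}.ncard ≤
      12 ^ Fintype.card ι := by
  classical
  let S : ∀ q, Finset (Fin (L q) → Fin (b q)) := fun q =>
    (toFinite {u : Fin (L q) → Fin (b q) | ∃ s : ℕ → Fin (b q), (∀ i : Fin (L q), s i = u i) ∧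
      dist (Real.ofDigits s : AddCircle (1 : ℝ)) (x₀ q) ≤ ((b q : ℝ) ^ L q)⁻¹}).toFinset
  have hS : ∀ q, (S q).card ≤ 12 := fun q => by
    rw [← Set.ncard_eq_toFinset_card]; exact ncard_digitWords_near_le (hb q) _ _
  have hle : (Fintype.piFinset S).card ≤ 12 ^ Fintype.card ι := by
    rw [Fintype.card_piFinset]
    exact (Finset.prod_le_prod' fun q _ => hS q).trans_eq (by simp)
  refine le_trans ?_ hle
  rw [← Set.ncard_coe_finset]
  refine Set.ncard_le_ncard ?_ (Finset.finite_toSet _)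
  rintro u ⟨s, hs, hd⟩
  simp only [Finset.mem_coe, Fintype.mem_piFinset, S, Set.Finite.mem_toFinset]
  exact fun q => ⟨fun n => s n q, hs q, hd q⟩

end Coding

/-! ### The canonical digit partition of the torus -/

section Canonical

/-- The itinerary of length `n` of a point under `T` with respect to the partition `C`. -/
def itinerary {X κ : Type*} (T : X → X) (C : X → κ) (n : ℕ) (x : X) : Fin n → κ :=
  fun k => C (T^[(k : ℕ)] x)

lemma measurable_itinerary {X κ : Type*} [MeasurableSpace X] [MeasurableSpace κ] {T : X → X}
    (hT : Measurable T) {C : X → κ} (hC : Measurable C) (n : ℕ) : Measurable (itinerary T C n) :=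
  measurable_pi_lambda _ fun k => hC.comp (hT.iterate k)

lemma measurable_equivIco :
    Measurable fun x : AddCircle (1 : ℝ) => (AddCircle.equivIco (1 : ℝ) 0 x : ℝ) :=
  measurable_subtype_coe.comp (AddCircle.measurableEquivIco (1 : ℝ) 0).measurable

lemma exists_canonical_digit {b : ℕ} (hb : 2 ≤ b) :
    ∃ c : AddCircle (1 : ℝ) → Fin b, Measurable c ∧ ∀ x,
      (Real.ofDigits (fun n => c ((fun y => b • y)^[n] x)) : AddCircle (1 : ℝ)) = x := by
  have hbR : (1 : ℝ) < b := by exact_mod_cast hb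
  have hb0 : (0 : ℝ) < b := by linarith
  let rep : AddCircle (1 : ℝ) → ℝ := fun x => (AddCircle.equivIco (1 : ℝ) 0 x : ℝ)
  have hrep : ∀ x, (rep x : AddCircle (1 : ℝ)) = x := fun x => AddCircle.coe_equivIco
  have hrep0 : ∀ x, 0 ≤ rep x := fun x => (AddCircle.equivIco (1 : ℝ) 0 x).2.1
  have hrep1 : ∀ x, rep x < 1 := fun x => by
    simpa using (AddCircle.equivIco (1 : ℝ) 0 x).2.2
  have hlt : ∀ x, ⌊(b : ℝ) * rep x⌋₊ < b := fun x => by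
    rw [Nat.floor_lt (mul_nonneg hb0.le (hrep0 x))]
    nlinarith [hrep1 x]
  let c : AddCircle (1 : ℝ) → Fin b := fun x => ⟨⌊(b : ℝ) * rep x⌋₊, hlt x⟩
  have hstep : ∀ x, rep x = (c x : ℕ) * (b : ℝ)⁻¹ + (b : ℝ)⁻¹ * rep (b • x) := by
    intro x
    have h1 : rep (b • x) = Int.fract ((b : ℝ) * rep x) := by
      have : b • x = ((b * rep x : ℝ) : AddCircle (1 : ℝ)) := by
        conv_lhs => rw [← hrep x]
        rw [← AddCircle.coe_nsmul, nsmul_eq_mul]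
      change ((AddCircle.equivIco (1 : ℝ) 0 (b • x) : ℝ)) = _
      rw [this, AddCircle.coe_equivIco_mk_apply]
      simp
    have h2 : ((c x : ℕ) : ℝ) = (⌊(b : ℝ) * rep x⌋ : ℝ) := by
      change ((⌊(b : ℝ) * rep x⌋₊ : ℕ) : ℝ) = _
      rw [natCast_floor_eq_intCast_floor (mul_nonneg hb0.le (hrep0 x))]
    have h3 := Int.floor_add_fract ((b : ℝ) * rep x)
    rw [h1, h2, mul_comm _ (b : ℝ)⁻¹, ← mul_add, h3, inv_mul_cancel_left₀ hb0.ne']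
  refine ⟨c, ?_, fun x => ?_⟩
  · refine measurable_to_countable' fun k => ?_
    have : c ⁻¹' {k} = (fun x => ⌊(b : ℝ) * rep x⌋₊) ⁻¹' {(k : ℕ)} := by
      ext x; simp [c, Fin.ext_iff]
    rw [this]
    exact (Nat.measurable_floor.comp (measurable_equivIco.const_mul _)) (measurableSet_singleton _)
  · set s : ℕ → Fin b := fun n => c ((fun y => b • y)^[n] x) with hs
    have hsum : ∀ n : ℕ, rep x = (∑ i ∈ Finset.range n, Real.ofDigitsTerm s i) +
        ((b : ℝ) ^ n)⁻¹ * rep ((fun y => b • y)^[n] x) := by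
      intro n
      induction n with
      | zero => simp
      | succ n ih =>
        rw [ih, hstep ((fun y => b • y)^[n] x), Finset.sum_range_succ,
          Function.iterate_succ_apply', add_assoc]
        congr 1
        simp only [Real.ofDigitsTerm, hs, pow_succ]
        field_simp
    have hdist : ∀ n : ℕ, |Real.ofDigits s - rep x| ≤ (b : ℝ)⁻¹ ^ n := by
      intro n
      have h0 := Real.ofDigits_nonneg fun i => s (i + n)
      have h1 := Real.ofDigits_le_one fun i => s (i + n)
      have h2 := hrep0 ((fun y => b • y)^[n] x)
      have h3 := hrep1 ((fun y => b • y)^[n] x)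
      rw [hsum n, Real.ofDigits_eq_sum_add_ofDigits s n, add_sub_add_left_eq_sub, ← mul_sub,
        abs_mul, abs_of_pos (by positivity), ← inv_pow]
      refine mul_le_of_le_one_right (by positivity) (abs_le.2 ⟨by linarith, by linarith⟩)
    have hzero : |Real.ofDigits s - rep x| ≤ 0 :=
      ge_of_tendsto' (tendsto_pow_atTop_nhds_zero_of_lt_one (by positivity)
        (inv_lt_one_of_one_lt₀ hbR)) hdist
    have heq : Real.ofDigits s = rep x := sub_eq_zero.1 (abs_nonpos_iff.1 hzero)
    rw [heq, hrep]

lemma exists_canonical_partition {ι : Type*} {b : ι → ℕ} (hb : ∀ q, 2 ≤ b q) :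
    ∃ C : (ι → AddCircle (1 : ℝ)) → ∀ q, Fin (b q), Measurable C ∧
      ∀ x, digitPoint b (fun n => C ((torusMul b)^[n] x)) = x := by
  choose c hc hcx using fun q => exists_canonical_digit (hb q)
  refine ⟨fun x q => c q (x q), measurable_pi_lambda _ fun q =>
    (hc q).comp (measurable_pi_apply q), fun x => funext fun q => ?_⟩
  have : ∀ n : ℕ, (torusMul b)^[n] x q = (fun y => b q • y)^[n] (x q) := by
    intro n
    induction n with
    | zero => rfl
    | succ n ih => rw [Function.iterate_succ_apply', Function.iterate_succ_apply', ← ih]; rfl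
  simp only [digitPoint, this]
  exact hcx q (x q)

/-- A finite family of measurable sets has a measurable selector on its union. -/
lemma exists_measurable_selector {X κ : Type*} [MeasurableSpace X] [Finite κ] [MeasurableSpace κ]
    [Nonempty κ] (Z : κ → Set X) (hZ : ∀ k, MeasurableSet (Z k)) :
    ∃ W : X → κ, Measurable W ∧ ∀ k, ∀ x ∈ Z k, x ∈ Z (W x) := by
  classical
  let G : (κ → Prop) → κ := fun t => if h : ∃ k, t k then h.choose else Classical.arbitrary κ
  let I : X → κ → Prop := fun x k => x ∈ Z k
  have hI : Measurable I := measurable_pi_iff.2 fun k => measurableSet_setOfPred.1 (hZ k)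
  refine ⟨fun x => G (I x), (Measurable.of_discrete (f := G)).comp hI, fun k x hx => ?_⟩
  have hne : ∃ k, I x k := ⟨k, hx⟩
  have : I x (G (I x)) := by
    simp only [G, dif_pos hne]
    exact hne.choose_spec
  exact this

end Canonical

/-! ### Kolmogorov–Sinai entropy through a generating partition -/

section KolmogorovSinai

lemma entPart_congr {X κ : Type*} [MeasurableSpace X] [Fintype κ] {μ : Measure X} {f g : X → κ}
    (h : f =ᵐ[μ] g) : entPart μ f = entPart μ g := by
  refine Finset.sum_congr rfl fun k _ => ?_
  have : (f ⁻¹' {k} : Set X) =ᵐ[μ] (g ⁻¹' {k} : Set X) := by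
    filter_upwards [h] with x hx
    exact propext (by change f x = k ↔ g x = k; rw [hx])
  rw [measure_congr this]

lemma entPart_le_add_log_of_ncard {X ι κ : Type*} [MeasurableSpace X] (μ : Measure X)
    [IsProbabilityMeasure μ] [Fintype ι] [MeasurableSpace ι] [MeasurableSingletonClass ι]
    [Fintype κ] [MeasurableSpace κ] [MeasurableSingletonClass κ] {f : X → ι} {w : X → κ}
    (hf : Measurable f) (hw : Measurable w) (R : ι → Set κ) {M : ℕ} (hM : 0 < M)
    (hR : ∀ i, (R i).ncard ≤ M) (h : ∀ᵐ x ∂μ, w x ∈ R (f x)) :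
    entPart μ w ≤ entPart μ f + Real.log M := by
  classical
  have : Nonempty X := nonempty_of_isProbabilityMeasure μ
  have : Nonempty κ := this.map w
  have hemb : ∀ i, ∃ e : κ → Fin M, InjOn e (R i) := by
    intro i
    have hc : Fintype.card (R i) ≤ Fintype.card (Fin M) := by
      rw [Fintype.card_fin, ← Nat.card_eq_fintype_card]
      exact hR i
    obtain ⟨φ⟩ := Function.Embedding.nonempty_of_card_le hc
    refine ⟨fun k => if hk : k ∈ R i then φ ⟨k, hk⟩ else ⟨0, hM⟩, fun k hk k' hk' h => ?_⟩
    simp only [hk, hk', dif_pos] at h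
    exact congrArg Subtype.val (φ.injective h)
  choose e he using hemb
  have hm : Measurable fun x => e (f x) (w x) :=
    (Measurable.of_discrete (f := fun p : ι × κ => e p.1 p.2)).comp (hf.prodMk hw)
  have hle := entPart_le_add_log_card μ hf hm fun p => Function.invFunOn (e p.1) (R p.1) p.2
  rw [Fintype.card_fin] at hle
  refine le_trans (le_of_eq (entPart_congr ?_)) hle
  filter_upwards [h] with x hx
  exact ((he (f x)).leftInvOn_invFunOn hx).symm

lemma entPart_comp_iterate {X ι : Type*} [MeasurableSpace X] [Fintype ι] [MeasurableSpace ι]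
    [MeasurableSingletonClass ι] {T : X → X} {μ : Measure X} (hT : MeasurePreserving T μ μ)
    {f : X → ι} (hf : Measurable f) (n : ℕ) : entPart μ (fun x => f (T^[n] x)) = entPart μ f := by
  rw [← entPart_map μ (hT.iterate n).measurable hf, (hT.iterate n).map_eq]

variable {κ : Type*} [Fintype κ] [MeasurableSpace κ] [MeasurableSingletonClass κ]

lemma entPart_itinerary_le {X : Type*} [MeasurableSpace X] {T : X → X} {μ : Measure X}
    [IsProbabilityMeasure μ] {C : X → κ} (hT : MeasurePreserving T μ μ)
    (hC : Measurable C) {N k m : ℕ}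
    (hm : 0 < m) (hN : N ≤ k * m) :
    entPart μ (itinerary T C N) ≤ k * entPart μ (itinerary T C m) := by
  have hmeas := measurable_itinerary hT.measurable hC m
  have hY : ∀ t : Fin k, Measurable fun x => itinerary T C m (T^[t * m] x) := fun t =>
    hmeas.comp (hT.measurable.iterate _)
  have hlt : ∀ i : Fin N, i.1 / m < k := fun i =>
    Nat.div_lt_of_lt_mul (by rw [mul_comm]; exact i.2.trans_le hN)
  have h := entPart_comp_le μ (measurable_pi_lambda _ hY)
    (fun v (i : Fin N) => v ⟨i / m, hlt i⟩ ⟨i % m, Nat.mod_lt _ hm⟩)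
  have h2 := entPart_pi_le μ hY
  simp only [entPart_comp_iterate hT hmeas, Finset.sum_const, Finset.card_univ, Fintype.card_fin,
    nsmul_eq_mul] at h2
  refine le_trans (le_of_eq ?_) (h.trans h2)
  congr 1
  ext x i
  simp only [itinerary]
  rw [← Function.iterate_add_apply, Nat.mod_add_div']

lemma exists_approx_partition {X : Type*} [MeasurableSpace X] [MetricSpace X] [BorelSpace X]
    [CompactSpace X] {μ : Measure X} [IsProbabilityMeasure μ] {κ' : ℕ → Type*}
    (c : ∀ l, X → κ' l)
    (hgen : ∀ δ > 0, ∃ l, ∀ x y, c l x = c l y → dist x y < δ)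
    {k : ℕ} {p : X → Fin k} (hp : Measurable p) {ε : ℝ} (hε : 0 < ε) :
    ∃ l, ∃ g : κ' l → Fin k, μ.real {x | p x ≠ g (c l x)} ≤ ε := by
  classical
  have : Nonempty X := nonempty_of_isProbabilityMeasure μ
  have hk : 0 < k := (p (Classical.arbitrary X)).pos
  have hkR : (0 : ℝ) < k := by exact_mod_cast hk
  have hK : ∀ i : Fin k, ∃ K ⊆ p ⁻¹' {i}, IsCompact K ∧
      μ (p ⁻¹' {i} \ K) < ENNReal.ofReal (ε / k) := by
    intro i
    obtain ⟨K, hKs, hKc, hK⟩ := (hp (measurableSet_singleton i)).exists_isClosed_sdiff_lt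
      (measure_ne_top μ _) (ε := ENNReal.ofReal (ε / k)) (by simp; positivity)
    exact ⟨K, hKs, hKc.isCompact, hK⟩
  choose K hKs hKc hKm using hK
  have hδ : ∀ i j : Fin k, ∃ δ > 0, i ≠ j → ∀ x ∈ K i, ∀ y ∈ K j, δ ≤ dist x y := by
    intro i j
    by_cases hij : i = j
    · exact ⟨1, one_pos, fun h => absurd hij h⟩
    have hd : Disjoint (K i) (K j) := by
      refine Set.disjoint_left.2 fun x hx hy => hij ?_
      exact (hKs i hx).symm.trans (hKs j hy)
    obtain ⟨r, hr, h⟩ := Metric.exists_pos_forall_lt_edist (hKc i) (hKc j).isClosed hd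
    refine ⟨r, hr, fun _ x hx y hy => ?_⟩
    have := h x hx y hy
    rw [edist_nndist] at this
    exact_mod_cast this.le
  choose δ hδ0 hδ using hδ
  have : Nonempty (Fin k) := ⟨⟨0, hk⟩⟩
  obtain ⟨δ₀, hδ₀, hδ₀le⟩ : ∃ δ₀ > 0, ∀ i j, δ₀ ≤ δ i j := by
    let s : Finset ℝ := Finset.univ.image fun q : Fin k × Fin k => δ q.1 q.2
    have hs : s.Nonempty := Finset.univ_nonempty.image _
    refine ⟨s.min' hs, ?_, fun i j => Finset.min'_le _ _ (Finset.mem_image.2 ⟨(i, j), by simp⟩)⟩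
    obtain ⟨q, -, hq⟩ := Finset.mem_image.1 (s.min'_mem hs)
    rw [← hq]; exact hδ0 _ _
  obtain ⟨l, hl⟩ := hgen δ₀ hδ₀
  let g : κ' l → Fin k := fun v =>
    if h : ∃ i, ∃ x ∈ K i, c l x = v then h.choose else ⟨0, hk⟩
  refine ⟨l, g, ?_⟩
  have hsub : {x | p x ≠ g (c l x)} ⊆ ⋃ i ∈ (Finset.univ : Finset (Fin k)), (p ⁻¹' {i} \ K i) := by
    intro x hx
    refine mem_iUnion₂.2 ⟨p x, Finset.mem_univ _, rfl, fun hxK => hx ?_⟩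
    have hex : ∃ i, ∃ y ∈ K i, c l y = c l x := ⟨p x, x, hxK, rfl⟩
    have hg : g (c l x) = hex.choose := dif_pos hex
    obtain ⟨y, hy, hyx⟩ := hex.choose_spec
    rw [hg]
    by_contra hne
    have h1 := hδ _ _ hne x hxK y hy
    have h2 := hl x y hyx.symm
    linarith [hδ₀le (p x) hex.choose]
  refine (measureReal_mono hsub (measure_ne_top _ _)).trans
    ((measureReal_biUnion_finset_le _ _).trans ?_)
  have : ∀ i ∈ (Finset.univ : Finset (Fin k)), μ.real (p ⁻¹' {i} \ K i) ≤ ε / k := by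
    intro i _
    exact ENNReal.toReal_le_of_le_ofReal (by positivity) (hKm i).le
  refine (Finset.sum_le_card_nsmul _ _ _ this).trans_eq ?_
  simp
  field_simp

lemma iInf_entPart_le {X : Type*} [MeasurableSpace X] [MetricSpace X] [BorelSpace X]
    [CompactSpace X] {T : X → X} {μ : Measure X} [IsProbabilityMeasure μ] {C : X → κ}
    (hT : MeasurePreserving T μ μ) (hC : Measurable C)
    (hgen : ∀ δ > 0, ∃ l, ∀ x y, itinerary T C l x = itinerary T C l y → dist x y < δ)
    {k : ℕ} {p : X → Fin k} (hp : Measurable p) {m : ℕ} (hm : 0 < m) :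
    ⨅ n : ℕ, ((n : ℝ) + 1)⁻¹ * entPart μ (itinerary T p (n + 1)) ≤
      (m : ℝ)⁻¹ * entPart μ (itinerary T C m) := by
  classical
  have hmR : (0 : ℝ) < m := by exact_mod_cast hm
  have hbdd : BddBelow (range fun n : ℕ =>
      ((n : ℝ) + 1)⁻¹ * entPart μ (itinerary T p (n + 1))) :=
    ⟨0, by rintro _ ⟨n, rfl⟩; have := entPart_nonneg μ (itinerary T p (n + 1)); positivity⟩
  refine le_of_forall_pos_le_add fun ε hε => ?_
  let _ : MeasurableSpace (Option (Fin k)) := ⊤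
  obtain ⟨δ, hδ, hδe⟩ := exists_entPart_lt_of_measureReal_le (Option (Fin k)) (half_pos hε)
  obtain ⟨l, g, hg⟩ := exists_approx_partition (μ := μ) (fun l => itinerary T C l) hgen hp hδ
  have hCm := measurable_itinerary hT.measurable hC
  let Z : X → Option (Fin k) := fun x =>
    if p x = g (itinerary T C l x) then none else some (p x)
  have hgm : Measurable fun x => g (itinerary T C l x) :=
    (Measurable.of_discrete (f := g)).comp (hCm l)
  have hZ : Measurable Z :=
    (Measurable.of_discrete
      (f := fun q : Fin k × Fin k => if q.1 = q.2 then none else some q.1)).comp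
      (hp.prodMk hgm)
  have hZe : entPart μ Z ≤ ε / 2 := by
    refine hδe μ Z hZ none (le_trans (measureReal_mono ?_ (measure_ne_top _ _)) hg)
    intro x hx heq
    exact hx (by simp [Z, heq])
  set h := entPart μ (itinerary T C m) with hh
  have h0 : 0 ≤ h := entPart_nonneg μ _
  obtain ⟨n, hn⟩ := exists_nat_gt (((l : ℝ) / m + 1) * h / (ε / 2))
  refine (ciInf_le hbdd n).trans ?_
  have hn1 : (0 : ℝ) < (n : ℝ) + 1 := by positivity
  rw [inv_mul_le_iff₀ hn1]
  set N := n + 1 + l with hN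
  have hZw : Measurable fun x => fun i : Fin (n + 1) => Z (T^[(i : ℕ)] x) :=
    measurable_pi_lambda _ fun i => hZ.comp (hT.measurable.iterate i)
  let G : (Fin N → κ) × (Fin (n + 1) → Option (Fin k)) → Fin (n + 1) → Fin k := fun v i =>
    (v.2 i).getD (g fun t => v.1 ⟨i + t, by omega⟩)
  have hG : itinerary T p (n + 1) =
      fun x => G (itinerary T C N x, fun i => Z (T^[(i : ℕ)] x)) := by
    ext x i
    have hsh : (fun t : Fin l => itinerary T C N x ⟨i + t, by omega⟩) =
        itinerary T C l (T^[(i : ℕ)] x) := by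
      ext t
      simp only [itinerary]
      rw [← Function.iterate_add_apply, add_comm]
    simp only [G, hsh, Z]
    split_ifs with hc
    · simp only [Option.getD_none, ← hc]; rfl
    · rfl
  have hH : entPart μ (itinerary T p (n + 1)) ≤
      entPart μ (itinerary T C N) + (n + 1) * (ε / 2) := by
    rw [hG]
    refine (entPart_comp_le μ ((hCm N).prodMk hZw) G).trans
      ((entPart_prod_le μ (hCm N) hZw).trans ?_)
    gcongr
    refine (entPart_pi_le μ fun i : Fin (n + 1) => hZ.comp (hT.measurable.iterate i)).trans ?_
    refine (Finset.sum_le_card_nsmul _ _ (ε / 2) fun i _ => ?_).trans_eq ?_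
    · exact (entPart_comp_iterate hT hZ i).trans_le hZe
    · simp
  have hHN : entPart μ (itinerary T C N) ≤ ((N : ℝ) / m + 1) * h := by
    have hle : N ≤ (N / m + 1) * m := by
      have := Nat.lt_div_mul_add (a := N) hm
      rw [Nat.succ_mul]; omega
    refine (entPart_itinerary_le hT hC hm hle).trans ?_
    push_cast
    gcongr
    exact Nat.cast_div_le
  have h3 : ((l : ℝ) / m + 1) * h ≤ (n + 1) * (ε / 2) := by
    rw [div_lt_iff₀ (half_pos hε)] at hn
    nlinarith
  have h4 : ((N : ℝ) / m + 1) * h = (n + 1) * ((m : ℝ)⁻¹ * h) + ((l : ℝ) / m + 1) * h := by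
    rw [hN]; push_cast; field_simp; ring
  linarith

variable {X : Type*} [MeasurableSpace X] [MetricSpace X] [BorelSpace X] [CompactSpace X]
  {T : X → X} {μ : Measure X} [IsProbabilityMeasure μ] {C : X → κ}

lemma ksEntropy_le (hT : MeasurePreserving T μ μ) (hC : Measurable C)
    (hgen : ∀ δ > 0, ∃ l, ∀ x y, itinerary T C l x = itinerary T C l y → dist x y < δ)
    {m : ℕ} (hm : 0 < m) : ksEntropy T μ ≤ (m : ℝ)⁻¹ * entPart μ (itinerary T C m) := by
  have h0 : 0 ≤ (m : ℝ)⁻¹ * entPart μ (itinerary T C m) := by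
    have := entPart_nonneg μ (itinerary T C m)
    positivity
  exact Real.iSup_le (fun k => Real.iSup_le (fun p => iInf_entPart_le hT hC hgen p.2 hm) h0) h0

lemma le_ksEntropy (hT : MeasurePreserving T μ μ) (hC : Measurable C)
    (hgen : ∀ δ > 0, ∃ l, ∀ x y, itinerary T C l x = itinerary T C l y → dist x y < δ)
    {h : ℝ} (hh : ∀ n : ℕ, 0 < n → n * h ≤ entPart μ (itinerary T C n)) : h ≤ ksEntropy T μ := by
  have h0 : 0 ≤ ((1 : ℕ) : ℝ)⁻¹ * entPart μ (itinerary T C 1) := by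
    have := entPart_nonneg μ (itinerary T C 1)
    positivity
  have hb : ∀ (k : ℕ) (p : {p : X → Fin k // Measurable p}),
      ⨅ n : ℕ, ((n : ℝ) + 1)⁻¹ * entPart μ (fun x => fun i : Fin (n + 1) => p.1 (T^[(i : ℕ)] x)) ≤
        ((1 : ℕ) : ℝ)⁻¹ * entPart μ (itinerary T C 1) := fun k p =>
    iInf_entPart_le hT hC hgen p.2 one_pos
  let e := Fintype.equivFin κ
  let p : {p : X → Fin (Fintype.card κ) // Measurable p} :=
    ⟨fun x => e (C x), (Measurable.of_discrete (f := e)).comp hC⟩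
  refine le_trans ?_ (le_ciSup (f := fun k : ℕ => ⨆ p : {p : X → Fin k // Measurable p},
    ⨅ n : ℕ, ((n : ℝ) + 1)⁻¹ * entPart μ (fun x => fun i : Fin (n + 1) => p.1 (T^[(i : ℕ)] x)))
    ⟨((1 : ℕ) : ℝ)⁻¹ * entPart μ (itinerary T C 1), ?_⟩ (Fintype.card κ))
  · refine le_trans ?_ (le_ciSup
      ⟨((1 : ℕ) : ℝ)⁻¹ * entPart μ (itinerary T C 1), ?_⟩ p)
    · refine le_ciInf fun n => ?_
      rw [le_inv_mul_iff₀ (by positivity)]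
      have h1 := hh (n + 1) n.succ_pos
      push_cast at h1
      refine h1.trans ?_
      have := entPart_comp_le μ (measurable_itinerary hT.measurable p.2 (n + 1))
        (fun v i => e.symm (v i))
      refine le_trans (le_of_eq ?_) this
      congr 1
      ext x i
      simp [itinerary, p]
    · rintro _ ⟨q, rfl⟩
      exact hb _ q
  · rintro _ ⟨k, rfl⟩
    exact Real.iSup_le (fun q => hb k q) h0

end KolmogorovSinai

/-! ### Entropy of the factors and addresses of points -/

section Addresses

/-- The words of length `n` that begin an address of a point having another address that begins
with `u`. -/
def compatWords {ι : Type*} (b : ι → ℕ) (n : ℕ) (u : Fin n → ∀ q, Fin (b q)) :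
    Set (Fin n → ∀ q, Fin (b q)) :=
  {u' | ∃ s s' : ℕ → ∀ q, Fin (b q), (∀ i : Fin n, s i = u i) ∧ (∀ i : Fin n, s' i = u' i) ∧
    digitPoint b s = digitPoint b s'}

lemma ncard_compatWords_le {ι : Type*} [Fintype ι] {b : ι → ℕ} (hb : ∀ q, 0 < b q) (n : ℕ)
    (u : Fin n → ∀ q, Fin (b q)) : (compatWords b n u).ncard ≤ 12 ^ Fintype.card ι := by
  rcases (compatWords b n u).eq_empty_or_nonempty with h | ⟨-, s₀, -, hs₀, -, -⟩
  · simp [h]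
  refine le_trans (Set.ncard_le_ncard_of_injOn
    (fun (v : Fin n → ∀ q, Fin (b q)) (q : ι) (i : Fin n) => v i q) ?_ ?_ (toFinite _))
    (ncard_words_near_le hb (fun _ => n) (digitPoint b s₀))
  · rintro u' ⟨s, s', hs, hs', hss⟩
    refine ⟨s', fun q i => by rw [hs'], fun q => ?_⟩
    rw [← hss]
    exact dist_coe_ofDigits_le fun i hi => by rw [hs ⟨i, hi⟩, hs₀ ⟨i, hi⟩]
  · intro v _ v' _ h
    funext i q
    exact congrFun (congrFun h q) i

lemma entPart_le_of_compatWords {X ι : Type*} [MeasurableSpace X] (μ : Measure X)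
    [IsProbabilityMeasure μ] [Fintype ι] [DecidableEq ι] {b : ι → ℕ} (hb : ∀ q, 0 < b q) {n : ℕ}
    {u u' : X → Fin n → ∀ q, Fin (b q)} (hu : Measurable u) (hu' : Measurable u')
    (h : ∀ᵐ x ∂μ, u' x ∈ compatWords b n (u x)) :
    entPart μ u' ≤ entPart μ u + Fintype.card ι * Real.log 12 := by
  have := entPart_le_add_log_of_ncard μ hu hu' (compatWords b n) (M := 12 ^ Fintype.card ι)
    (by positivity) (ncard_compatWords_le hb n) h
  simpa using this

lemma exists_dist_lt_of_itinerary_eq {ι κ : Type*} [Fintype ι] {b : ι → ℕ} (hb : ∀ q, 2 ≤ b q)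
    {T : κ → κ} {C : κ → ∀ q, Fin (b q)} {g : κ → ι → AddCircle (1 : ℝ)}
    (hC : ∀ x, digitPoint b (fun n => C (T^[n] x)) = g x) {δ : ℝ} (hδ : 0 < δ) :
    ∃ l, ∀ x y, itinerary T C l x = itinerary T C l y → dist (g x) (g y) < δ := by
  obtain ⟨l, hl⟩ := exists_pow_lt_of_lt_one hδ (by norm_num : (1 / 2 : ℝ) < 1)
  refine ⟨l, fun x y h => lt_of_le_of_lt ?_ hl⟩
  rw [← hC x, ← hC y]
  refine dist_digitPoint_le (by positivity) fun q => ⟨l, ?_, fun i hi => ?_⟩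
  · rw [one_div, inv_pow]
    have : (2 : ℝ) ≤ b q := by exact_mod_cast hb q
    gcongr
  · exact congrFun (congrFun h ⟨i, hi⟩) q

/-- The point with the address given by the digits of a symbolic sequence. -/
def codePoint {ι A : Type*} {b : ι → ℕ} (dig : A → ∀ q, Fin (b q)) (ω : ℕ → A) :
    ι → AddCircle (1 : ℝ) :=
  digitPoint b fun n => dig (ω n)

/-- The digits visible after restricting to a family of coordinates. -/
def visDigit {ι κ A : Type*} {b : ι → ℕ} (p : κ → ι) (dig : A → ∀ q, Fin (b q)) (v : A) :
    ∀ q, Fin (b (p q)) :=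
  fun q => dig v (p q)

/-- Restriction of a point of the torus to a family of coordinates. -/
def coordProj {ι κ : Type*} (p : κ → ι) (x : ι → AddCircle (1 : ℝ)) : κ → AddCircle (1 : ℝ) :=
  fun q => x (p q)

lemma torusMul_codePoint {ι A : Type*} {b : ι → ℕ} (dig : A → ∀ q, Fin (b q))
    (hb : ∀ q, 0 < b q) (ω : ℕ → A) :
    torusMul b (codePoint dig ω) = codePoint dig (shiftMap ω) :=
  torusMul_digitPoint hb _

lemma torusMul_iterate_codePoint {ι A : Type*} {b : ι → ℕ} (dig : A → ∀ q, Fin (b q))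
    (hb : ∀ q, 0 < b q) (n : ℕ) (ω : ℕ → A) :
    (torusMul b)^[n] (codePoint dig ω) = codePoint dig (shiftMap^[n] ω) := by
  induction n generalizing ω with
  | zero => rfl
  | succ n ih => rw [Function.iterate_succ_apply, torusMul_codePoint dig hb, ih]; rfl

lemma continuous_codePoint {ι A : Type*} {b : ι → ℕ} (dig : A → ∀ q, Fin (b q))
    [TopologicalSpace A] [DiscreteTopology A] : Continuous (codePoint dig) := by
  refine continuous_digitPoint.comp (continuous_pi fun n => ?_)
  exact continuous_of_discreteTopology.comp (continuous_apply n)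

lemma measurable_coordProj {ι κ : Type*} (p : κ → ι) : Measurable (coordProj p) :=
  measurable_pi_lambda _ fun q => measurable_pi_apply (p q)

lemma measurePreserving_coordProj {ι κ : Type*} (p : κ → ι) {b : ι → ℕ} [Countable ι] [Countable κ]
    {μ : Measure (ι → AddCircle (1 : ℝ))} (hμ : MeasurePreserving (torusMul b) μ μ) :
    MeasurePreserving (torusMul fun q => b (p q)) (μ.map (coordProj p)) (μ.map (coordProj p)) := by
  have hm : Measurable (torusMul fun q => b (p q)) := continuous_torusMul.measurable
  refine ⟨hm, ?_⟩
  rw [Measure.map_map hm (measurable_coordProj p)]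
  conv_rhs => rw [← hμ.map_eq, Measure.map_map (measurable_coordProj p) hμ.measurable]
  rfl

variable {ι κ A : Type*} {b : ι → ℕ} (p : κ → ι) (dig : A → ∀ q, Fin (b q))

/-- Selection of an initial word of an address, for points of the coded set. -/
lemma exists_address_selector [Fintype ι] [Finite A] [Nonempty A] [TopologicalSpace A]
    [DiscreteTopology A]
    [MeasurableSpace A] (m : ℕ) :
    ∃ W : (ι → AddCircle (1 : ℝ)) → Fin m → A, Measurable W ∧
      ∀ ω : ℕ → A, ∃ ω' : ℕ → A, codePoint dig ω' = codePoint dig ω ∧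
        ∀ i : Fin m, ω' i = W (codePoint dig ω) i := by
  obtain ⟨W, hW, h⟩ := exists_measurable_selector
    (fun w : Fin m → A => codePoint dig '' {ω | ∀ i : Fin m, ω i = w i}) (by
      intro w
      have hcl : IsClosed {ω : ℕ → A | ∀ i : Fin m, ω i = w i} := by
        simp only [ofPred_forall]
        exact isClosed_iInter fun i => isClosed_eq (continuous_apply _) continuous_const
      exact (hcl.isCompact.image (continuous_codePoint dig)).measurableSet)
  refine ⟨W, hW, fun ω => ?_⟩
  obtain ⟨ω', h1, h2⟩ := h (fun i => ω i) (codePoint dig ω) ⟨ω, fun i => rfl, rfl⟩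
  exact ⟨ω', h2, h1⟩

lemma mul_ksEntropy_le_entPart_address [Finite ι] [Fintype κ] [DecidableEq κ]
    [MeasurableSpace A] [DiscreteMeasurableSpace A]
    (hb : ∀ q, 2 ≤ b q) {μ : Measure (ι → AddCircle (1 : ℝ))} [IsProbabilityMeasure μ]
    (hμ : MeasurePreserving (torusMul b) μ μ) (hΛ : ∀ᵐ x ∂μ, x ∈ range (codePoint dig)) {m : ℕ}
    (hm : 0 < m) {W : (ι → AddCircle (1 : ℝ)) → Fin m → A} (hW : Measurable W)
    (h : ∀ ω : ℕ → A, ∃ ω' : ℕ → A, codePoint dig ω' = codePoint dig ω ∧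
        ∀ i : Fin m, ω' i = W (codePoint dig ω) i) :
    m * ksEntropy (torusMul fun q => b (p q)) (μ.map (coordProj p)) ≤
      entPart (μ.map W) (fun w i => visDigit p dig (w i)) + Fintype.card κ * Real.log 12 := by
  have hb' : ∀ q, 2 ≤ b (p q) := fun q => hb _
  obtain ⟨C, hC, hCx⟩ := exists_canonical_partition hb'
  have hP := measurable_coordProj p
  have : IsProbabilityMeasure (μ.map (coordProj p)) :=
    Measure.isProbabilityMeasure_map hP.aemeasurable
  have hpres := measurePreserving_coordProj p hμ
  have h1 := ksEntropy_le hpres hC (fun δ hδ => exists_dist_lt_of_itinerary_eq hb' hCx hδ) hm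
  have hmR : (0 : ℝ) < m := by exact_mod_cast hm
  rw [le_inv_mul_iff₀ hmR] at h1
  refine h1.trans ?_
  have hit := measurable_itinerary hpres.measurable hC m
  have hvis : Measurable fun (w : Fin m → A) (i : Fin m) => visDigit p dig (w i) :=
    measurable_pi_lambda _ fun i => (Measurable.of_discrete (f := visDigit p dig)).comp
      (measurable_pi_apply i)
  rw [entPart_map μ hP hit, entPart_map μ hW hvis]
  refine entPart_le_of_compatWords μ (fun q => by linarith [hb' q]) (hvis.comp hW) (hit.comp hP) ?_
  filter_upwards [hΛ]
  rintro _ ⟨ω, rfl⟩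
  obtain ⟨ω', h2, h3⟩ := h ω
  refine ⟨fun n => visDigit p dig (ω' n),
    fun n => C ((torusMul fun q => b (p q))^[n] (coordProj p (codePoint dig ω))),
    fun i => congrArg (visDigit p dig) (h3 i), fun i => rfl, ?_⟩
  rw [hCx, ← h2]; rfl

lemma le_ksEntropy_of_entPart_wordMap [Finite ι] [Fintype κ] [DecidableEq κ]
    [MeasurableSpace A] [DiscreteMeasurableSpace A]
    [TopologicalSpace A] [DiscreteTopology A] [BorelSpace (ℕ → A)]
    (hb : ∀ q, 2 ≤ b q) {ν : Measure (ℕ → A)} [IsProbabilityMeasure ν]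
    (hν : MeasurePreserving shiftMap ν ν) {h : ℝ}
    (hh : ∀ n : ℕ, n * h ≤ entPart ν (wordMap (visDigit p dig) n)) :
    h ≤ ksEntropy (torusMul fun q => b (p q)) ((ν.map (codePoint dig)).map (coordProj p)) := by
  have hb' : ∀ q, 2 ≤ b (p q) := fun q => hb _
  have hb0 : ∀ q, 0 < b q := fun q => by linarith [hb q]
  obtain ⟨C, hC, hCx⟩ := exists_canonical_partition hb'
  have hP := measurable_coordProj p
  have hcode : Measurable (codePoint dig) := (continuous_codePoint dig).measurable
  have : IsProbabilityMeasure (ν.map (codePoint dig)) :=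
    Measure.isProbabilityMeasure_map hcode.aemeasurable
  have : IsProbabilityMeasure ((ν.map (codePoint dig)).map (coordProj p)) :=
    Measure.isProbabilityMeasure_map hP.aemeasurable
  have hT : Measurable (torusMul b) := continuous_torusMul.measurable
  have hμ : MeasurePreserving (torusMul b) (ν.map (codePoint dig)) (ν.map (codePoint dig)) := by
    refine ⟨hT, ?_⟩
    rw [Measure.map_map hT hcode]
    conv_rhs => rw [← hν.map_eq, Measure.map_map hcode hν.measurable]
    congr 1
    exact funext fun ω => torusMul_codePoint dig hb0 ω
  have hpres := measurePreserving_coordProj p hμ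
  have hit := measurable_itinerary hpres.measurable hC
  have key : ∀ n : ℕ, n * h ≤ entPart ((ν.map (codePoint dig)).map (coordProj p))
      (itinerary (torusMul fun q => b (p q)) C n) + Fintype.card κ * Real.log 12 := by
    intro n
    refine (hh n).trans ?_
    rw [entPart_map _ hP (hit n),
      entPart_map ν hcode (f := fun x => itinerary (torusMul fun q => b (p q)) C n (coordProj p x))
        ((hit n).comp hP)]
    refine entPart_le_of_compatWords ν (fun q => hb0 _) (((hit n).comp hP).comp hcode)
      (measurable_wordMap _ n) (ae_of_all _ fun ω => ?_)
    refine ⟨fun n => C ((torusMul fun q => b (p q))^[n] (coordProj p (codePoint dig ω))),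
      fun n => visDigit p dig (ω n), fun i => rfl, fun i => rfl, ?_⟩
    rw [hCx]; rfl
  refine le_ksEntropy hpres hC (fun δ hδ => exists_dist_lt_of_itinerary_eq hb' hCx hδ)
    fun n hn => ?_
  set F := entPart ((ν.map (codePoint dig)).map (coordProj p))
    (itinerary (torusMul fun q => b (p q)) C n) with hF
  have h3 : ∀ k : ℕ, k * (n * h - F) ≤ Fintype.card κ * Real.log 12 := by
    intro k
    have h1 := key (k * n)
    have h2 := entPart_itinerary_le hpres hC hn (le_refl (k * n))
    push_cast at h1
    linarith
  by_contra! hlt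
  obtain ⟨k, hk⟩ := exists_nat_gt (Fintype.card κ * Real.log 12 / (n * h - F))
  rw [div_lt_iff₀ (by linarith)] at hk
  exact absurd (h3 k) (not_le.2 hk)

end Addresses

/-! ### Counting good words -/

section Counting

variable {ι κ A : Type*} [Fintype ι] [Fintype κ] {b : ι → ℕ} (p : κ → ι)
  (dig : A → ∀ q, Fin (b q)) [Fintype A] [TopologicalSpace A] [DiscreteTopology A]
  [MeasurableSpace A] [BorelSpace A] {N : ℕ}

/-- The entropies of the factor measures of the invariant measures carried by the coded set whose
`φ`-integral is `α`. -/
def levelEntropies {ι κ A : Type*} {b : ι → ℕ} (p : κ → ι) (dig : A → ∀ q, Fin (b q)) {N : ℕ}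
    (φ : (ι → AddCircle (1 : ℝ)) → Fin N → ℝ) (α : Fin N → ℝ) : Set ℝ :=
  {h | ∃ μ : ProbabilityMeasure (ι → AddCircle (1 : ℝ)),
    (IsInvariantPM (torusMul b) μ ∧
      (μ : Measure (ι → AddCircle (1 : ℝ))) (range (codePoint dig)) = 1) ∧
    ∫ x, φ x ∂(μ : Measure (ι → AddCircle (1 : ℝ))) = α ∧
    h = ksEntropy (torusMul fun q => b (p q))
      ((μ : Measure (ι → AddCircle (1 : ℝ))).map (coordProj p))}

lemma bddAbove_levelEntropies [Nonempty A] (hb : ∀ q, 2 ≤ b q)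
    (φ : (ι → AddCircle (1 : ℝ)) → Fin N → ℝ)
    (α : Fin N → ℝ) : BddAbove (levelEntropies p dig φ α) := by
  classical
  refine ⟨Real.log (Fintype.card (Fin 1 → ∀ q, Fin (b (p q)))) + Fintype.card κ * Real.log 12, ?_⟩
  rintro _ ⟨μ, ⟨hinv, hΛ⟩, -, rfl⟩
  obtain ⟨W, hW, h⟩ := exists_address_selector (ι := ι) dig 1
  have hms : MeasurableSet (range (codePoint dig)) :=
    (isCompact_range (continuous_codePoint dig)).measurableSet
  have h1 := mul_ksEntropy_le_entPart_address p dig hb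
    (μ := (μ : Measure (ι → AddCircle (1 : ℝ)))) ⟨continuous_torusMul.measurable, hinv⟩
    ((prob_compl_eq_zero_iff hms).2 hΛ) one_pos hW h
  have : IsProbabilityMeasure ((μ : Measure (ι → AddCircle (1 : ℝ))).map W) :=
    Measure.isProbabilityMeasure_map hW.aemeasurable
  have h2 := entPart_le_log_card ((μ : Measure (ι → AddCircle (1 : ℝ))).map W)
    (f := fun w i => visDigit p dig (w i))
    (measurable_pi_lambda _ fun i => (Measurable.of_discrete (f := visDigit p dig)).comp
      (measurable_pi_apply i))
  simp only [Nat.cast_one, one_mul] at h1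
  linarith

lemma integral_birkSum_codePoint (hb : ∀ q, 0 < b q) {φ : (ι → AddCircle (1 : ℝ)) → Fin N → ℝ}
    (hφ : ContinuousOn φ (range (codePoint dig))) {μ : Measure (ι → AddCircle (1 : ℝ))}
    [IsProbabilityMeasure μ] (hμ : MeasurePreserving (torusMul b) μ μ)
    (hΛ : ∀ᵐ x ∂μ, x ∈ range (codePoint dig)) {m : ℕ} {δ : ℝ}
    (hδ : ∀ ω ω' : ℕ → A, (∀ i < m, ω i = ω' i) →
      ‖birkSum (φ ∘ codePoint dig) m ω - birkSum (φ ∘ codePoint dig) m ω'‖ ≤ δ * m)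
    {W : (ι → AddCircle (1 : ℝ)) → Fin m → A} (hW : Measurable W)
    (h : ∀ ω : ℕ → A, ∃ ω' : ℕ → A, codePoint dig ω' = codePoint dig ω ∧
        ∀ i : Fin m, ω' i = W (codePoint dig ω) i) (e : (Fin m → A) → ℕ → A)
    (he : ∀ w (i : Fin m), e w i = w i) :
    ‖∫ w, birkSum (φ ∘ codePoint dig) m (e w) ∂(μ.map W) - m • ∫ x, φ x ∂μ‖ ≤ δ * m := by
  have hint : Integrable φ μ := by
    have := hφ.integrableOn_compact (μ := μ) (isCompact_range (continuous_codePoint dig))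
    rwa [IntegrableOn, Measure.restrict_eq_self_of_ae_mem hΛ] at this
  have hiter : ∀ i : ℕ, Integrable (fun x => φ ((torusMul b)^[i] x)) μ := fun i =>
    (hμ.iterate i).integrable_comp_of_integrable hint
  have hsum : ∫ x, ∑ i ∈ Finset.range m, φ ((torusMul b)^[i] x) ∂μ = m • ∫ x, φ x ∂μ := by
    rw [integral_finsetSum _ fun i _ => hiter i]
    have : ∀ i, ∫ x, φ ((torusMul b)^[i] x) ∂μ = ∫ x, φ x ∂μ := fun i => by
      have hi := hμ.iterate i
      conv_rhs => rw [← hi.map_eq]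
      rw [integral_map hi.measurable.aemeasurable]
      rw [hi.map_eq]; exact hint.aestronglyMeasurable
    simp [this]
  have hG : Measurable fun w => birkSum (φ ∘ codePoint dig) m (e w) := Measurable.of_discrete
  rw [integral_map hW.aemeasurable hG.aestronglyMeasurable, ← hsum]
  have hbd : ∀ᵐ x ∂μ, ‖birkSum (φ ∘ codePoint dig) m (e (W x)) -
      ∑ i ∈ Finset.range m, φ ((torusMul b)^[i] x)‖ ≤ δ * m := by
    filter_upwards [hΛ]
    rintro _ ⟨ω, rfl⟩
    obtain ⟨ω', h1, h2⟩ := h ω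
    have h3 : ∑ i ∈ Finset.range m, φ ((torusMul b)^[i] (codePoint dig ω)) =
        birkSum (φ ∘ codePoint dig) m ω' := by
      rw [← h1]
      exact Finset.sum_congr rfl fun i _ => by rw [torusMul_iterate_codePoint dig hb]; rfl
    rw [h3]
    exact hδ _ _ fun i hi => by rw [he _ ⟨i, hi⟩, h2 ⟨i, hi⟩]
  have hfin : Integrable (fun x => birkSum (φ ∘ codePoint dig) m (e (W x))) μ := by
    obtain ⟨K, hK⟩ :=
      (toFinite (range fun w => birkSum (φ ∘ codePoint dig) m (e w))).isBounded.exists_norm_le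
    exact Integrable.of_bound (hG.comp hW).aestronglyMeasurable K
      (ae_of_all _ fun x => hK _ ⟨W x, rfl⟩)
  rw [← integral_sub hfin (integrable_finsetSum _ fun i _ => hiter i)]
  simpa using norm_integral_le_of_norm_le_const hbd

lemma exp_le_ncard_goodWords_of_levelEntropies [Nonempty A] (hb : ∀ q, 2 ≤ b q)
    {φ : (ι → AddCircle (1 : ℝ)) → Fin N → ℝ} (hφ : ContinuousOn φ (range (codePoint dig)))
    {α : Fin N → ℝ} {h : ℝ} (hh : h ∈ levelEntropies p dig φ α) {ε δ : ℝ} (hε : 0 < ε)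
    (hδ : 0 < δ) :
    ∃ M : ℕ, ∀ m ≥ M, ∃ n₀ : ℕ, ∀ n ≥ n₀, Real.exp (n * (m * (h - ε))) ≤
      (goodWords (visDigit p dig) (φ ∘ codePoint dig) α (n * m) δ).ncard := by
  classical
  obtain ⟨μ, ⟨hinv, hΛ⟩, hα, rfl⟩ := hh
  have hb0 : ∀ q, 0 < b q := fun q => by linarith [hb q]
  have hms : MeasurableSet (range (codePoint dig)) :=
    (isCompact_range (continuous_codePoint dig)).measurableSet
  have hψ : Continuous (φ ∘ codePoint dig) :=
    hφ.comp_continuous (continuous_codePoint dig) fun ω => ⟨ω, rfl⟩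
  have hμ : MeasurePreserving (torusMul b) (μ : Measure (ι → AddCircle (1 : ℝ))) μ :=
    ⟨continuous_torusMul.measurable, hinv⟩
  have hΛ' : ∀ᵐ x ∂(μ : Measure (ι → AddCircle (1 : ℝ))), x ∈ range (codePoint dig) :=
    (prob_compl_eq_zero_iff hms).2 hΛ
  set c := Fintype.card κ * Real.log 12 with hc
  obtain ⟨M₁, hM₁⟩ := exists_birkSum_sub_le hψ (show 0 < δ / 3 by positivity)
  obtain ⟨M₂, hM₂⟩ := exists_nat_ge ((c + 1) / ε)
  refine ⟨max (max M₁ M₂) 1, fun m hm => ?_⟩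
  have hm1 : M₁ ≤ m := (le_max_left _ _).trans ((le_max_left _ _).trans hm)
  have hm2 : M₂ ≤ m := (le_max_right _ _).trans ((le_max_left _ _).trans hm)
  have hm0 : 0 < m := (le_max_right _ _).trans hm
  obtain ⟨W, hW, hsel⟩ := exists_address_selector (ι := ι) dig m
  have : IsProbabilityMeasure ((μ : Measure (ι → AddCircle (1 : ℝ))).map W) :=
    Measure.isProbabilityMeasure_map hW.aemeasurable
  let e : (Fin m → A) → ℕ → A := fun w i =>
    if hi : i < m then w ⟨i, hi⟩ else Classical.arbitrary A
  have he : ∀ w (i : Fin m), e w i = w i := fun w i => by simp [e]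
  have hρ := integral_birkSum_codePoint dig hb0 hφ hμ hΛ' (hM₁ m hm1) hW hsel e he
  rw [hα] at hρ
  obtain ⟨n₀, hn₀⟩ := exists_card_goodWords_ge (visDigit p dig) (φ ∘ codePoint dig) α hm0
    (show 0 < δ / 3 by positivity) (hM₁ m hm1) ((μ : Measure (ι → AddCircle (1 : ℝ))).map W) e he hρ
    one_pos
  refine ⟨n₀, fun n hn => ?_⟩
  have h1 := hn₀ n hn
  rw [mul_div_cancel₀ δ (by norm_num : (3 : ℝ) ≠ 0)] at h1
  refine le_trans (Real.exp_le_exp.2 ?_) h1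
  have h2 := mul_ksEntropy_le_entPart_address p dig hb hμ hΛ' hm0 hW hsel
  have h3 : c + 1 ≤ m * ε := by
    rw [← div_le_iff₀ hε]
    exact hM₂.trans (by exact_mod_cast hm2)
  gcongr
  linarith

lemma exp_le_ncard_goodWords [Nonempty A] (hb : ∀ q, 2 ≤ b q)
    {φ : (ι → AddCircle (1 : ℝ)) → Fin N → ℝ} (hφ : ContinuousOn φ (range (codePoint dig)))
    {α : Fin N → ℝ} (hne : (levelEntropies p dig φ α).Nonempty) {ε δ : ℝ} (hε : 0 < ε)
    (hδ : 0 < δ) :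
    ∃ M : ℕ, ∀ m ≥ M, ∃ n₀ : ℕ, ∀ n ≥ n₀,
      Real.exp (n * (m * (sSup (levelEntropies p dig φ α) - ε))) ≤
      (goodWords (visDigit p dig) (φ ∘ codePoint dig) α (n * m) δ).ncard := by
  obtain ⟨h, hh, hlt⟩ := exists_lt_of_lt_csSup hne
    (show sSup (levelEntropies p dig φ α) - ε / 2 < _ by linarith)
  obtain ⟨M, hM⟩ := exp_le_ncard_goodWords_of_levelEntropies p dig hb hφ hh (half_pos hε) hδ
  refine ⟨M, fun m hm => ?_⟩
  obtain ⟨n₀, hn₀⟩ := hM m hm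
  refine ⟨n₀, fun n hn => le_trans (Real.exp_le_exp.2 ?_) (hn₀ n hn)⟩
  exact mul_le_mul_of_nonneg_left (mul_le_mul_of_nonneg_left (by linarith) m.cast_nonneg)
    n.cast_nonneg

lemma ncard_goodWords_le_exp [Nonempty A] (hb : ∀ q, 2 ≤ b q)
    {φ : (ι → AddCircle (1 : ℝ)) → Fin N → ℝ} (hφ : ContinuousOn φ (range (codePoint dig)))
    (α : Fin N → ℝ) {ε : ℝ} (hε : 0 < ε) :
    ∃ δ > 0, ∃ M : ℕ, ∀ m ≥ M,
      ((goodWords (visDigit p dig) (φ ∘ codePoint dig) α m δ).ncard : ℝ) ≤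
        Real.exp (m * (sSup (levelEntropies p dig φ α) + ε)) := by
  classical
  by_contra! hcon
  have hψ : Continuous (φ ∘ codePoint dig) :=
    hφ.comp_continuous (continuous_codePoint dig) fun ω => ⟨ω, rfl⟩
  obtain ⟨ν, hν, hα, hent⟩ := exists_invariant_of_card_goodWords (visDigit p dig)
    (φ ∘ codePoint dig) hψ α (sSup (levelEntropies p dig φ α) + ε) fun δ hδ M => by
      obtain ⟨m, hm, h⟩ := hcon δ hδ M
      exact ⟨m, hm, h.le⟩
  have hcode : Measurable (codePoint dig) := (continuous_codePoint dig).measurable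
  have hb0 : ∀ q, 0 < b q := fun q => by linarith [hb q]
  have hνp : MeasurePreserving shiftMap (ν : Measure (ℕ → A)) ν :=
    ⟨measurable_shiftMap, hν⟩
  have hle := le_ksEntropy_of_entPart_wordMap p dig hb hνp hent
  have hms : MeasurableSet (range (codePoint dig)) :=
    (isCompact_range (continuous_codePoint dig)).measurableSet
  have hmem : ksEntropy (torusMul fun q => b (p q))
      (((ν : Measure (ℕ → A)).map (codePoint dig)).map (coordProj p)) ∈
        levelEntropies p dig φ α := by
    refine ⟨ν.map hcode.aemeasurable, ⟨?_, ?_⟩, ?_, rfl⟩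
    · change ((ν : Measure (ℕ → A)).map (codePoint dig)).map (torusMul b) =
        (ν : Measure (ℕ → A)).map (codePoint dig)
      rw [Measure.map_map continuous_torusMul.measurable hcode]
      conv_rhs => rw [← hνp.map_eq, Measure.map_map hcode hνp.measurable]
      congr 1
      exact funext fun ω => torusMul_codePoint dig hb0 ω
    · change ((ν : Measure (ℕ → A)).map (codePoint dig)) (range (codePoint dig)) = 1
      rw [Measure.map_apply hcode hms]
      simp
    · change ∫ x, φ x ∂((ν : Measure (ℕ → A)).map (codePoint dig)) = α
      have hΛ : ∀ᵐ x ∂((ν : Measure (ℕ → A)).map (codePoint dig)), x ∈ range (codePoint dig) :=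
        (ae_map_iff hcode.aemeasurable hms).2 (ae_of_all _ fun ω => ⟨ω, rfl⟩)
      have hint := hφ.integrableOn_compact (μ := (ν : Measure (ℕ → A)).map (codePoint dig))
        (isCompact_range (continuous_codePoint dig))
      rw [IntegrableOn, Measure.restrict_eq_self_of_ae_mem hΛ] at hint
      rw [integral_map hcode.aemeasurable hint.aestronglyMeasurable]
      exact hα
  have := le_csSup (bddAbove_levelEntropies p dig hb φ α) hmem
  linarith

end Counting

/-! ### Covering numbers and box dimension -/

section Dimension

/-- The family `x` shifted by one index, starting from zero. -/
def prevVal {M : Type*} [Zero M] {d : ℕ} (x : Fin (d + 1) → M) : Fin (d + 1) → M :=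
  Fin.cons 0 fun i => x i.castSucc

@[simp] lemma prevVal_zero {M : Type*} [Zero M] {d : ℕ} (x : Fin (d + 1) → M) :
    prevVal x 0 = 0 := rfl

@[simp] lemma prevVal_succ {M : Type*} [Zero M] {d : ℕ} (x : Fin (d + 1) → M) (i : Fin d) :
    prevVal x i.succ = x i.castSucc := rfl

lemma dimCombo_eq_sum {d : ℕ} (a : Fin (d + 1) → ℕ) (H : Fin (d + 1) → ℝ) :
    dimCombo a H =
      ∑ k, (1 / Real.log (a k) - prevVal (fun q => 1 / Real.log (a q)) k) * H k := by
  rw [dimCombo, Fin.sum_univ_succ]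
  simp only [prevVal_zero, prevVal_succ, sub_zero]
  congr 1
  ring

lemma prevVal_le_self {d : ℕ} {x : Fin (d + 1) → ℕ} (hx : Monotone x) (k : Fin (d + 1)) :
    prevVal x k ≤ x k := by
  refine Fin.cases (Nat.zero_le _) (fun i => ?_) k
  exact hx i.castSucc_le_succ

lemma exists_prevVal_le_lt {d : ℕ} (x : Fin (d + 1) → ℕ) {n : ℕ} (hn : n < x (Fin.last d)) :
    ∃ k, prevVal x k ≤ n ∧ n < x k := by
  classical
  have hex : ∃ k, n < x k := ⟨_, hn⟩
  obtain ⟨k, hk, hmin⟩ := WellFounded.has_min (wellFounded_lt (α := Fin (d + 1))) {k | n < x k} hex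
  refine ⟨k, ?_, hk⟩
  revert hmin hk
  refine Fin.cases (fun _ _ => Nat.zero_le _) (fun i _ hmin => ?_) k
  by_contra! hlt
  exact hmin i.castSucc hlt i.castSucc_lt_succ

lemma le_of_prevVal_le_lt {d : ℕ} {x : Fin (d + 1) → ℕ} (hx : Monotone x) {n : ℕ}
    {k k' : Fin (d + 1)} : prevVal x k ≤ n → n < x k' → k ≤ k' := by
  refine Fin.cases (fun _ _ => Fin.zero_le _) (fun i h1 h2 => ?_) k
  by_contra! hlt
  have : x k' ≤ x i.castSucc := hx (by
    rw [Fin.le_def]; rw [Fin.lt_def] at hlt; simp at hlt ⊢; omega)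
  rw [prevVal_succ] at h1
  omega

lemma eq_of_prevVal_le_lt {d : ℕ} {x : Fin (d + 1) → ℕ} (hx : Monotone x) {n : ℕ}
    {k k' : Fin (d + 1)} (h1 : prevVal x k ≤ n) (h2 : n < x k) (h1' : prevVal x k' ≤ n)
    (h2' : n < x k') : k = k' :=
  le_antisymm (le_of_prevVal_le_lt hx h1 h2') (le_of_prevVal_le_lt hx h1' h2)

lemma coverN_image_le {Ω X κ : Type*} [PseudoMetricSpace X] (g : Ω → X) (P : Set Ω) (lab : Ω → κ)
    (G : Finset κ) (hlab : ∀ ω ∈ P, lab ω ∈ G) {r : ℝ}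
    (hr : ∀ ω ∈ P, ∀ ω' ∈ P, lab ω = lab ω' → dist (g ω) (g ω') < r) :
    coverN (g '' P) r ≤ G.card := by
  classical
  have hle : ∀ t : Finset X, g '' P ⊆ ⋃ x ∈ t, ball x r → coverN (g '' P) r ≤ t.card :=
    fun t ht => Nat.sInf_le ⟨t, rfl, ht⟩
  rcases P.eq_empty_or_nonempty with rfl | ⟨ω₀, hω₀⟩
  · exact (hle ∅ (by simp)).trans (by simp)
  let c : κ → X := fun u => if h : ∃ ω ∈ P, lab ω = u then g h.choose else g ω₀
  refine (hle (G.image c) ?_).trans Finset.card_image_le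
  rintro _ ⟨ω, hω, rfl⟩
  have hex : ∃ ω' ∈ P, lab ω' = lab ω := ⟨ω, hω, rfl⟩
  refine mem_iUnion₂.2 ⟨c (lab ω), Finset.mem_image_of_mem c (hlab ω hω), ?_⟩
  rw [mem_ball]
  simp only [c, dif_pos hex]
  exact hr _ hω _ hex.choose_spec.1 hex.choose_spec.2.symm

lemma exists_finset_card_eq_coverN {X : Type*} [PseudoMetricSpace X] [CompactSpace X] (s : Set X)
    {r : ℝ} (hr : 0 < r) : ∃ t : Finset X, t.card = coverN s r ∧ s ⊆ ⋃ x ∈ t, ball x r := by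
  have hne : {n : ℕ | ∃ t : Finset X, t.card = n ∧ s ⊆ ⋃ x ∈ t, ball x r}.Nonempty := by
    obtain ⟨t, -, ht, hst⟩ := finite_cover_balls_of_compact (isCompact_univ (X := X)) hr
    refine ⟨_, ht.toFinset, rfl, fun x _ => ?_⟩
    simpa using hst (mem_univ x)
  exact Nat.sInf_mem hne

lemma eventually_logRatio_nonneg {X : Type*} [PseudoMetricSpace X] (s : Set X) :
    ∀ᶠ r : ℝ in 𝓝[>] 0, 0 ≤ Real.log (coverN s r) / Real.log r⁻¹ := by
  filter_upwards [Ioo_mem_nhdsGT (zero_lt_one' ℝ)] with r hr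
  exact div_nonneg (Real.log_natCast_nonneg _)
    (Real.log_nonneg ((one_le_inv₀ hr.1).2 hr.2.le))

lemma upperBoxDim_nonneg {X : Type*} [PseudoMetricSpace X] (s : Set X) : 0 ≤ upperBoxDim s := by
  refine Real.sInf_nonneg fun c hc => ?_
  obtain ⟨r, h1, h2⟩ := ((eventually_logRatio_nonneg s).and
    (show ∀ᶠ r : ℝ in 𝓝[>] 0, Real.log (coverN s r) / Real.log r⁻¹ ≤ c from hc)).exists
  exact h1.trans h2

lemma upperBoxDim_le_of_tendsto {X : Type*} [PseudoMetricSpace X] {s : Set X} {F : ℝ → ℝ} {c : ℝ}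
    (hF : Tendsto F (𝓝[>] 0) (𝓝 c))
    (h : ∀ᶠ r : ℝ in 𝓝[>] 0, Real.log (coverN s r) / Real.log r⁻¹ ≤ F r) : upperBoxDim s ≤ c := by
  rw [← hF.limsup_eq]
  refine limsup_le_limsup h ?_ hF.isBoundedUnder_le
  exact (isBoundedUnder_of_eventually_ge (eventually_logRatio_nonneg s)).isCoboundedUnder_le

lemma packingDim_le_of_cover {X : Type*} [PseudoMetricSpace X] {s : Set X} (C : ℕ → Set X)
    (hC : s ⊆ ⋃ n, C n) {c : ℝ} (h : ∀ n, upperBoxDim (C n) ≤ c) : packingDim s ≤ c := by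
  refine (ciInf_le ⟨0, ?_⟩ (⟨C, hC⟩ : {C : ℕ → Set X // s ⊆ ⋃ n, C n})).trans (ciSup_le h)
  rintro _ ⟨C', rfl⟩
  exact Real.iSup_nonneg fun n => upperBoxDim_nonneg _

lemma tendsto_log_inv_nhdsGT : Tendsto (fun r : ℝ => Real.log r⁻¹) (𝓝[>] 0) atTop :=
  Real.tendsto_log_atTop.comp tendsto_inv_nhdsGT_zero

/-- The number of base-`a` digits needed at scale `exp (-t)`. -/
def digitCount {d : ℕ} (a : Fin (d + 1) → ℕ) (t : ℝ) (q : Fin (d + 1)) : ℕ :=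
  ⌊1 / Real.log (a q) * t⌋₊

variable {d : ℕ} {a : Fin (d + 1) → ℕ}

lemma log_digit_pos (ha2 : ∀ q, 2 ≤ a q) (q : Fin (d + 1)) : 0 < Real.log (a q) :=
  Real.log_pos (by exact_mod_cast ha2 q)

lemma tendsto_digitCount_div (ha2 : ∀ q, 2 ≤ a q) (q : Fin (d + 1)) :
    Tendsto (fun t => (digitCount a t q : ℝ) / t) atTop (𝓝 (1 / Real.log (a q))) :=
  tendsto_nat_floor_mul_div_atTop (by have := log_digit_pos ha2 q; positivity)

lemma strictMono_one_div_log (ha : StrictAnti a) (ha2 : ∀ q, 2 ≤ a q) :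
    StrictMono fun q => 1 / Real.log (a q) := fun p q hpq =>
  one_div_lt_one_div_of_lt (log_digit_pos ha2 q)
    (Real.log_lt_log (by exact_mod_cast (by linarith [ha2 q] : 0 < a q))
      (by exact_mod_cast ha hpq))

lemma monotone_digitCount (ha : StrictAnti a) (ha2 : ∀ q, 2 ≤ a q) {t : ℝ} (ht : 0 ≤ t) :
    Monotone (digitCount a t) := fun _ _ hpq =>
  Nat.floor_le_floor (mul_le_mul_of_nonneg_right ((strictMono_one_div_log ha ha2).monotone hpq) ht)

lemma inv_pow_lt_exp_neg (ha2 : ∀ q, 2 ≤ a q) (t : ℝ) (q : Fin (d + 1)) :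
    ((a q : ℝ) ^ (digitCount a t q + 1))⁻¹ < Real.exp (-t) := by
  have hl := log_digit_pos ha2 q
  have ha0 : (0 : ℝ) < a q := by exact_mod_cast (by linarith [ha2 q] : 0 < a q)
  rw [← Real.exp_log (show (0 : ℝ) < ((a q : ℝ) ^ (digitCount a t q + 1))⁻¹ by positivity),
    Real.exp_lt_exp, Real.log_inv, Real.log_pow, neg_lt_neg_iff]
  have := Nat.lt_floor_add_one (1 / Real.log (a q) * t)
  rw [one_div_mul_eq_div, div_lt_iff₀ hl, ← one_div_mul_eq_div] at this
  push_cast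
  exact this

lemma exp_neg_le_inv_pow (ha2 : ∀ q, 2 ≤ a q) {t : ℝ} (ht : 0 ≤ t) {q : Fin (d + 1)} {L : ℕ}
    (hL : L ≤ digitCount a t q) : Real.exp (-t) ≤ ((a q : ℝ) ^ L)⁻¹ := by
  have hl := log_digit_pos ha2 q
  have ha0 : (0 : ℝ) < a q := by exact_mod_cast (by linarith [ha2 q] : 0 < a q)
  rw [← Real.exp_log (show (0 : ℝ) < ((a q : ℝ) ^ L)⁻¹ by positivity),
    Real.exp_le_exp, Real.log_inv, Real.log_pow, neg_le_neg_iff]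
  have h1 : (L : ℝ) ≤ digitCount a t q := by exact_mod_cast hL
  have h2 : (digitCount a t q : ℝ) ≤ 1 / Real.log (a q) * t :=
    Nat.floor_le (by positivity)
  have := h1.trans h2
  rwa [one_div_mul_eq_div, le_div_iff₀ hl] at this

lemma exists_logRatio_le (ha2 : ∀ q, 2 ≤ a q) :
    ∃ K : ℝ, ∀ C : Set (Fin (d + 1) → AddCircle (1 : ℝ)),
      ∀ᶠ r : ℝ in 𝓝[>] 0, Real.log (coverN C r) / Real.log r⁻¹ ≤ K := by
  classical
  let F : ℝ → ℝ := fun t => ∑ q, ((digitCount a t q : ℝ) / t + 1 / t) * Real.log (a q)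
  have hF : Tendsto F atTop (𝓝 (∑ q, (1 / Real.log (a q) + 0) * Real.log (a q))) :=
    tendsto_finsetSum _ fun q _ => ((tendsto_digitCount_div ha2 q).add
      (tendsto_const_nhds.div_atTop tendsto_id)).mul_const _
  refine ⟨(∑ q, (1 / Real.log (a q) + 0) * Real.log (a q)) + 1, fun C => ?_⟩
  have h1 := tendsto_log_inv_nhdsGT.eventually (hF.eventually_le_const (lt_add_one _))
  filter_upwards [h1, Ioo_mem_nhdsGT (zero_lt_one' ℝ)] with r hr hr01
  refine le_trans ?_ hr
  set t := Real.log r⁻¹ with ht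
  have ht0 : 0 < t := Real.log_pos ((one_lt_inv₀ hr01.1).2 hr01.2)
  have hrt : r = Real.exp (-t) := by
    rw [ht, Real.log_inv, neg_neg, Real.exp_log hr01.1]
  obtain ⟨S, hS⟩ : ∃ S : (Fin (d + 1) → AddCircle (1 : ℝ)) → ℕ → ∀ q, Fin (a q),
      ∀ x, digitPoint a (S x) = x := by
    obtain ⟨c, -, hc⟩ := exists_canonical_partition ha2
    exact ⟨_, hc⟩
  have hcov : coverN C r ≤ ∏ q, a q ^ (digitCount a t q + 1) := by
    have := coverN_image_le (r := r) (fun x : Fin (d + 1) → AddCircle (1 : ℝ) => x) C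
      (fun x q (i : Fin (digitCount a t q + 1)) => S x i q) Finset.univ
      (fun _ _ => Finset.mem_univ _)
      (fun x _ y _ hxy => by
        rw [← hS x, ← hS y, dist_pi_lt_iff hr01.1]
        intro q
        rw [hrt]
        exact (dist_coe_ofDigits_le fun i hi => congrFun (congrFun hxy q) ⟨i, hi⟩).trans_lt
          (inv_pow_lt_exp_neg ha2 t q))
    simpa [Fintype.card_pi] using this
  have hlog : Real.log (coverN C r) ≤ ∑ q, ((digitCount a t q : ℝ) + 1) * Real.log (a q) := by
    have hpos : ∀ q, (0 : ℝ) < (a q : ℝ) ^ (digitCount a t q + 1) := fun q => by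
      have : (0 : ℝ) < a q := by exact_mod_cast (by linarith [ha2 q] : 0 < a q)
      positivity
    have heq : Real.log ((∏ q, a q ^ (digitCount a t q + 1) : ℕ) : ℝ) =
        ∑ q, ((digitCount a t q : ℝ) + 1) * Real.log (a q) := by
      push_cast
      rw [Real.log_prod fun q _ => (hpos q).ne']
      exact Finset.sum_congr rfl fun q _ => by rw [Real.log_pow]; push_cast; ring
    rw [← heq]
    rcases Nat.eq_zero_or_pos (coverN C r) with h0 | h0
    · rw [h0, Nat.cast_zero, Real.log_zero]; exact Real.log_natCast_nonneg _
    · exact Real.log_le_log (by exact_mod_cast h0) (by exact_mod_cast hcov)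
  rw [div_le_iff₀ ht0]
  refine hlog.trans_eq ?_
  rw [Finset.sum_mul]
  exact Finset.sum_congr rfl fun q _ => by field_simp

lemma eventually_logRatio_lt (ha2 : ∀ q, 2 ≤ a q)
    {C : Set (Fin (d + 1) → AddCircle (1 : ℝ))} {s : ℝ} (hs : upperBoxDim C < s) :
    ∀ᶠ r : ℝ in 𝓝[>] 0, Real.log (coverN C r) / Real.log r⁻¹ < s := by
  obtain ⟨K, hK⟩ := exists_logRatio_le ha2
  exact eventually_lt_of_limsup_lt hs (isBoundedUnder_of_eventually_le (hK C))

lemma exists_upperBoxDim_le (ha2 : ∀ q, 2 ≤ a q) :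
    ∃ K : ℝ, ∀ C : Set (Fin (d + 1) → AddCircle (1 : ℝ)), upperBoxDim C ≤ K := by
  obtain ⟨K, hK⟩ := exists_logRatio_le ha2
  exact ⟨K, fun C => upperBoxDim_le_of_tendsto tendsto_const_nhds (hK C)⟩

end Dimension

/-! ### The upper bound for the packing dimension -/

section UpperBound

variable {d : ℕ} {a : Fin (d + 1) → ℕ}

instance (k : Fin (d + 1)) : Fintype (ProjIdx d k) :=
  inferInstanceAs (Fintype {q : Fin (d + 1) // k ≤ q})

instance (k : Fin (d + 1)) : DecidableEq (ProjIdx d k) :=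
  inferInstanceAs (DecidableEq {q : Fin (d + 1) // k ≤ q})

/-- The digits with index at least `k`. -/
def tailDigit {A : Type*} (dig : A → ∀ q, Fin (a q)) (k : Fin (d + 1)) :
    A → ∀ q : ProjIdx d k, Fin (a q.1) :=
  visDigit (fun q : ProjIdx d k => q.1) dig

lemma tendsto_prevVal_div {τ : Type*} {F : Filter τ} {x : τ → Fin (d + 1) → ℕ} {t : τ → ℝ}
    {l : Fin (d + 1) → ℝ} (h : ∀ k, Tendsto (fun s => (x s k : ℝ) / t s) F (𝓝 (l k)))
    (k : Fin (d + 1)) :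
    Tendsto (fun s => ((prevVal (x s) k : ℕ) : ℝ) / t s) F (𝓝 (prevVal l k)) := by
  refine Fin.cases ?_ (fun i => ?_) k
  · simpa using tendsto_const_nhds
  · exact h i.castSucc

lemma tendsto_sub_prevVal_div {τ : Type*} {F : Filter τ} {x : τ → Fin (d + 1) → ℕ} {t : τ → ℝ}
    {l : Fin (d + 1) → ℝ} (h : ∀ k, Tendsto (fun s => (x s k : ℝ) / t s) F (𝓝 (l k)))
    (hx : ∀ᶠ s in F, Monotone (x s)) (k : Fin (d + 1)) :
    Tendsto (fun s => ((x s k - prevVal (x s) k : ℕ) : ℝ) / t s) F (𝓝 (l k - prevVal l k)) := by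
  refine ((h k).sub (tendsto_prevVal_div h k)).congr' ?_
  filter_upwards [hx] with s hs
  rw [Nat.cast_sub (prevVal_le_self hs k), sub_div]

lemma tendsto_natCast_atTop_of_div {τ : Type*} {F : Filter τ} {x : τ → ℕ} {t : τ → ℝ} {l : ℝ}
    (hl : 0 < l) (ht : Tendsto t F atTop) (h : Tendsto (fun s => (x s : ℝ) / t s) F (𝓝 l)) :
    Tendsto x F atTop := by
  rw [← tendsto_natCast_atTop_iff (R := ℝ)]
  refine (h.pos_mul_atTop hl ht).congr' ?_
  filter_upwards [ht.eventually_gt_atTop 0] with s hs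
  field_simp

lemma sub_prevVal_one_div_log_pos (ha : StrictAnti a) (ha2 : ∀ q, 2 ≤ a q) (k : Fin (d + 1)) :
    0 < 1 / Real.log (a k) - prevVal (fun q => 1 / Real.log (a q)) k := by
  refine Fin.cases ?_ (fun i => ?_) k
  · have := log_digit_pos ha2 0
    simpa using this
  · exact sub_pos.2 (strictMono_one_div_log ha ha2 i.castSucc_lt_succ)

lemma norm_birkSum_shift_sub_le {A E : Type*} [NormedAddCommGroup E] (ψ : (ℕ → A) → E) (α : E)
    (m n : ℕ) (ω : ℕ → A) :
    ‖birkSum ψ n (shiftMap^[m] ω) - n • α‖ ≤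
      ‖birkSum ψ (m + n) ω - (m + n) • α‖ + ‖birkSum ψ m ω - m • α‖ := by
  have : birkSum ψ n (shiftMap^[m] ω) - n • α =
      (birkSum ψ (m + n) ω - (m + n) • α) - (birkSum ψ m ω - m • α) := by
    rw [birkSum_add, add_nsmul]; abel
  rw [this]
  exact norm_sub_le _ _

lemma eventually_norm_birkSum_sub_le {A E : Type*} [NormedAddCommGroup E] [NormedSpace ℝ E]
    {ψ : (ℕ → A) → E} {α : E} {ω : ℕ → A}
    (h : Tendsto (fun n : ℕ => (n : ℝ)⁻¹ • birkSum ψ n ω) atTop (𝓝 α)) {δ : ℝ} (hδ : 0 < δ) :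
    ∀ᶠ n : ℕ in atTop, ‖birkSum ψ n ω - n • α‖ ≤ δ * n := by
  filter_upwards [h.eventually (closedBall_mem_nhds α hδ), eventually_gt_atTop 0] with n hn h0
  have hn0 : (0 : ℝ) < n := by exact_mod_cast h0
  have heq : birkSum ψ n ω - n • α = (n : ℝ) • ((n : ℝ)⁻¹ • birkSum ψ n ω - α) := by
    rw [smul_sub, smul_inv_smul₀ hn0.ne', Nat.cast_smul_eq_nsmul]
  rw [heq, norm_smul, Real.norm_of_nonneg hn0.le, mul_comm]
  rw [dist_eq_norm] at hn
  gcongr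

/-- The points whose addresses have Birkhoff averages of `ψ` converging to `α`. -/
def codeLevel {A E : Type*} [NormedAddCommGroup E] [NormedSpace ℝ E] (dig : A → ∀ q, Fin (a q))
    (ψ : (ℕ → A) → E) (α : E) : Set (Fin (d + 1) → AddCircle (1 : ℝ)) :=
  {x | ∃ ω, codePoint dig ω = x ∧ Tendsto (fun n : ℕ => (n : ℝ)⁻¹ • birkSum ψ n ω) atTop (𝓝 α)}

lemma dist_codePoint_lt_of_wordMap_eq {A : Type*} (ha : StrictAnti a) (ha2 : ∀ q, 2 ≤ a q)
    (dig : A → ∀ q, Fin (a q)) {t : ℝ} (ht : 0 ≤ t) {ω ω' : ℕ → A}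
    {L : Fin (d + 1) → ℕ} (hL : ∀ q, L q = digitCount a t q + 1)
    (h : ∀ k, wordMap (tailDigit dig k) (L k - prevVal L k) (shiftMap^[prevVal L k] ω) =
      wordMap (tailDigit dig k) (L k - prevVal L k) (shiftMap^[prevVal L k] ω')) :
    dist (codePoint dig ω) (codePoint dig ω') < Real.exp (-t) := by
  have hmono : Monotone L := fun p q hpq => by
    rw [hL, hL]
    exact Nat.succ_le_succ (monotone_digitCount ha ha2 ht hpq)
  rw [dist_pi_lt_iff (Real.exp_pos _)]
  intro q
  refine (dist_coe_ofDigits_le (n := L q) fun i hi => ?_).trans_lt ?_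
  · obtain ⟨k, hk1, hk2⟩ := exists_prevVal_le_lt L (hi.trans_le (hmono (Fin.le_last q)))
    have hkq : k ≤ q := le_of_prevVal_le_lt hmono hk1 hi
    have := congrFun (congrFun (h k) ⟨i - prevVal L k, by omega⟩) ⟨q, hkq⟩
    simpa [wordMap, tailDigit, visDigit, shiftMap_iterate, Nat.sub_add_cancel hk1] using this
  · rw [hL]
    exact inv_pow_lt_exp_neg ha2 t q

lemma packingDim_codeLevel_le {A E : Type*} [Finite A] [NormedAddCommGroup E] [NormedSpace ℝ E]
    (ha : StrictAnti a) (ha2 : ∀ q, 2 ≤ a q) (dig : A → ∀ q, Fin (a q)) (ψ : (ℕ → A) → E) (α : E)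
    {H : Fin (d + 1) → ℝ} (hH : ∀ k, 0 ≤ H k) {δ : ℝ} (hδ : 0 < δ) {M₀ : ℕ}
    (hcard : ∀ k, ∀ m ≥ M₀,
      ((goodWords (tailDigit dig k) ψ α m δ).ncard : ℝ) ≤ Real.exp (m * H k)) :
    packingDim (codeLevel dig ψ α) ≤ dimCombo a H := by
  classical
  set ℓ : Fin (d + 1) → ℝ := fun q => 1 / Real.log (a q) with hℓ
  have hg := sub_prevVal_one_div_log_pos ha ha2
  obtain ⟨δ', hδ'g, hδ'⟩ : ∃ δ' : ℝ, (∀ k, 2 * δ' * ℓ k < δ * (ℓ k - prevVal ℓ k)) ∧ 0 < δ' := by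
    refine ((eventually_all.2 fun k => ?_ : ∀ᶠ δ' in 𝓝[>] (0 : ℝ), ∀ k,
      2 * δ' * ℓ k < δ * (ℓ k - prevVal ℓ k)).and self_mem_nhdsWithin).exists
    have : Tendsto (fun x : ℝ => 2 * x * ℓ k) (𝓝[>] 0) (𝓝 (2 * 0 * ℓ k)) :=
      ((tendsto_id.const_mul 2).mul_const _).mono_left nhdsWithin_le_nhds
    refine this.eventually_lt_const ?_
    rw [mul_zero, zero_mul]
    exact mul_pos hδ (hg k)
  let P : ℕ → Set (ℕ → A) := fun M => {ω | ∀ n ≥ M, ‖birkSum ψ n ω - n • α‖ ≤ δ' * n}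
  refine packingDim_le_of_cover (fun M => codePoint dig '' P M) ?_ fun M => ?_
  · rintro _ ⟨ω, rfl, hω⟩
    obtain ⟨M, hM⟩ := eventually_atTop.1 (eventually_norm_birkSum_sub_le hω hδ')
    exact mem_iUnion.2 ⟨M, ω, hM, rfl⟩
  let L : ℝ → Fin (d + 1) → ℕ := fun t q => digitCount a t q + 1
  have hL : ∀ k, Tendsto (fun t => (L t k : ℝ) / t) atTop (𝓝 (ℓ k)) := fun k => by
    have := (tendsto_digitCount_div ha2 k).add
      ((tendsto_const_nhds (x := (1 : ℝ))).div_atTop (tendsto_id (x := (atTop : Filter ℝ))))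
    rw [add_zero] at this
    refine this.congr fun t => ?_
    simp only [L]
    push_cast
    rw [add_div, id]
  have hLmono : ∀ᶠ t in atTop, Monotone (L t) := by
    filter_upwards [eventually_ge_atTop 0] with t ht p q hpq
    exact Nat.succ_le_succ (monotone_digitCount ha ha2 ht hpq)
  have hLg := tendsto_sub_prevVal_div hL hLmono
  have hn : ∀ᶠ t in atTop, ∀ k, max M₀ M ≤ L t k - prevVal (L t) k := eventually_all.2 fun k =>
    (tendsto_natCast_atTop_of_div (hg k) tendsto_id (hLg k)).eventually_ge_atTop _
  have hlow : ∀ᶠ t in atTop, ∀ k, prevVal (L t) k = 0 ∨ M ≤ prevVal (L t) k := by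
    refine eventually_all.2 fun k => Fin.cases ?_ (fun i => ?_) k
    · simp
    · filter_upwards [(tendsto_natCast_atTop_of_div (one_div_pos.2 (log_digit_pos ha2 _)) tendsto_id
        (hL i.castSucc)).eventually_ge_atTop M] with t ht
      exact Or.inr ht
  have hdom : ∀ᶠ t in atTop, ∀ k,
      2 * δ' * L t k ≤ δ * (L t k - prevVal (L t) k : ℕ) := by
    refine eventually_all.2 fun k => ?_
    filter_upwards [((hL k).const_mul (2 * δ')).eventually_lt ((hLg k).const_mul δ) (hδ'g k),
      eventually_gt_atTop 0] with t ht ht0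
    rw [← mul_div_assoc, ← mul_div_assoc, div_lt_div_iff_of_pos_right ht0] at ht
    exact ht.le
  have hF : Tendsto (fun t => ∑ k, ((L t k - prevVal (L t) k : ℕ) : ℝ) / t * H k) atTop
      (𝓝 (dimCombo a H)) := by
    rw [dimCombo_eq_sum]
    exact tendsto_finsetSum _ fun k _ => (hLg k).mul_const _
  refine upperBoxDim_le_of_tendsto (hF.comp tendsto_log_inv_nhdsGT) ?_
  filter_upwards [tendsto_log_inv_nhdsGT.eventually (hLmono.and (hn.and (hlow.and hdom))),
    Ioo_mem_nhdsGT (zero_lt_one' ℝ)] with r hr hr01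
  simp only [Function.comp]
  set t := Real.log r⁻¹ with ht
  obtain ⟨hmono, hn, hlow, hdom⟩ := hr
  have ht0 : 0 < t := Real.log_pos ((one_lt_inv₀ hr01.1).2 hr01.2)
  have hrt : r = Real.exp (-t) := by
    rw [ht, Real.log_inv, neg_neg, Real.exp_log hr01.1]
  set n : Fin (d + 1) → ℕ := fun k => L t k - prevVal (L t) k with hn_def
  let G := Fintype.piFinset fun k => (toFinite (goodWords (tailDigit dig k) ψ α (n k) δ)).toFinset
  have hcov : coverN (codePoint dig '' P M) r ≤ G.card := by
    refine coverN_image_le _ _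
      (fun ω k => wordMap (tailDigit dig k) (n k) (shiftMap^[prevVal (L t) k] ω)) G ?_ ?_
    · intro ω hω
      refine Fintype.mem_piFinset.2 fun k => (Finite.mem_toFinset _).2 ⟨_, ?_, fun i => rfl⟩
      have hsum : prevVal (L t) k + n k = L t k := Nat.add_sub_cancel' (prevVal_le_self hmono k)
      have hLM : M ≤ L t k := ((le_max_right _ _).trans (hn k)).trans (Nat.sub_le _ _)
      refine (norm_birkSum_shift_sub_le ψ α _ _ ω).trans ?_
      rw [hsum]
      have h1 := hω _ hLM
      have h2 : ‖birkSum ψ (prevVal (L t) k) ω - prevVal (L t) k • α‖ ≤ δ' * L t k := by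
        rcases hlow k with h0 | hM
        · rw [h0]
          simp only [birkSum, Finset.range_zero, Finset.sum_empty, zero_smul, sub_zero, norm_zero]
          positivity
        · refine (hω _ hM).trans ?_
          have : ((prevVal (L t) k : ℕ) : ℝ) ≤ L t k := by exact_mod_cast prevVal_le_self hmono k
          gcongr
      linarith [hdom k]
    · intro ω _ ω' _ h
      rw [hrt]
      exact dist_codePoint_lt_of_wordMap_eq ha ha2 dig ht0.le (fun _ => rfl) fun k => congrFun h k
  have hlog : Real.log (coverN (codePoint dig '' P M) r) ≤ ∑ k, (n k : ℝ) * H k := by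
    rcases Nat.eq_zero_or_pos (coverN (codePoint dig '' P M) r) with h0 | h0
    · rw [h0, Nat.cast_zero, Real.log_zero]
      exact Finset.sum_nonneg fun k _ => mul_nonneg (Nat.cast_nonneg _) (hH k)
    · rw [Real.log_le_iff_le_exp (by exact_mod_cast h0), Real.exp_sum]
      calc (coverN (codePoint dig '' P M) r : ℝ) ≤ G.card := by exact_mod_cast hcov
        _ = ∏ k, ((goodWords (tailDigit dig k) ψ α (n k) δ).ncard : ℝ) := by
          rw [Fintype.card_piFinset, Nat.cast_prod]
          exact Finset.prod_congr rfl fun k _ => by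
            rw [Set.ncard_eq_toFinset_card _ (toFinite _)]
        _ ≤ _ := Finset.prod_le_prod (fun _ _ => Nat.cast_nonneg _) fun k _ =>
          hcard k _ ((le_max_left _ _).trans (hn k))
  rw [div_le_iff₀ ht0, Finset.sum_mul]
  refine hlog.trans_eq (Finset.sum_congr rfl fun k _ => ?_)
  rw [div_mul_eq_mul_div, div_mul_cancel₀ _ ht0.ne']

end UpperBound

/-! ### The lower bound for the packing dimension -/

section LowerBound

/-- The concatenation of the initial blocks of length `B` of a sequence of sequences. -/
def blockSeq {A : Type*} (B : ℕ) (y : ℕ → ℕ → A) : ℕ → A := fun n => y (n / B) (n % B)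

lemma blockSeq_mul_add {A : Type*} {B i : ℕ} (hi : i < B) (y : ℕ → ℕ → A) (j : ℕ) :
    blockSeq B y (j * B + i) = y j i := by
  have hB : 0 < B := by omega
  rw [blockSeq, Nat.add_comm, Nat.add_mul_div_right _ _ hB, Nat.div_eq_of_lt hi, zero_add,
    Nat.add_mul_mod_self_right, Nat.mod_eq_of_lt hi]

lemma norm_birkSum_blockSeq_sub_le {A E : Type*} [NormedAddCommGroup E] {ψ : (ℕ → A) → E} {α : E}
    {B J : ℕ} (hB : 0 < B) {c δ : ℝ} (hδ : 0 ≤ δ) (hc : ∀ ω, ‖ψ ω‖ ≤ c)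
    (hvar : ∀ ω ω' : ℕ → A, (∀ p < B, ω p = ω' p) → ‖birkSum ψ B ω - birkSum ψ B ω'‖ ≤ δ * B)
    {y : ℕ → ℕ → A} (hy : ∀ j < J, ‖birkSum ψ B (y j) - B • α‖ ≤ δ * B) {ω : ℕ → A}
    (hω : ∀ p < J * B, ω p = blockSeq B y p) {n : ℕ} (hn : n ≤ J * B) :
    ‖birkSum ψ n ω - n • α‖ ≤ 2 * δ * n + B * (c + ‖α‖) := by
  have hc0 : 0 ≤ c := (norm_nonneg _).trans (hc ω)
  set m := n / B with hm
  have hmn : m * B + n % B = n := by rw [mul_comm]; exact Nat.div_add_mod n B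
  have hblock : ∀ b ∈ Finset.range m,
      ‖birkSum ψ B (shiftMap^[b * B] ω) - B • α‖ ≤ 2 * δ * B := by
    intro b hb
    have hbm : (b + 1) * B ≤ m * B := Nat.mul_le_mul_right _ (Finset.mem_range.1 hb)
    rw [add_one_mul] at hbm
    have hbJ : b < J := by
      by_contra! h
      have := Nat.mul_le_mul_right B h
      omega
    have h1 := hvar (shiftMap^[b * B] ω) (y b) fun p hp => by
      rw [shiftMap_iterate, hω _ (by omega), Nat.add_comm, blockSeq_mul_add hp]
    have h2 := norm_sub_le_norm_sub_add_norm_sub (birkSum ψ B (shiftMap^[b * B] ω))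
      (birkSum ψ B (y b)) (B • α)
    linarith [hy b hbJ]
  have hsplit : birkSum ψ n ω - n • α =
      ∑ b ∈ Finset.range m, (birkSum ψ B (shiftMap^[b * B] ω) - B • α) +
        (birkSum ψ (n % B) (shiftMap^[m * B] ω) - (n % B) • α) := by
    conv_lhs => rw [← hmn, birkSum_add, birkSum_mul, add_nsmul, mul_nsmul']
    rw [Finset.sum_sub_distrib, Finset.sum_const, Finset.card_range]
    abel
  have hmod : ((n % B : ℕ) : ℝ) ≤ B := by exact_mod_cast (Nat.mod_lt n hB).le
  have hmB : (m : ℝ) * B ≤ n := by exact_mod_cast (by omega : m * B ≤ n)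
  rw [hsplit]
  refine (norm_add_le _ _).trans ?_
  refine add_le_add ((norm_sum_le_of_le _ hblock).trans ?_) ?_
  · rw [Finset.sum_const, Finset.card_range, nsmul_eq_mul]
    nlinarith
  · refine (norm_sub_le _ _).trans ?_
    have h1 := birkSum_norm_le hc (n % B) (shiftMap^[m * B] ω)
    have h2 := norm_nsmul_le (n := n % B) (a := α)
    nlinarith [norm_nonneg α]

lemma tendsto_of_eventually_norm_birkSum_sub_le {A E : Type*} [NormedAddCommGroup E]
    [NormedSpace ℝ E] {ψ : (ℕ → A) → E} {α : E} {ω : ℕ → A}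
    (h : ∀ δ > 0, ∀ᶠ n : ℕ in atTop, ‖birkSum ψ n ω - n • α‖ ≤ δ * n) :
    Tendsto (fun n : ℕ => (n : ℝ)⁻¹ • birkSum ψ n ω) atTop (𝓝 α) := by
  refine Metric.nhds_basis_closedBall.tendsto_right_iff.2 fun δ hδ => ?_
  filter_upwards [h δ hδ, eventually_gt_atTop 0] with n hn h0
  have hn0 : (0 : ℝ) < n := by exact_mod_cast h0
  have heq : (n : ℝ)⁻¹ • birkSum ψ n ω - α = (n : ℝ)⁻¹ • (birkSum ψ n ω - n • α) := by
    rw [smul_sub, ← Nat.cast_smul_eq_nsmul ℝ, inv_smul_smul₀ hn0.ne']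
  rw [mem_closedBall, dist_eq_norm, heq, norm_smul, norm_inv, Real.norm_of_nonneg hn0.le,
    inv_mul_le_iff₀ hn0, mul_comm]
  exact hn

variable {d : ℕ} {a : Fin (d + 1) → ℕ}

lemma sum_range_comp_eq_sum_prevVal {x : Fin (d + 1) → ℕ} (hx : Monotone x)
    {κ : ℕ → Fin (d + 1)} (hκ : ∀ j < x (Fin.last d), prevVal x (κ j) ≤ j ∧ j < x (κ j))
    (f : Fin (d + 1) → ℝ) :
    ∑ j ∈ Finset.range (x (Fin.last d)), f (κ j) = ∑ k, ((x k - prevVal x k : ℕ) : ℝ) * f k := by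
  rw [← Finset.sum_fiberwise (Finset.range (x (Fin.last d))) κ]
  refine Finset.sum_congr rfl fun k _ => ?_
  have hfilter : (Finset.range (x (Fin.last d))).filter (fun j => κ j = k) =
      Finset.Ico (prevVal x k) (x k) := by
    ext j
    simp only [Finset.mem_filter, Finset.mem_range, Finset.mem_Ico]
    constructor
    · rintro ⟨hj, rfl⟩
      exact hκ j hj
    · rintro ⟨h1, h2⟩
      have hj := h2.trans_le (hx (Fin.le_last k))
      exact ⟨hj, eq_of_prevVal_le_lt hx (hκ j hj).1 (hκ j hj).2 h1 h2⟩
  rw [hfilter, Finset.sum_congr rfl fun j hj => ?_, Finset.sum_const, Nat.card_Ico, nsmul_eq_mul]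
  rw [← hfilter, Finset.mem_filter] at hj
  rw [hj.2]

/-- The number of blocks of length `B` starting at time `T` that fit below scale `exp (-t)`. -/
def blockCount (a : Fin (d + 1) → ℕ) (T B : ℕ) (t : ℝ) (q : Fin (d + 1)) : ℕ :=
  (digitCount a t q - T) / B

lemma monotone_blockCount (ha : StrictAnti a) (ha2 : ∀ q, 2 ≤ a q) (T B : ℕ) {t : ℝ} (ht : 0 ≤ t) :
    Monotone (blockCount a T B t) := fun _ _ hpq =>
  Nat.div_le_div_right (Nat.sub_le_sub_right (monotone_digitCount ha ha2 ht hpq) T)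

lemma tendsto_blockCount_div (ha2 : ∀ q, 2 ≤ a q) (T : ℕ) {B : ℕ} (hB : 0 < B) (q : Fin (d + 1)) :
    Tendsto (fun t => (blockCount a T B t q : ℝ) / (t / B)) atTop (𝓝 (1 / Real.log (a q))) := by
  have h := tendsto_digitCount_div ha2 q
  have h' : Tendsto (fun t => (digitCount a t q : ℝ) / t - (T + B) / t) atTop
      (𝓝 (1 / Real.log (a q))) := by
    simpa using h.sub ((tendsto_const_nhds (x := (T + B : ℝ))).div_atTop tendsto_id)
  have hB' : (0 : ℝ) < B := by exact_mod_cast hB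
  refine tendsto_of_tendsto_of_tendsto_of_le_of_le' h' h ?_ ?_
  · filter_upwards [eventually_gt_atTop 0] with t ht
    rw [div_div_eq_mul_div, ← sub_div, div_le_div_iff_of_pos_right ht]
    have h1 := Nat.lt_div_mul_add (a := digitCount a t q - T) hB
    have h2 : digitCount a t q ≤ blockCount a T B t q * B + (T + B) := by
      rw [blockCount]; omega
    have h3 : (digitCount a t q : ℝ) ≤ blockCount a T B t q * B + (T + B) := by exact_mod_cast h2
    linarith
  · filter_upwards [eventually_gt_atTop 0] with t ht
    rw [div_div_eq_mul_div, div_le_div_iff_of_pos_right ht]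
    have h1 := Nat.div_mul_le_self (digitCount a t q - T) B
    have h2 : blockCount a T B t q * B ≤ digitCount a t q := by
      rw [blockCount]; omega
    exact_mod_cast h2

end LowerBound

section Avoidance

variable {d : ℕ} {a : Fin (d + 1) → ℕ}

/-- At most `12 ^ (d + 1)` blocks per ball have codes in the same ball of a cover, when every
block of each coordinate is resolved at the scale of the balls. -/
lemma card_le_mul_coverN {A V : Type*} [Fintype V] (ha2 : ∀ q, 2 ≤ a q)
    (dig : A → ∀ q, Fin (a q)) {t : ℝ} (ht : 0 ≤ t) {L : Fin (d + 1) → ℕ}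
    (hL : ∀ q, L q ≤ digitCount a t q) {C : Set (Fin (d + 1) → AddCircle (1 : ℝ))}
    (Ω : V → ℕ → A) (hΩ : ∀ v, codePoint dig (Ω v) ∈ C)
    (hinj : ∀ v v', (∀ q, ∀ i < L q, dig (Ω v i) q = dig (Ω v' i) q) → v = v') :
    Fintype.card V ≤ 12 ^ (d + 1) * coverN C (Real.exp (-t)) := by
  classical
  obtain ⟨S, hScard, hS⟩ := exists_finset_card_eq_coverN C (Real.exp_pos (-t))
  have hcen : ∀ v, ∃ x ∈ S, dist (codePoint dig (Ω v)) x < Real.exp (-t) := fun v => by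
    obtain ⟨x, hx, hdist⟩ := mem_iUnion₂.1 (hS (hΩ v))
    exact ⟨x, hx, hdist⟩
  choose c hcS hc using hcen
  rw [← hScard, ← Finset.card_univ]
  refine Finset.card_le_mul_card_image_of_maps_to (f := c) (fun v _ => hcS v) _ fun x _ => ?_
  have hnear := ncard_words_near_le (fun q => by linarith [ha2 q] : ∀ q, 0 < a q) L x
  rw [Fintype.card_fin] at hnear
  refine le_trans ?_ hnear
  rw [← Set.ncard_coe_finset]
  refine Set.ncard_le_ncard_of_injOn (fun v q (i : Fin (L q)) => dig (Ω v i) q) ?_ ?_ (toFinite _)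
  · intro v hv
    have hvx : c v = x := by simpa using hv
    refine ⟨fun n => dig (Ω v n), fun q i => rfl, fun q => ?_⟩
    refine le_trans ?_ (exp_neg_le_inv_pow ha2 ht (hL q))
    rw [← hvx]
    exact (dist_le_pi_dist (codePoint dig (Ω v)) (c v) q).trans (hc v).le
  · intro v _ v' _ h
    exact hinj v v' fun q i hi => congrFun (congrFun h q) ⟨i, hi⟩

lemma exists_blocks_avoiding {A E : Type*} [Finite A] [NormedAddCommGroup E]
    (ha : StrictAnti a) (ha2 : ∀ q, 2 ≤ a q) (dig : A → ∀ q, Fin (a q)) {ψ : (ℕ → A) → E} {α : E}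
    {h : Fin (d + 1) → ℝ} {B : ℕ} (hB : 0 < B) {δ : ℝ}
    (hgood : ∀ k, Real.exp (B * h k) ≤ (goodWords (tailDigit dig k) ψ α B δ).ncard)
    (ω₀ : ℕ → A) (T Q : ℕ) {C : Set (Fin (d + 1) → AddCircle (1 : ℝ))}
    (hC : upperBoxDim C < dimCombo a h) :
    ∃ J ≥ Q, ∃ y : ℕ → ℕ → A, (∀ j < J, ‖birkSum ψ B (y j) - B • α‖ ≤ δ * B) ∧
      ∀ ω, (∀ p < T + J * B, ω p = splice T ω₀ (blockSeq B y) p) → codePoint dig ω ∉ C := by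
  classical
  have hB' : (0 : ℝ) < B := by exact_mod_cast hB
  obtain ⟨s, hCs, hs⟩ := exists_between hC
  set x : ℝ → Fin (d + 1) → ℕ := fun t => blockCount a T B t with hx
  have hxlim := tendsto_blockCount_div ha2 T hB
  have hmono : ∀ᶠ t : ℝ in atTop, Monotone (x t) := by
    filter_upwards [eventually_ge_atTop 0] with t ht
    exact monotone_blockCount ha ha2 T B ht
  have hlim : Tendsto (fun t : ℝ => ∑ k, ((x t k - prevVal (x t) k : ℕ) : ℝ) / (t / B) * h k) atTop
      (𝓝 (dimCombo a h)) := by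
    rw [dimCombo_eq_sum]
    exact tendsto_finsetSum _ fun k _ =>
      (tendsto_sub_prevVal_div hxlim hmono k).mul_const _
  have hlim' : Tendsto (fun t : ℝ => s + ((d + 1) * Real.log 12) / t) atTop (𝓝 s) := by
    simpa using (tendsto_const_nhds (x := s)).add
      ((tendsto_const_nhds (x := ((d + 1) * Real.log 12 : ℝ))).div_atTop tendsto_id)
  have hcov : ∀ᶠ t : ℝ in atTop,
      Real.log (coverN C (Real.exp (-t))) / Real.log (Real.exp (-t))⁻¹ < s := by
    have hexp : Tendsto (fun t : ℝ => Real.exp (-t)) atTop (𝓝[>] 0) :=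
      tendsto_nhdsWithin_iff.2 ⟨Real.tendsto_exp_neg_atTop_nhds_zero,
        Eventually.of_forall fun t => Real.exp_pos _⟩
    exact hexp.eventually (eventually_logRatio_lt ha2 hCs)
  have hbig : ∀ᶠ t : ℝ in atTop, Q ≤ x t (Fin.last d) :=
    (tendsto_natCast_atTop_of_div (one_div_pos.2 (log_digit_pos ha2 _))
      (tendsto_id.atTop_div_const hB') (hxlim (Fin.last d))).eventually_ge_atTop _
  have hT : ∀ᶠ t : ℝ in atTop, ∀ q, T ≤ digitCount a t q := eventually_all.2 fun q =>
    (tendsto_natCast_atTop_of_div (one_div_pos.2 (log_digit_pos ha2 _)) tendsto_id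
      (tendsto_digitCount_div ha2 q)).eventually_ge_atTop _
  obtain ⟨t, hmono, hlt, hcov, hbig, hT, ht⟩ := (hmono.and ((hlim'.eventually_lt hlim hs).and
    (hcov.and (hbig.and (hT.and (eventually_gt_atTop 0)))))).exists
  rw [Real.log_inv, Real.log_exp, neg_neg, div_lt_iff₀ ht] at hcov
  set J := x t (Fin.last d) with hJ
  have hκ : ∀ j, ∃ k, j < J → prevVal (x t) k ≤ j ∧ j < x t k := fun j => by
    by_cases hj : j < J
    · obtain ⟨k, hk⟩ := exists_prevVal_le_lt (x t) hj
      exact ⟨k, fun _ => hk⟩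
    · exact ⟨0, fun h => absurd h hj⟩
  choose κ hκ using hκ
  let V := ∀ j : Fin J, goodWords (tailDigit dig (κ j)) ψ α B δ
  let _ : Fintype V := Fintype.ofFinite V
  choose w hw hwu using fun (j : Fin J) (u : goodWords (tailDigit dig (κ j)) ψ α B δ) => u.2
  let Y : V → ℕ → ℕ → A := fun v j => if hj : j < J then w ⟨j, hj⟩ (v ⟨j, hj⟩) else ω₀
  have hYval : ∀ v (j : Fin J), Y v j = w j (v j) := fun v j => dif_pos j.2
  by_contra! hcon
  have hΩ : ∀ v : V, ∃ ω, (∀ p < T + J * B, ω p = splice T ω₀ (blockSeq B (Y v)) p) ∧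
      codePoint dig ω ∈ C := fun v => hcon J hbig (Y v) fun j hj => by
    rw [hYval v ⟨j, hj⟩]
    exact hw _ _
  choose Ω hΩ hΩC using hΩ
  have hcard := card_le_mul_coverN ha2 dig ht.le (L := fun q => T + x t q * B) (fun q => by
    have h1 := Nat.div_mul_le_self (digitCount a t q - T) B
    have h2 := hT q
    simp only [hx, blockCount]
    omega) Ω hΩC (fun v v' hvv' => by
      funext j
      refine Subtype.ext (funext fun i => funext fun q => ?_)
      have hq : j + 1 ≤ x t q.1 := (hκ j j.2).2.trans_le (hmono q.2)
      have hqB := Nat.mul_le_mul_right B hq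
      have hjB := Nat.mul_le_mul_right B (Nat.succ_le_of_lt j.2)
      rw [Nat.succ_eq_add_one] at hjB
      rw [add_one_mul] at hqB hjB
      have := hvv' q.1 (T + (j * B + i)) (by omega)
      rw [hΩ v _ (by omega), hΩ v' _ (by omega), splice_add, splice_add, blockSeq_mul_add i.2,
        blockSeq_mul_add i.2, hYval, hYval] at this
      rw [← hwu j (v j) i, ← hwu j (v' j) i]
      exact this)
  have hcardV : Real.exp (∑ k, ((x t k - prevVal (x t) k : ℕ) : ℝ) * (B * h k)) ≤
      Fintype.card V := by
    rw [← sum_range_comp_eq_sum_prevVal hmono (κ := κ) hκ, Real.exp_sum,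
      ← Fin.prod_univ_eq_prod_range (fun j => Real.exp (B * h (κ j)))]
    have : Fintype.card V = ∏ j : Fin J, (goodWords (tailDigit dig (κ j)) ψ α B δ).ncard := by
      rw [← Nat.card_eq_fintype_card, Nat.card_pi]
      rfl
    rw [this, Nat.cast_prod]
    exact Finset.prod_le_prod (fun _ _ => (Real.exp_pos _).le) fun j _ => hgood _
  have hle := hcardV.trans (by exact_mod_cast hcard : (Fintype.card V : ℝ) ≤
    12 ^ (d + 1) * (coverN C (Real.exp (-t)) : ℝ))
  have hpos : (0 : ℝ) < coverN C (Real.exp (-t)) := by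
    have := (Real.exp_pos _).trans_le hle
    exact pos_of_mul_pos_right this (by positivity)
  have hlog := Real.log_le_log (Real.exp_pos _) hle
  rw [Real.log_exp, Real.log_mul (by positivity) hpos.ne', Real.log_pow] at hlog
  have hsum : (∑ k, ((x t k - prevVal (x t) k : ℕ) : ℝ) / (t / B) * h k) * t =
      ∑ k, ((x t k - prevVal (x t) k : ℕ) : ℝ) * (B * h k) := by
    rw [Finset.sum_mul]
    exact Finset.sum_congr rfl fun k _ => by field_simp
  have hlt' := mul_lt_mul_of_pos_right hlt ht
  rw [hsum, add_mul, div_mul_cancel₀ _ ht.ne'] at hlt'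
  push_cast at hlog
  linarith

end Avoidance

section Iteration

lemma exists_limit_of_agree {A : Type*} (s : ℕ → ℕ × (ℕ → A)) (hT : ∀ i, (s i).1 ≤ (s (i + 1)).1)
    (hlow : ∀ i, i ≤ (s i).1) (h : ∀ i, ∀ p < (s i).1, (s (i + 1)).2 p = (s i).2 p) :
    ∃ ω : ℕ → A, ∀ i, ∀ p < (s i).1, ω p = (s i).2 p := by
  have hmono : Monotone fun i => (s i).1 := monotone_nat_of_le_succ hT
  have hagree : ∀ i j, i ≤ j → ∀ p < (s i).1, (s j).2 p = (s i).2 p := by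
    intro i j hij
    induction j, hij using Nat.le_induction with
    | base => exact fun _ _ => rfl
    | succ j hij ih => exact fun p hp => (h j p (hp.trans_le (hmono hij))).trans (ih p hp)
  refine ⟨fun p => (s (p + 1)).2 p, fun i p hp => ?_⟩
  rcases le_total i (p + 1) with hi | hi
  · exact hagree _ _ hi p hp
  · exact (hagree _ _ hi p (hlow (p + 1))).symm

variable {d : ℕ} {a : Fin (d + 1) → ℕ} {A : Type*} [TopologicalSpace A] [DiscreteTopology A]
  [Finite A] {E : Type*} [NormedAddCommGroup E]

lemma exists_extension_avoiding (ha : StrictAnti a) (ha2 : ∀ q, 2 ≤ a q)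
    (dig : A → ∀ q, Fin (a q)) {ψ : (ℕ → A) → E} (hψ : Continuous ψ) {α : E}
    {h : Fin (d + 1) → ℝ} {δ : ℝ} (hδ : 0 < δ)
    (hgood : ∀ B₀ : ℕ, ∃ B ≥ B₀, ∀ k,
      Real.exp (B * h k) ≤ (goodWords (tailDigit dig k) ψ α B δ).ncard) :
    ∃ K : ℝ, ∀ (ω₀ : ℕ → A) (T Q : ℕ) (C : Set (Fin (d + 1) → AddCircle (1 : ℝ))),
      upperBoxDim C < dimCombo a h → ∃ P : ℕ, Q ≤ P ∧ T ≤ P ∧ ∃ ω₁ : ℕ → A,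
        (∀ p < T, ω₁ p = ω₀ p) ∧ ∀ ω : ℕ → A, (∀ p < P, ω p = ω₁ p) →
          codePoint dig ω ∉ C ∧ ∀ n, T ≤ n → n ≤ P →
            ‖birkSum ψ n ω - n • α‖ ≤ ‖birkSum ψ T ω - T • α‖ + 2 * δ * n + K := by
  obtain ⟨c, -, hc⟩ := exists_norm_le_of_continuous hψ
  obtain ⟨M, hM⟩ := exists_birkSum_sub_le hψ hδ
  obtain ⟨B, hBM, hB⟩ := hgood (max M 1)
  have hB0 : 0 < B := (le_max_right M 1).trans hBM
  refine ⟨B * (c + ‖α‖), fun ω₀ T Q C hC => ?_⟩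
  obtain ⟨J, hJ, y, hy, havoid⟩ := exists_blocks_avoiding ha ha2 dig hB0 hB ω₀ T Q hC
  refine ⟨T + J * B, ?_, Nat.le_add_right _ _, splice T ω₀ (blockSeq B y),
    fun p hp => splice_of_lt hp _ _, fun ω hω => ⟨havoid ω hω, fun n hTn hnP => ?_⟩⟩
  · exact (hJ.trans (Nat.le_mul_of_pos_right J hB0)).trans (Nat.le_add_left _ _)
  obtain ⟨l, rfl⟩ := Nat.exists_eq_add_of_le hTn
  have hl := norm_birkSum_blockSeq_sub_le hB0 hδ.le hc (hM B ((le_max_left M 1).trans hBM)) hy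
    (ω := shiftMap^[T] ω) (fun p hp => by
      rw [shiftMap_iterate, hω _ (by omega), Nat.add_comm, splice_add])
    (n := l) (by omega)
  have heq : birkSum ψ (T + l) ω - (T + l) • α =
      (birkSum ψ T ω - T • α) + (birkSum ψ l (shiftMap^[T] ω) - l • α) := by
    rw [birkSum_add, add_nsmul]; abel
  rw [heq]
  refine (norm_add_le _ _).trans ?_
  push_cast
  nlinarith [(Nat.cast_nonneg T : (0 : ℝ) ≤ T)]

variable [NormedSpace ℝ E]

lemma exists_mem_codeLevel_notMem (ha : StrictAnti a) (ha2 : ∀ q, 2 ≤ a q) [Nonempty A]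
    (dig : A → ∀ q, Fin (a q)) {ψ : (ℕ → A) → E} (hψ : Continuous ψ) {α : E}
    {h : Fin (d + 1) → ℝ}
    (hgood : ∀ δ > 0, ∀ B₀ : ℕ, ∃ B ≥ B₀, ∀ k,
      Real.exp (B * h k) ≤ (goodWords (tailDigit dig k) ψ α B δ).ncard)
    (C : ℕ → Set (Fin (d + 1) → AddCircle (1 : ℝ)))
    (hC : ∀ n, upperBoxDim (C n) < dimCombo a h) : ∃ x ∈ codeLevel dig ψ α, ∀ n, x ∉ C n := by
  obtain ⟨c, -, hc⟩ := exists_norm_le_of_continuous hψ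
  have hδ : ∀ i : ℕ, 0 < 1 / ((i : ℝ) + 1) := fun i => by positivity
  choose K hK using fun i : ℕ => exists_extension_avoiding ha ha2 dig hψ (hδ i)
    (hgood _ (hδ i))
  have hQ : ∀ (i T : ℕ), ∃ Q : ℕ, i + 1 ≤ Q ∧ T * (c + ‖α‖) + K i ≤ 1 / ((i : ℝ) + 1) * Q ∧
      K (i + 1) ≤ 1 / (((i + 1 : ℕ) : ℝ) + 1) * Q := fun i T => by
    have hlim : ∀ j : ℕ, Tendsto (fun Q : ℕ => 1 / ((j : ℝ) + 1) * Q) atTop atTop := fun j =>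
      tendsto_natCast_atTop_atTop.const_mul_atTop (hδ j)
    exact ((eventually_ge_atTop (i + 1)).and (((hlim i).eventually_ge_atTop _).and
      ((hlim (i + 1)).eventually_ge_atTop _))).exists
  choose Q hQi hQ1 hQ2 using hQ
  choose P hPQ hPT Ω hagree hΩ using fun (i : ℕ) (s : ℕ × (ℕ → A)) =>
    hK i s.2 s.1 (Q i s.1) (C i) (hC i)
  let ω₀ : ℕ → A := fun _ => Classical.arbitrary A
  let s : ℕ → ℕ × (ℕ → A) := fun i =>
    Nat.rec ((0, ω₀) : ℕ × (ℕ → A)) (fun i s => (P i s, Ω i s)) i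
  obtain ⟨ω, hω⟩ := exists_limit_of_agree s (fun i => hPT i (s i))
    (fun i => by
      cases i with
      | zero => exact Nat.zero_le _
      | succ i => exact (hQi i _).trans (hPQ i (s i)))
    (fun i => hagree i (s i))
  have hstep := fun i => hΩ i (s i) ω (hω (i + 1))
  refine ⟨codePoint dig ω, ⟨ω, rfl, tendsto_of_eventually_norm_birkSum_sub_le fun ε hε => ?_⟩,
    fun n => (hstep n).1⟩
  have hs1 : ∀ i, (s i).1 ≤ (s (i + 1)).1 := fun i => hPT i (s i)
  have hcrude : ∀ n : ℕ, ‖birkSum ψ n ω - n • α‖ ≤ n * (c + ‖α‖) := fun n => by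
    refine (norm_sub_le _ _).trans ?_
    rw [mul_add]
    exact add_le_add (birkSum_norm_le hc n ω) norm_nsmul_le
  have hend : ∀ i, ‖birkSum ψ (s (i + 1)).1 ω - (s (i + 1)).1 • α‖ ≤
      3 * (1 / ((i : ℝ) + 1)) * (s (i + 1)).1 := fun i => by
    have h1 := (hstep i).2 _ (hs1 i) le_rfl
    have h2 := hcrude (s i).1
    have h3 : (Q i (s i).1 : ℝ) ≤ (s (i + 1)).1 := by exact_mod_cast hPQ i (s i)
    have h4 := mul_le_mul_of_nonneg_left h3 (hδ i).le
    have h5 := hQ1 i (s i).1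
    change _ ≤ _ + 2 * (1 / ((i : ℝ) + 1)) * ((s (i + 1)).1 : ℝ) + _ at h1
    linarith
  have hmid : ∀ i n, (s (i + 1)).1 ≤ n → n ≤ (s (i + 2)).1 →
      ‖birkSum ψ n ω - n • α‖ ≤ 6 * (1 / ((i : ℝ) + 1)) * n := fun i n hn1 hn2 => by
    have h1 := (hstep (i + 1)).2 n hn1 hn2
    have h2 := hend i
    have h3 : (Q i (s i).1 : ℝ) ≤ n := by exact_mod_cast (hPQ i (s i)).trans hn1
    have h4 := mul_le_mul_of_nonneg_left h3 (hδ (i + 1)).le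
    have h5 := hQ2 i (s i).1
    have h6 : ((s (i + 1)).1 : ℝ) ≤ n := by exact_mod_cast hn1
    have h7 := mul_le_mul_of_nonneg_left h6 (hδ i).le
    have h8 : 1 / (((i + 1 : ℕ) : ℝ) + 1) ≤ 1 / ((i : ℝ) + 1) :=
      one_div_le_one_div_of_le (by positivity) (by push_cast; linarith)
    have h9 := mul_le_mul_of_nonneg_right h8 (Nat.cast_nonneg n : (0 : ℝ) ≤ n)
    linarith
  obtain ⟨i₀, hi₀⟩ := exists_nat_one_div_lt (div_pos hε (by norm_num : (0 : ℝ) < 6))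
  filter_upwards [eventually_ge_atTop (s (i₀ + 1)).1] with n hn
  obtain ⟨i, hi₀i, hi1, hi2⟩ : ∃ i, i₀ ≤ i ∧ (s (i + 1)).1 ≤ n ∧ n ≤ (s (i + 2)).1 := by
    by_contra! hcon
    have hall : ∀ i ≥ i₀, (s (i + 1)).1 ≤ n := fun i hi => by
      induction i, hi using Nat.le_induction with
      | base => exact hn
      | succ i hi ih => exact (hcon i hi ih).le
    have h1 := hall (max i₀ n) (le_max_left _ _)
    have h2 := (hQi (max i₀ n) _).trans (hPQ (max i₀ n) (s (max i₀ n)))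
    have h3 := (le_max_right i₀ n)
    have h4 : max i₀ n + 1 ≤ (s (max i₀ n + 1)).1 := h2
    omega
  refine (hmid i n hi1 hi2).trans ?_
  have h1 : 1 / ((i : ℝ) + 1) ≤ 1 / ((i₀ : ℝ) + 1) :=
    one_div_le_one_div_of_le (by positivity) (by have : (i₀ : ℝ) ≤ i := by exact_mod_cast hi₀i
                                                 linarith)
  gcongr
  linarith

lemma le_packingDim_codeLevel (ha : StrictAnti a) (ha2 : ∀ q, 2 ≤ a q) [Nonempty A]
    (dig : A → ∀ q, Fin (a q)) {ψ : (ℕ → A) → E} (hψ : Continuous ψ) {α : E}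
    {h : Fin (d + 1) → ℝ}
    (hgood : ∀ δ > 0, ∀ B₀ : ℕ, ∃ B ≥ B₀, ∀ k,
      Real.exp (B * h k) ≤ (goodWords (tailDigit dig k) ψ α B δ).ncard) :
    dimCombo a h ≤ packingDim (codeLevel dig ψ α) := by
  obtain ⟨K, hK⟩ := exists_upperBoxDim_le ha2
  have : Nonempty {C : ℕ → Set (Fin (d + 1) → AddCircle (1 : ℝ)) //
      codeLevel dig ψ α ⊆ ⋃ n, C n} :=
    ⟨⟨fun _ => univ, fun x _ => mem_iUnion.2 ⟨0, mem_univ x⟩⟩⟩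
  refine le_ciInf fun C => ?_
  by_contra! hlt
  obtain ⟨x, hx, hxC⟩ := exists_mem_codeLevel_notMem ha ha2 dig hψ hgood C.1 fun n =>
    (le_ciSup ⟨K, by rintro _ ⟨n, rfl⟩; exact hK _⟩ n).trans_lt hlt
  obtain ⟨n, hn⟩ := mem_iUnion.1 (C.2 hx)
  exact hxC n hn

end Iteration

/-! ### Symbolic description of the sponge -/

section Sponge

variable {d N : ℕ} {a : Fin (d + 1) → ℕ} {D : Finset (Fin (d + 1) → ℕ)}

/-- The digits in `D`, with their coordinates viewed as base-`a` digits. -/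
def spongeDigit (hD : ∀ v ∈ D, ∀ q, v q < a q) (v : {v // v ∈ D}) (q : Fin (d + 1)) : Fin (a q) :=
  ⟨v.1 q, hD v.1 v.2 q⟩

lemma coding_eq_codePoint (hD : ∀ v ∈ D, ∀ q, v q < a q) :
    coding a D = codePoint (spongeDigit hD) := by
  funext ω q
  simp only [coding, codePoint, digitPoint, Real.ofDigits, Real.ofDigitsTerm, spongeDigit,
    div_eq_mul_inv]

lemma sponge_eq_range_codePoint (hD : ∀ v ∈ D, ∀ q, v q < a q) :
    sponge a D = range (codePoint (spongeDigit hD)) := by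
  rw [sponge, coding_eq_codePoint hD]

lemma HkLevel_eq_sSup_levelEntropies (hD : ∀ v ∈ D, ∀ q, v q < a q)
    (φ : (Fin (d + 1) → AddCircle (1 : ℝ)) → Fin N → ℝ) (α : Fin N → ℝ) (k : Fin (d + 1)) :
    HkLevel a D φ α k =
      sSup (levelEntropies (fun q : ProjIdx d k => q.1) (spongeDigit hD) φ α) := by
  rw [HkLevel, levelEntropies, ← sponge_eq_range_codePoint hD]
  rfl

lemma birkhoffSeq_codePoint (hD : ∀ v ∈ D, ∀ q, v q < a q) (ha2 : ∀ q, 2 ≤ a q)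
    (φ : (Fin (d + 1) → AddCircle (1 : ℝ)) → Fin N → ℝ) (ω : ℕ → {v // v ∈ D}) (n : ℕ) :
    birkhoffSeq a φ (codePoint (spongeDigit hD) ω) n =
      (n : ℝ)⁻¹ • birkSum (φ ∘ codePoint (spongeDigit hD)) n ω := by
  rw [birkhoffSeq, birkSum]
  congr 1
  refine Finset.sum_congr rfl fun i _ => congrArg φ ?_
  exact torusMul_iterate_codePoint (spongeDigit hD) (fun q => by linarith [ha2 q]) i ω

lemma birkhoffLevel_eq_codeLevel (hD : ∀ v ∈ D, ∀ q, v q < a q) (ha2 : ∀ q, 2 ≤ a q)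
    (φ : (Fin (d + 1) → AddCircle (1 : ℝ)) → Fin N → ℝ) (α : Fin N → ℝ) :
    birkhoffLevel a D φ α = codeLevel (spongeDigit hD) (φ ∘ codePoint (spongeDigit hD)) α := by
  ext x
  rw [birkhoffLevel, sponge_eq_range_codePoint hD]
  constructor
  · rintro ⟨⟨ω, rfl⟩, h⟩
    exact ⟨ω, rfl, h.congr fun n => birkhoffSeq_codePoint hD ha2 φ ω n⟩
  · rintro ⟨ω, rfl, h⟩
    exact ⟨⟨ω, rfl⟩, h.congr fun n => (birkhoffSeq_codePoint hD ha2 φ ω n).symm⟩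

lemma goodWords_mono {A B E : Type*} [NormedAddCommGroup E] (π : A → B) (ψ : (ℕ → A) → E) (α : E)
    (m : ℕ) {δ δ' : ℝ} (h : δ ≤ δ') : goodWords π ψ α m δ ⊆ goodWords π ψ α m δ' := by
  rintro u ⟨ω, h1, h2⟩
  exact ⟨ω, h1.trans (mul_le_mul_of_nonneg_right h (Nat.cast_nonneg m)), h2⟩

lemma ksEntropy_nonneg {X : Type*} [MeasurableSpace X] (T : X → X) (μ : Measure X)
    [IsProbabilityMeasure μ] : 0 ≤ ksEntropy T μ :=
  Real.iSup_nonneg fun _ => Real.iSup_nonneg fun _ => Real.iInf_nonneg fun n =>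
    mul_nonneg (by positivity) (Finset.sum_nonneg fun _ _ =>
      Real.negMulLog_nonneg ENNReal.toReal_nonneg (by
        rw [← Measure.real_def]; exact measureReal_le_one))

lemma dimCombo_add_const (a : Fin (d + 1) → ℕ) (H : Fin (d + 1) → ℝ) (ε : ℝ) :
    dimCombo a (fun k => H k + ε) = dimCombo a H + dimCombo a (fun _ => 1) * ε := by
  simp only [dimCombo_eq_sum, Finset.sum_mul, ← Finset.sum_add_distrib]
  exact Finset.sum_congr rfl fun k _ => by ring

lemma tendsto_dimCombo_add_const (a : Fin (d + 1) → ℕ) (H : Fin (d + 1) → ℝ) :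
    Tendsto (fun ε : ℝ => dimCombo a fun k => H k + ε) (𝓝 0) (𝓝 (dimCombo a H)) := by
  simp only [dimCombo_add_const]
  have : Continuous fun ε : ℝ => dimCombo a H + dimCombo a (fun _ => 1) * ε := by fun_prop
  simpa using this.tendsto 0

end Sponge

/-- **Theorem (packing spectrum of Birkhoff averages on a self-affine Sierpiński sponge).**
For every `α ∈ A(φ)`,
`dim_P E_φ(α) = H^1(f,φ,α)/log a_1 + Σ_{k=2}^d (1/log a_k − 1/log a_{k−1}) H^k(f,φ,α)`. -/
theorem packingDim_birkhoffLevel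
    {d N : ℕ} (a : Fin (d + 1) → ℕ) (ha : StrictAnti a) (ha2 : ∀ q, 2 ≤ a q)
    (D : Finset (Fin (d + 1) → ℕ)) (hD : ∀ v ∈ D, ∀ q, v q < a q) (hDne : D.Nonempty)
    (φ : (Fin (d + 1) → AddCircle (1 : ℝ)) → (Fin N → ℝ))
    (hφ : ContinuousOn φ (sponge a D)) :
    ∀ α : Fin N → ℝ,
      (∃ μ : ProbabilityMeasure (Fin (d + 1) → AddCircle (1 : ℝ)), MemSpongeInv a D μ ∧
        (∫ x, φ x ∂(μ : Measure (Fin (d + 1) → AddCircle (1 : ℝ)))) = α) →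
      packingDim (birkhoffLevel a D φ α) = dimCombo a (HkLevel a D φ α) := by
  classical
  rintro α ⟨μ, hμ, hμα⟩
  have : Nonempty {v // v ∈ D} := hDne.to_subtype
  set dig := spongeDigit hD with hdig
  have hΛ := sponge_eq_range_codePoint hD
  have hb : ∀ q, 0 < a q := fun q => by linarith [ha2 q]
  rw [hΛ] at hφ
  have hψ : Continuous (φ ∘ codePoint dig) :=
    hφ.comp_continuous (continuous_codePoint dig) fun ω => mem_range_self ω
  set H := HkLevel a D φ α with hH
  have hHeq : ∀ k, H k = sSup (levelEntropies (fun q : ProjIdx d k => q.1) dig φ α) :=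
    HkLevel_eq_sSup_levelEntropies hD φ α
  have hne : ∀ k : Fin (d + 1),
      (levelEntropies (fun q : ProjIdx d k => q.1) dig φ α).Nonempty := fun k => by
    refine ⟨_, μ, ⟨hμ.1, ?_⟩, hμα, rfl⟩
    rw [← hΛ]
    exact hμ.2
  have hH0 : ∀ k, 0 ≤ H k := fun k => by
    rw [hHeq]
    refine Real.sSup_nonneg ?_
    rintro _ ⟨ν, -, -, rfl⟩
    have := Measure.isProbabilityMeasure_map (μ := (ν : Measure (Fin (d + 1) → AddCircle (1 : ℝ))))
      (f := coordProj fun q : ProjIdx d k => q.1)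
      (measurable_pi_lambda _ fun q => measurable_pi_apply _).aemeasurable
    exact ksEntropy_nonneg _ _
  rw [birkhoffLevel_eq_codeLevel hD ha2]
  refine le_antisymm ?_ ?_
  · refine ge_of_tendsto ((tendsto_dimCombo_add_const a H).mono_left
      (nhdsWithin_le_nhds (s := Ioi 0))) ?_
    filter_upwards [self_mem_nhdsWithin] with ε hε
    choose δ hδ M hM using fun k : Fin (d + 1) => ncard_goodWords_le_exp
      (fun q : ProjIdx d k => q.1) dig ha2 hφ α hε
    refine packingDim_codeLevel_le ha ha2 dig _ α
      (fun k => add_nonneg (hH0 k) (le_of_lt hε))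
      (δ := Finset.univ.inf' Finset.univ_nonempty δ) ?_ (M₀ := Finset.univ.sup M) fun k m hm => ?_
    · exact (Finset.lt_inf'_iff _).2 fun k _ => hδ k
    · rw [hHeq]
      refine le_trans ?_ (hM k m ((Finset.le_sup (Finset.mem_univ k)).trans hm))
      exact_mod_cast Set.ncard_le_ncard
        (goodWords_mono _ _ _ _ (Finset.inf'_le _ (Finset.mem_univ k))) (toFinite _)
  · refine le_of_tendsto ((tendsto_dimCombo_add_const a H).mono_left
      (nhdsWithin_le_nhds (s := Iio 0))) ?_
    filter_upwards [self_mem_nhdsWithin] with ε hε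
    refine le_packingDim_codeLevel ha ha2 dig hψ fun δ hδ B₀ => ?_
    choose M hM using fun k : Fin (d + 1) => exp_le_ncard_goodWords
      (fun q : ProjIdx d k => q.1) dig ha2 hφ (hne k) (neg_pos.2 hε) hδ
    let m := Finset.univ.sup M + 1
    choose n₀ hn₀ using fun k => hM k m ((Finset.le_sup (Finset.mem_univ k)).trans (Nat.le_succ _))
    let n := max (Finset.univ.sup n₀) B₀
    refine ⟨n * m, (le_max_right _ _).trans (Nat.le_mul_of_pos_right n (Nat.succ_pos _)),
      fun k => ?_⟩
    have := hn₀ k n ((Finset.le_sup (Finset.mem_univ k)).trans (le_max_left _ _))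
    rw [hHeq]
    rwa [sub_neg_eq_add, ← mul_assoc, ← Nat.cast_mul] at this

end
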